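/- arXiv:2106.02013 — 2 statements merged into one kernel-verified Lean document; each statement's English description precedes it below -/
import Mathlib

section
/- For every natural number d ≥ 2 there exists a d-regular measurably bipartite treeing T (an acyclic d-regular graphing admitting a Borel bipartition) such that: (i) every circulation f ∈ L¹(E(T)) is zero almost everywhere, i.e. ∫_V ∑_y |f(x,y)| dν(x) = 0; and (ii) T admits no measurable perfect matching. -/
/-- A graphing: a standard Borel probability space `(V, ν)` together with a symmetric
irreflexive Borel edge set `E ⊆ V × V` with finite degrees satisfying the
mass-transport (measure-preservation) identity. -/
structure Graphing where
  V : Type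
  [mV : MeasurableSpace V]
  [sb : StandardBorelSpace V]
  ν : MeasureTheory.Measure V
  [prob : MeasureTheory.IsProbabilityMeasure ν]
  E : Set (V × V)
  E_meas : MeasurableSet E
  symm : ∀ x y : V, (x, y) ∈ E → (y, x) ∈ E
  irrefl : ∀ x : V, (x, x) ∉ E
  locFin : ∀ x : V, {y : V | (x, y) ∈ E}.Finite
  massTransport : ∀ A B : Set V, MeasurableSet A → MeasurableSet B →
    ∫ x in A, ((Set.ncard {y ∈ B | (x, y) ∈ E} : ℝ)) ∂ν
      = ∫ x in B, ((Set.ncard {y ∈ A | (x, y) ∈ E} : ℝ)) ∂ν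

attribute [instance] Graphing.mV Graphing.sb Graphing.prob

open MeasureTheory

/-- The degree of a vertex. -/
noncomputable def Graphing.deg (G : Graphing) (x : G.V) : ℕ := {y : G.V | (x, y) ∈ G.E}.ncard

/-- `G` is `d`-regular. -/
def Graphing.IsRegular (G : Graphing) (d : ℕ) : Prop := ∀ x : G.V, G.deg x = d

/-- `G` is acyclic: there is no injective cyclic sequence `x₀, …, x_{k-1}` (`k ≥ 3`)
of consecutively adjacent vertices (indices mod `k`). -/
def Graphing.Acyclic (G : Graphing) : Prop :=
  ¬ ∃ (k : ℕ) (x : Fin (k + 1) → G.V), 2 ≤ k ∧ Function.Injective x ∧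
      ∀ i : Fin (k + 1), (x i, x (i + 1)) ∈ G.E

/-- `G` is measurably bipartite: a Borel set `A` meets every edge in exactly one endpoint. -/
def Graphing.MeasurablyBipartite (G : Graphing) : Prop :=
  ∃ A : Set G.V, MeasurableSet A ∧ ∀ x y : G.V, (x, y) ∈ G.E → (x ∈ A ↔ y ∉ A)

/-- A circulation: an antisymmetric Borel function supported on `E` whose
sum over the neighbours of each vertex vanishes. -/
def Graphing.IsCirculation (G : Graphing) (f : G.V × G.V → ℝ) : Prop :=
  Measurable f ∧ (∀ x y : G.V, f (x, y) = - f (y, x)) ∧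
    (∀ x y : G.V, (x, y) ∉ G.E → f (x, y) = 0) ∧
    ∀ x : G.V, ∑ᶠ y : G.V, f (x, y) = 0

/-- A measurable perfect matching: a symmetric Borel subset of `E` such that almost
every vertex has exactly one `M`-neighbour. -/
def Graphing.IsPerfectMatching (G : Graphing) (M : Set (G.V × G.V)) : Prop :=
  M ⊆ G.E ∧ MeasurableSet M ∧ (∀ x y : G.V, (x, y) ∈ M → (y, x) ∈ M) ∧
    ∀ᵐ x ∂G.ν, ∃! y : G.V, (x, y) ∈ M

/-- The combinatorial data from which the treeing is built: a measure preserving bijection `θ` of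
`Y × Fin d`, with height functions `k n` whose coboundary is essentially `ψ n`. -/
structure TData (d : ℕ) where
  Y : Type
  [mY : MeasurableSpace Y]
  [sbY : StandardBorelSpace Y]
  ν : Measure Y
  [pν : IsProbabilityMeasure ν]
  θ : Y × Fin d ≃ᵐ Y × Fin d
  mp : MeasurePreserving θ (ν.prod Measure.count) (ν.prod Measure.count)
  k : ℕ → Y → ℕ
  N : ℕ → ℕ
  ψ : ℕ → Y × Fin d → ℝ
  S : ℕ → Set Y
  Z : ℕ → Set Y
  k_meas : ∀ n, Measurable (k n)
  ψ_meas : ∀ n, Measurable (ψ n)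
  S_meas : ∀ n, MeasurableSet (S n)
  Z_meas : ∀ n, MeasurableSet (Z n)
  k_le : ∀ n y, k n y ≤ N n
  N_pos : ∀ n, 0 < N n
  ψ_le : ∀ n x, |ψ n x| ≤ 1
  ev : ∀ x, ∀ᶠ n in Filter.atTop, (k n (θ x).1 : ℝ) - k n x.1 = ψ n x
  le_one : ∀ n x, x.1 ∉ S n → |(k n (θ x).1 : ℝ) - k n x.1| ≤ 1
  eq_ψ : ∀ n x, x.1 ∉ S n → x.1 ∉ Z n → (k n (θ x).1 : ℝ) - k n x.1 = ψ n x
  Z_lim : Filter.Tendsto (fun n => ν (Z n)) Filter.atTop (nhds 0)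
  S_lim : Filter.Tendsto (fun n => ((d : ENNReal) + 1) ^ (N n + 1) * ν (S n))
    Filter.atTop (nhds 0)
  sep : ∀ (Q : Finset (Y × Fin d)) (e : Y × Fin d), e ∈ Q →
    ∃ᶠ n in Filter.atTop, (∀ q ∈ Q, q ≠ e → ψ n q = 0) ∧ ψ n e = 1
  span : ∀ F : Y × Fin d → ℝ, Integrable F (ν.prod Measure.count) →
    ∫ x, F x ∂(ν.prod Measure.count) = 0 →
    Filter.Tendsto (fun n => ∫ x, F x * ψ n x ∂(ν.prod Measure.count)) Filter.atTop (nhds 0) →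
    F =ᵐ[ν.prod Measure.count] 0

attribute [instance] TData.mY TData.sbY TData.pν

namespace TData

variable {d : ℕ} (T : TData d)

/-- the measure on half-edges -/
noncomputable abbrev μ : Measure (T.Y × Fin d) := T.ν.prod Measure.count

lemma integral_μ {h : T.Y × Fin d → ℝ} (hh : Integrable h T.μ) :
    ∫ x, h x ∂T.μ = ∫ y, ∑ i, h (y, i) ∂T.ν := by
  rw [integral_prod _ hh]
  simp only [integral_count]

lemma lintegral_μ {h : T.Y × Fin d → ENNReal} (hh : Measurable h) :
    ∫⁻ x, h x ∂T.μ = ∫⁻ y, ∑ i, h (y, i) ∂T.ν := by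
  rw [lintegral_prod _ hh.aemeasurable]
  simp only [lintegral_count, tsum_fintype]

lemma μ_preimage_fst (B : Set T.Y) :
    T.μ {x | x.1 ∈ B} = d * T.ν B := by
  have : {x : T.Y × Fin d | x.1 ∈ B} = B ×ˢ Set.univ := by ext; simp
  rw [this, Measure.prod_prod, mul_comm]
  congr 1
  rw [Measure.count_apply MeasurableSet.univ]
  simp

/-- forward map from side `false`, backward map from side `true` -/
noncomputable def tw (b : Bool) : T.Y × Fin d ≃ᵐ T.Y × Fin d := if b then T.θ.symm else T.θ

@[simp] lemma tw_false : T.tw false = T.θ := rfl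
@[simp] lemma tw_true : T.tw true = T.θ.symm := rfl

@[simp] lemma tw_not_tw (b : Bool) (x) : T.tw (!b) (T.tw b x) = x := by
  cases b <;> simp

lemma tw_mp (b : Bool) : MeasurePreserving (T.tw b) T.μ T.μ := by
  cases b
  · exact T.mp
  · exact T.mp.symm

/-- neighbours -/
noncomputable def nb (p : Bool × T.Y) (i : Fin d) : Bool × T.Y := (!p.1, (T.tw p.1 (p.2, i)).1)

lemma nb_meas (i : Fin d) : Measurable (fun p => T.nb p i) := by
  apply measurable_from_prod_countable_right
  intro b
  change Measurable (fun y => ((!b), ((T.tw b) (y, i)).1))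
  exact measurable_const.prodMk (measurable_fst.comp ((T.tw b).measurable.comp
    measurable_prodMk_right))

/-- thickening of a set of vertices -/
noncomputable def thick (D : Set (Bool × T.Y)) : Set (Bool × T.Y) :=
  D ∪ {p | ∃ i, T.nb p i ∈ D}

lemma thick_meas {D : Set (Bool × T.Y)} (hD : MeasurableSet D) : MeasurableSet (T.thick D) := by
  refine hD.union ?_
  have : {p | ∃ i, T.nb p i ∈ D} = ⋃ i, (fun p => T.nb p i) ⁻¹' D := by ext; simp
  rw [this]
  exact MeasurableSet.iUnion fun i => T.nb_meas i hD

lemma slice_meas {D : Set (Bool × T.Y)} (hD : MeasurableSet D) (b : Bool) :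
    MeasurableSet {y | (b, y) ∈ D} := measurable_prodMk_left hD

lemma slice_nb_le {D : Set (Bool × T.Y)} (hD : MeasurableSet D) (b : Bool) :
    T.ν {y | ∃ i, T.nb (b, y) i ∈ D} ≤ d * T.ν {y | (!b, y) ∈ D} := by
  have h1 : {y | ∃ i, T.nb (b, y) i ∈ D} = ⋃ i, {y | T.nb (b, y) i ∈ D} := by ext; simp
  have hm : MeasurableSet {x : T.Y × Fin d | (!b, x.1) ∈ D} :=
    measurable_fst (T.slice_meas hD (!b))
  have h2 : T.μ {x | (!b, (T.tw b x).1) ∈ D} = d * T.ν {y | (!b, y) ∈ D} := by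
    rw [← T.μ_preimage_fst {y | (!b, y) ∈ D}]
    exact (T.tw_mp b).measure_preimage hm.nullMeasurableSet
  have hm2 : MeasurableSet {x | (!b, (T.tw b x).1) ∈ D} := (T.tw b).measurable hm
  have h3 : T.μ {x | (!b, (T.tw b x).1) ∈ D} = ∑ i, T.ν {y | T.nb (b, y) i ∈ D} := by
    rw [← lintegral_indicator_one hm2, T.lintegral_μ (measurable_one.indicator hm2),
      lintegral_finsetSum]
    · refine Finset.sum_congr rfl fun i _ => ?_
      rw [← lintegral_indicator_one]
      · rfl
      · exact ((T.nb_meas i).comp measurable_prodMk_left) hD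
    · intro i _
      exact (measurable_one.indicator hm2).comp measurable_prodMk_right
  rw [← h2, h3, h1]
  exact measure_iUnion_fintype_le _ _

lemma slice_thick_le {D : Set (Bool × T.Y)} (hD : MeasurableSet D) {c : ENNReal}
    (hc : ∀ b, T.ν {y | (b, y) ∈ D} ≤ c) (b : Bool) :
    T.ν {y | (b, y) ∈ T.thick D} ≤ (d + 1) * c := by
  have : {y | (b, y) ∈ T.thick D} = {y | (b, y) ∈ D} ∪ {y | ∃ i, T.nb (b, y) i ∈ D} := rfl
  rw [this]
  refine (measure_union_le _ _).trans ?_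
  rw [add_mul, one_mul, add_comm]
  exact add_le_add ((T.slice_nb_le hD b).trans (by gcongr; exact hc _)) (hc b)

/-- iterated thickening -/
noncomputable def D (n : ℕ) : ℕ → Set (Bool × T.Y)
  | 0 => {p | p.1 = false ∧ p.2 ∈ T.S n}
  | r + 1 => T.thick (D n r)

lemma D_meas (n r : ℕ) : MeasurableSet (T.D n r) := by
  induction r with
  | zero =>
    exact (measurable_fst (measurableSet_singleton false)).inter (measurable_snd (T.S_meas n))
  | succ r ih => exact T.thick_meas ih

lemma D_le (n r : ℕ) (b : Bool) :
    T.ν {y | (b, y) ∈ T.D n r} ≤ ((d : ENNReal) + 1) ^ r * T.ν (T.S n) := by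
  induction r generalizing b with
  | zero =>
    rw [pow_zero, one_mul]
    exact measure_mono fun y hy => hy.2
  | succ r ih =>
    rw [pow_succ', mul_assoc]
    exact T.slice_thick_le (T.D_meas n r) ih b

lemma D_mono (n : ℕ) : Monotone (T.D n) :=
  monotone_nat_of_le_succ fun _ => Set.subset_union_left

lemma D_nb {n r : ℕ} {p : Bool × T.Y} {i : Fin d} (h : T.nb p i ∈ T.D n r) : p ∈ T.D n (r + 1) :=
  Or.inr ⟨i, h⟩

lemma D_θ {n r : ℕ} {x : T.Y × Fin d} (h : (true, (T.θ x).1) ∈ T.D n r) :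
    (false, x.1) ∈ T.D n (r + 1) :=
  T.D_nb (i := x.2) (by simpa [nb] using h)

lemma D_θ' {n r : ℕ} {x : T.Y × Fin d} (h : (false, x.1) ∈ T.D n r) :
    (true, (T.θ x).1) ∈ T.D n (r + 1) :=
  T.D_nb (i := (T.θ x).2) (by simpa [nb] using h)

open Classical in
/-- cutoff function -/
noncomputable def η (n : ℕ) (p : Bool × T.Y) : ℝ :=
  (∑ r ∈ Finset.range (T.N n), if p ∈ T.D n (r + 1) then 0 else 1) / T.N n

lemma η_meas (n : ℕ) : Measurable (T.η n) := by
  unfold η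
  refine Measurable.div_const (Finset.measurable_sum _ fun r _ => ?_) _
  exact Measurable.ite (T.D_meas n _) measurable_const measurable_const

lemma η_nonneg (n p) : 0 ≤ T.η n p := by
  unfold η
  refine div_nonneg (Finset.sum_nonneg fun r _ => ?_) (by positivity)
  split_ifs <;> norm_num

lemma η_le_one (n p) : T.η n p ≤ 1 := by
  unfold η
  refine div_le_one_of_le₀ ?_ (by positivity)
  calc _ ≤ ∑ r ∈ Finset.range (T.N n), (1 : ℝ) :=
        Finset.sum_le_sum fun r _ => by split_ifs <;> norm_num
    _ = _ := by simp

lemma η_eq_one {n p} (h : p ∉ T.D n (T.N n)) : T.η n p = 1 := by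
  unfold η
  rw [Finset.sum_congr rfl (g := fun _ => (1 : ℝ))]
  · have := T.N_pos n
    have h' : (T.N n : ℝ) ≠ 0 := by positivity
    simp [h']
  · intro r hr
    rw [if_neg]
    exact fun h' => h (T.D_mono n (by simpa using hr) h')

lemma η_eq_zero {n p} (h : p ∈ T.D n 1) : T.η n p = 0 := by
  unfold η
  rw [Finset.sum_eq_zero, zero_div]
  intro r _
  rw [if_pos]
  exact T.D_mono n (by omega) h

lemma η_lip_aux {n : ℕ} {p q : Bool × T.Y}
    (h : ∀ r, q ∈ T.D n r → p ∈ T.D n (r + 1)) : T.η n p - T.η n q ≤ 1 / T.N n := by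
  classical
  unfold η
  rw [← sub_div]
  gcongr
  obtain ⟨M, hM⟩ : ∃ M, T.N n = M + 1 := ⟨T.N n - 1, by have := T.N_pos n; omega⟩
  rw [hM, Finset.sum_range_succ' (fun r => if p ∈ T.D n (r + 1) then (0 : ℝ) else 1),
    Finset.sum_range_succ (fun r => if q ∈ T.D n (r + 1) then (0 : ℝ) else 1)]
  have h1 : ∑ r ∈ Finset.range M, (if p ∈ T.D n (r + 1 + 1) then (0 : ℝ) else 1) ≤
      ∑ r ∈ Finset.range M, (if q ∈ T.D n (r + 1) then (0 : ℝ) else 1) := by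
    refine Finset.sum_le_sum fun r _ => ?_
    by_cases hq : q ∈ T.D n (r + 1)
    · rw [if_pos hq, if_pos (h _ hq)]
    · rw [if_neg hq]; split_ifs <;> norm_num
  have h2 : (if p ∈ T.D n (0 + 1) then (0 : ℝ) else 1) ≤ 1 := by split_ifs <;> norm_num
  have h3 : 0 ≤ (if q ∈ T.D n (M + 1) then (0 : ℝ) else 1) := by split_ifs <;> norm_num
  linarith

lemma η_lip (n : ℕ) (x : T.Y × Fin d) :
    |T.η n (true, (T.θ x).1) - T.η n (false, x.1)| ≤ 1 / T.N n := by
  rw [abs_le]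
  have h1 := T.η_lip_aux (n := n) (p := (true, (T.θ x).1)) (q := (false, x.1))
    fun r hr => T.D_θ' hr
  have h2 := T.η_lip_aux (n := n) (q := (true, (T.θ x).1)) (p := (false, x.1))
    fun r hr => T.D_θ hr
  constructor <;> linarith

/-- the cut off height function -/
noncomputable def g (n : ℕ) (p : Bool × T.Y) : ℝ := T.k n p.2 * T.η n p

lemma g_meas (n : ℕ) : Measurable (T.g n) := by
  unfold g
  refine Measurable.mul ?_ (T.η_meas n)
  exact (measurable_from_nat (f := fun m : ℕ => (m : ℝ))).comp ((T.k_meas n).comp measurable_snd)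

lemma g_bound (n p) : |T.g n p| ≤ T.N n := by
  unfold g
  rw [abs_mul, abs_of_nonneg (T.η_nonneg n p), Nat.abs_cast]
  calc _ ≤ (T.N n : ℝ) * 1 := by
        gcongr
        · exact T.η_nonneg n p
        · exact_mod_cast T.k_le n p.2
        · exact T.η_le_one n p
    _ = _ := mul_one _

lemma dg_bound (n : ℕ) (x : T.Y × Fin d) :
    |T.g n (true, (T.θ x).1) - T.g n (false, x.1)| ≤ 2 := by
  have hN : (0 : ℝ) < T.N n := by exact_mod_cast T.N_pos n
  by_cases hS : x.1 ∈ T.S n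
  · have h0 : (false, x.1) ∈ T.D n 0 := ⟨rfl, hS⟩
    have h1 := T.η_eq_zero (T.D_mono n (by omega : 0 ≤ 1) h0)
    have h2 := T.η_eq_zero (T.D_θ' h0)
    simp [g, h1, h2]
  · have h1 := T.le_one n x hS
    have h2 := T.η_lip n x
    have h3 := T.η_nonneg n (true, (T.θ x).1)
    have h4 := T.η_le_one n (true, (T.θ x).1)
    have h5 : (T.k n x.1 : ℝ) ≤ T.N n := by exact_mod_cast T.k_le n x.1
    have e : T.g n (true, (T.θ x).1) - T.g n (false, x.1) =
        ((T.k n (T.θ x).1 : ℝ) - T.k n x.1) * T.η n (true, (T.θ x).1) +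
        T.k n x.1 * (T.η n (true, (T.θ x).1) - T.η n (false, x.1)) := by
      simp only [g]; ring
    rw [e]
    calc _ ≤ |((T.k n (T.θ x).1 : ℝ) - T.k n x.1)| * |T.η n (true, (T.θ x).1)| +
        |(T.k n x.1 : ℝ)| * |T.η n (true, (T.θ x).1) - T.η n (false, x.1)| := by
          rw [← abs_mul, ← abs_mul]; exact abs_add_le _ _
      _ ≤ 1 * 1 + T.N n * (1 / T.N n) := by
          rw [abs_of_nonneg h3, Nat.abs_cast]
          gcongr
      _ = 2 := by field_simp; norm_num

/-- exceptional vertices at stage `n` -/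
noncomputable def Qset (n : ℕ) : Set T.Y := {y | (false, y) ∈ T.D n (T.N n + 1)} ∪ T.Z n

lemma dg_eq (n : ℕ) (x : T.Y × Fin d) (hx : x.1 ∉ T.Qset n) :
    T.g n (true, (T.θ x).1) - T.g n (false, x.1) = T.ψ n x := by
  have hx1 : (false, x.1) ∉ T.D n (T.N n + 1) := fun h => hx (Or.inl h)
  have hx2 : x.1 ∉ T.Z n := fun h => hx (Or.inr h)
  have hS : x.1 ∉ T.S n := fun h => hx1 (T.D_mono n (Nat.zero_le _) ⟨rfl, h⟩)
  have h1 : T.η n (true, (T.θ x).1) = 1 := T.η_eq_one fun h => hx1 (T.D_θ h)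
  have h2 : T.η n (false, x.1) = 1 := T.η_eq_one fun h => hx1 (T.D_mono n (by omega) h)
  simp only [g, h1, h2, mul_one]
  exact T.eq_ψ n x hS hx2

lemma Qset_meas (n : ℕ) : MeasurableSet (T.Qset n) :=
  (T.slice_meas (T.D_meas n _) false).union (T.Z_meas n)

lemma Qset_lim : Filter.Tendsto (fun n => T.μ {x | x.1 ∈ T.Qset n}) Filter.atTop (nhds 0) := by
  have h1 : Filter.Tendsto (fun n => (d : ENNReal) *
      (((d : ENNReal) + 1) ^ (T.N n + 1) * T.ν (T.S n) + T.ν (T.Z n)))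
      Filter.atTop (nhds (d * (0 + 0))) :=
    ENNReal.Tendsto.const_mul (T.S_lim.add T.Z_lim) (Or.inr (by simp))
  rw [add_zero, mul_zero] at h1
  refine tendsto_of_tendsto_of_tendsto_of_le_of_le tendsto_const_nhds h1
    (fun _ => bot_le) fun n => ?_
  dsimp only
  rw [T.μ_preimage_fst (T.Qset n)]
  gcongr
  exact (measure_union_le _ _).trans (add_le_add (T.D_le n _ false) le_rfl)

lemma integral_vertex_zero {F : T.Y × Fin d → ℝ} (hF : Integrable F T.μ)
    (hA : ∀ᵐ y ∂T.ν, ∑ i, F (y, i) = 0) {h : T.Y → ℝ} (hh : Measurable h) {C : ℝ}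
    (hC : ∀ y, |h y| ≤ C) :
    Integrable (fun x => F x * h x.1) T.μ ∧ ∫ x, F x * h x.1 ∂T.μ = 0 := by
  have hi : Integrable (fun x => F x * h x.1) T.μ :=
    hF.mul_bdd (c := C) (hh.comp measurable_fst).aestronglyMeasurable
      (Filter.Eventually.of_forall fun x => hC x.1)
  refine ⟨hi, ?_⟩
  rw [T.integral_μ hi]
  refine integral_eq_zero_of_ae ?_
  filter_upwards [hA] with y hy
  simp [← Finset.sum_mul, hy]

/-- Key fact: there are no nonzero integrable circulations. -/
theorem circ_zero {F : T.Y × Fin d → ℝ} (hF : Integrable F T.μ)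
    (hA : ∀ᵐ y ∂T.ν, ∑ i, F (y, i) = 0) (hB : ∀ᵐ z ∂T.ν, ∑ j, F (T.θ.symm (z, j)) = 0) :
    F =ᵐ[T.μ] 0 := by
  refine T.span F hF ?_ ?_
  · rw [T.integral_μ hF]
    exact integral_eq_zero_of_ae hA
  · have key : ∀ n, ‖∫ x, F x * T.ψ n x ∂T.μ‖ ≤ 3 * ∫ x in {x | x.1 ∈ T.Qset n}, |F x| ∂T.μ := by
      intro n
      have hA' := T.integral_vertex_zero hF hA (h := fun y => T.g n (false, y))
        ((T.g_meas n).comp measurable_prodMk_left) (fun y => T.g_bound n _)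
      have hF' : Integrable (F ∘ T.θ.symm) T.μ := T.mp.symm.integrable_comp_of_integrable hF
      have hB' := T.integral_vertex_zero hF' hB (h := fun y => T.g n (true, y))
        ((T.g_meas n).comp measurable_prodMk_left) (fun y => T.g_bound n _)
      have hB1 : Integrable (fun x => F x * T.g n (true, (T.θ x).1)) T.μ := by
        have := T.mp.integrable_comp_of_integrable hB'.1
        simpa [Function.comp_def] using this
      have hB2 : ∫ x, F x * T.g n (true, (T.θ x).1) ∂T.μ = 0 := by
        rw [← hB'.2]
        have := T.mp.integral_comp' (fun x => (F ∘ T.θ.symm) x * T.g n (true, x.1))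
        simpa using this
      have hψ : Integrable (fun x => F x * T.ψ n x) T.μ :=
        hF.mul_bdd (c := 1) (T.ψ_meas n).aestronglyMeasurable
          (Filter.Eventually.of_forall fun x => T.ψ_le n x)
      have e : ∫ x, F x * T.ψ n x ∂T.μ = ∫ x, F x * (T.ψ n x -
          (T.g n (true, (T.θ x).1) - T.g n (false, x.1))) ∂T.μ := by
        have : ∀ x, F x * (T.ψ n x - (T.g n (true, (T.θ x).1) - T.g n (false, x.1))) =
          F x * T.ψ n x - (F x * T.g n (true, (T.θ x).1) - F x * T.g n (false, x.1)) := by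
          intro x; ring
        simp only [this]
        rw [integral_sub hψ (by exact hB1.sub hA'.1), integral_sub hB1 hA'.1, hB2, hA'.2]
        simp
      rw [e]
      have hQ : MeasurableSet {x : T.Y × Fin d | x.1 ∈ T.Qset n} := measurable_fst (T.Qset_meas n)
      rw [← integral_const_mul, ← integral_indicator hQ]
      refine norm_integral_le_of_norm_le ((hF.abs.const_mul 3).indicator hQ)
        (Filter.Eventually.of_forall fun x => ?_)
      by_cases hx : x.1 ∈ T.Qset n
      · rw [Set.indicator_of_mem (show x ∈ {x : T.Y × Fin d | x.1 ∈ T.Qset n} from hx),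
          Real.norm_eq_abs, abs_mul, mul_comm]
        have h1 := abs_le.1 (T.dg_bound n x)
        have h2 := abs_le.1 (T.ψ_le n x)
        gcongr
        rw [abs_le]
        constructor <;> linarith
      · rw [Set.indicator_of_notMem (show x ∉ {x : T.Y × Fin d | x.1 ∈ T.Qset n} from hx),
          T.dg_eq n x hx]
        simp
    refine squeeze_zero_norm key ?_
    have := (Integrable.tendsto_setIntegral_nhds_zero hF.abs (s := fun n => {x | x.1 ∈ T.Qset n})
      T.Qset_lim).const_mul 3
    simpa using this

end TData
namespace TData

variable {d : ℕ} (T : TData d)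

lemma nb_symm {p q : Bool × T.Y} {i : Fin d} (h : T.nb p i = q) : ∃ j, T.nb q j = p := by
  subst h
  refine ⟨(T.tw p.1 (p.2, i)).2, ?_⟩
  simp [nb]

lemma nb_ne (p : Bool × T.Y) (i : Fin d) : T.nb p i ≠ p := by
  intro h
  have := congrArg Prod.fst h
  simp [nb] at this

/-- underlying edge of a half-edge -/
noncomputable def und (p : Bool × T.Y) (i : Fin d) : T.Y × Fin d :=
  if p.1 then T.θ.symm (p.2, i) else (p.2, i)

/-- orientation sign of a vertex -/
def sgn (p : Bool × T.Y) : ℝ := if p.1 then -1 else 1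

lemma sgn_ne (p : Bool × T.Y) : T.sgn p ≠ 0 := by
  unfold sgn; split_ifs <;> norm_num

lemma ev_nb (p : Bool × T.Y) (i : Fin d) : ∀ᶠ n in Filter.atTop,
    (T.k n (T.nb p i).2 : ℝ) - T.k n p.2 = T.sgn p * T.ψ n (T.und p i) := by
  obtain ⟨b, y⟩ := p
  cases b
  · filter_upwards [T.ev (y, i)] with n hn
    simpa [nb, sgn, und] using hn
  · filter_upwards [T.ev (T.θ.symm (y, i))] with n hn
    simp [nb, sgn, und] at hn ⊢
    linarith

lemma und_inj {p q : Bool × T.Y} {i j : Fin d} (h : T.und p i = T.und q j) :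
    (p = q ∧ i = j) ∨ (T.nb p i = q ∧ T.nb q j = p) := by
  obtain ⟨b, y⟩ := p
  obtain ⟨c, z⟩ := q
  cases b <;> cases c
  · left
    simpa [und] using h
  · right
    simp only [und, nb, Bool.false_eq_true, if_true, if_false] at h ⊢
    have h' := congrArg T.θ h
    simp at h'
    simp [h', ← h]
  · right
    simp only [und, nb, Bool.false_eq_true, if_true, if_false] at h ⊢
    have h' := congrArg T.θ h
    simp at h'
    simp [← h', h]
  · left
    simpa [und] using h

lemma nb_inj (p : Bool × T.Y) : Function.Injective (T.nb p) := by
  classical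
  intro i i' h
  by_contra hne
  have hu : T.und p i' ≠ T.und p i := by
    intro h'
    rcases T.und_inj h' with h1 | h1
    · exact hne h1.2.symm
    · exact T.nb_ne _ _ h1.1
  have hs := T.sep {T.und p i, T.und p i'} (T.und p i) (by simp)
  obtain ⟨n, ⟨⟨h1, h2⟩, h3⟩, h4⟩ := ((hs.and_eventually (T.ev_nb p i)).and_eventually
    (T.ev_nb p i')).exists
  rw [h2] at h3
  rw [h1 _ (by simp) hu] at h4
  rw [h] at h3
  have := T.sgn_ne p
  apply this
  linarith

lemma finsum_nb (v : Bool × T.Y) (h : Bool × T.Y → ℝ) (h0 : ∀ w, (∀ i, T.nb v i ≠ w) → h w = 0) :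
    ∑ᶠ w, h w = ∑ i, h (T.nb v i) := by
  classical
  rw [finsum_eq_sum_of_support_subset (s := Finset.univ.image (T.nb v)),
    Finset.sum_image fun a _ b _ hab => T.nb_inj v hab]
  intro w hw
  by_contra hcon
  apply hw
  apply h0
  intro i hi
  exact hcon (by simp; exact ⟨i, hi⟩)

open Classical in
lemma ncard_nb (v : Bool × T.Y) (B : Set (Bool × T.Y)) :
    (Set.ncard {w ∈ B | ∃ i, T.nb v i = w} : ℝ) = ∑ i, if T.nb v i ∈ B then 1 else 0 := by
  have : {w ∈ B | ∃ i, T.nb v i = w} =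
      ((Finset.univ.filter (fun i => T.nb v i ∈ B)).image (T.nb v) : Finset _) := by
    ext w
    simp only [Set.mem_ofPred_eq, Finset.coe_image, Finset.coe_filter, Finset.mem_univ, true_and,
      Set.mem_image]
    constructor
    · rintro ⟨hw, i, rfl⟩
      exact ⟨i, hw, rfl⟩
    · rintro ⟨i, hi, rfl⟩
      exact ⟨hi, i, rfl⟩
  rw [this, Set.ncard_coe_finset, Finset.card_image_of_injective _ (T.nb_inj v)]
  simp

/-- vertex measure -/
noncomputable def νV : Measure (Bool × T.Y) :=
  ((2⁻¹ : ENNReal) • (Measure.count : Measure Bool)).prod T.ν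

instance : IsProbabilityMeasure ((2⁻¹ : ENNReal) • (Measure.count : Measure Bool)) := by
  constructor
  rw [Measure.smul_apply, Measure.count_apply MeasurableSet.univ]
  have h2 : (Set.univ : Set Bool).encard = 2 := by
    rw [Set.encard_univ]; simp
  rw [h2]
  exact ENNReal.inv_mul_cancel two_ne_zero ENNReal.ofNat_ne_top

instance : IsProbabilityMeasure T.νV := by unfold νV; infer_instance

lemma all_of_ae {P : Bool → Prop}
    (h : ∀ᵐ b ∂((2⁻¹ : ENNReal) • (Measure.count : Measure Bool)), P b) (b : Bool) : P b := by
  rw [Measure.ae_ennreal_smul_measure_iff (by simp)] at h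
  rw [ae_iff, Measure.count_eq_zero_iff] at h
  by_contra hb
  have : b ∈ {a | ¬ P a} := hb
  rw [h] at this
  exact this

lemma ae_νV {P : Bool × T.Y → Prop} (h : ∀ᵐ v ∂T.νV, P v) (b : Bool) : ∀ᵐ y ∂T.ν, P (b, y) :=
  all_of_ae (Measure.ae_ae_of_ae_prod h) b

lemma integrable_νV {h : Bool × T.Y → ℝ} (hh : Integrable h T.νV) (b : Bool) :
    Integrable (fun y => h (b, y)) T.ν :=
  all_of_ae (Integrable.prod_right_ae hh) b

lemma integral_νV {h : Bool × T.Y → ℝ} (hh : Integrable h T.νV) :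
    ∫ v, h v ∂T.νV = 2⁻¹ * ∑ b, ∫ y, h (b, y) ∂T.ν := by
  unfold νV at hh ⊢
  rw [integral_prod _ hh, integral_smul_measure, integral_count]
  simp

open Classical in
/-- edge count between `A` and `B` seen from side `b` -/
noncomputable def eI (A B : Set (Bool × T.Y)) (b : Bool) (x : T.Y × Fin d) : ℝ :=
  (if (b, x.1) ∈ A then 1 else 0) * (if (!b, (T.tw b x).1) ∈ B then 1 else 0)

lemma eI_meas {A B : Set (Bool × T.Y)} (hA : MeasurableSet A) (hB : MeasurableSet B) (b : Bool) :
    Measurable (T.eI A B b) := by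
  unfold eI
  refine Measurable.mul (Measurable.ite ?_ measurable_const measurable_const)
    (Measurable.ite ?_ measurable_const measurable_const)
  · exact measurable_fst (T.slice_meas hA b)
  · exact (T.tw b).measurable (measurable_fst (T.slice_meas hB (!b)))

lemma eI_bound (A B : Set (Bool × T.Y)) (b : Bool) (x : T.Y × Fin d) : ‖T.eI A B b x‖ ≤ 1 := by
  unfold eI
  split_ifs <;> simp

lemma eI_integrable {A B : Set (Bool × T.Y)} (hA : MeasurableSet A) (hB : MeasurableSet B)
    (b : Bool) : Integrable (T.eI A B b) T.μ :=
  Integrable.of_bound (T.eI_meas hA hB b).aestronglyMeasurable 1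
    (Filter.Eventually.of_forall (T.eI_bound A B b))

lemma eI_swap (A B : Set (Bool × T.Y)) (b : Bool) :
    ∫ x, T.eI A B b x ∂T.μ = ∫ x, T.eI B A (!b) x ∂T.μ := by
  rw [← (T.tw_mp b).integral_comp' (T.eI B A (!b))]
  congr 1
  ext x
  have e1 : (!!b, ((T.tw !b) ((T.tw b) x)).1) = (b, x.1) := by rw [tw_not_tw, Bool.not_not]
  unfold eI
  rw [e1, mul_comm]

lemma mt_integral {A B : Set (Bool × T.Y)} (hA : MeasurableSet A) (hB : MeasurableSet B) :
    ∫ v in A, (Set.ncard {w ∈ B | ∃ i, T.nb v i = w} : ℝ) ∂T.νV =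
      2⁻¹ * ∑ b, ∫ x, T.eI A B b x ∂T.μ := by
  classical
  rw [← integral_indicator hA]
  have e : (A.indicator fun v => (Set.ncard {w ∈ B | ∃ i, T.nb v i = w} : ℝ)) =
      fun v => ∑ i, T.eI A B v.1 (v.2, i) := by
    ext ⟨b, y⟩
    simp only [Set.indicator_apply, T.ncard_nb, eI]
    by_cases h : (b, y) ∈ A
    · simp only [h, if_true, one_mul, nb]
      refine Finset.sum_congr rfl fun i _ => ?_
      congr
    · simp [h]
  rw [e]
  have hm : Measurable (fun v : Bool × T.Y => ∑ i, T.eI A B v.1 (v.2, i)) := by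
    apply measurable_from_prod_countable_right
    intro b
    exact Finset.measurable_sum _ fun i _ => (T.eI_meas hA hB b).comp measurable_prodMk_right
  rw [T.integral_νV]
  · congr 1
    refine Finset.sum_congr rfl fun b _ => ?_
    rw [T.integral_μ (T.eI_integrable hA hB b)]
  · refine Integrable.of_bound hm.aestronglyMeasurable d (Filter.Eventually.of_forall fun v => ?_)
    refine (norm_sum_le _ _).trans ?_
    refine (Finset.sum_le_sum fun i _ => T.eI_bound A B _ _).trans ?_
    simp

/-- The graphing. -/
noncomputable def graph : Graphing where
  V := Bool × T.Y
  ν := T.νV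
  E := {p | ∃ i, T.nb p.1 i = p.2}
  E_meas := by
    have : {p : (Bool × T.Y) × (Bool × T.Y) | ∃ i, T.nb p.1 i = p.2} =
        ⋃ i, {p | T.nb p.1 i = p.2} := by ext; simp
    rw [this]
    exact MeasurableSet.iUnion fun i =>
      measurableSet_eq_fun ((T.nb_meas i).comp measurable_fst) measurable_snd
  symm := fun x y ⟨i, hi⟩ => T.nb_symm hi
  irrefl := fun x ⟨i, hi⟩ => T.nb_ne x i hi
  locFin := fun x => Set.finite_range (T.nb x)
  massTransport := by
    intro A B hA hB
    have h1 := T.mt_integral hA hB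
    have h2 := T.mt_integral hB hA
    refine h1.trans (Eq.trans ?_ h2.symm)
    simp only [Fintype.sum_bool, T.eI_swap A B, Bool.not_true, Bool.not_false]
    ring

lemma graph_regular : T.graph.IsRegular d := by
  intro x
  change Set.ncard (Set.range (T.nb x)) = d
  rw [← Set.image_univ, Set.ncard_image_of_injective _ (T.nb_inj x)]
  simp

lemma graph_bip : T.graph.MeasurablyBipartite := by
  refine ⟨{p : Bool × T.Y | p.1 = true}, measurable_fst (measurableSet_singleton true), ?_⟩
  rintro ⟨b, y⟩ q ⟨i, hi⟩
  change T.nb (b, y) i = q at hi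
  subst hi
  change b = true ↔ ¬ ((!b) = true)
  cases b <;> simp

lemma graph_acyclic : T.graph.Acyclic := by
  classical
  rintro ⟨k, x, hk, hx, hE⟩
  change Fin (k + 1) → Bool × T.Y at x
  have hE' : ∀ t, ∃ i, T.nb (x t) i = x (t + 1) := hE
  choose i hi using hE'
  have hinj : Function.Injective fun t => T.und (x t) (i t) := by
    intro s t hst
    rcases T.und_inj hst with h | h
    · exact hx h.1
    · exfalso
      rw [hi, hi] at h
      have h1 := hx h.1
      have h2 := hx h.2
      rw [← h1] at h2
      have h3 : (1 : Fin (k + 1)) + 1 = 0 := by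
        rw [add_assoc] at h2
        simpa using h2
      have h4 := congrArg Fin.val h3
      rw [Fin.val_add, Fin.val_one', Fin.val_zero] at h4
      rw [Nat.mod_eq_of_lt (by omega : 1 < k + 1)] at h4
      rw [Nat.mod_eq_of_lt (by omega)] at h4
      omega
  have hs := T.sep (Finset.univ.image fun t => T.und (x t) (i t)) (T.und (x 0) (i 0))
    (Finset.mem_image_of_mem _ (Finset.mem_univ _))
  have hev : ∀ᶠ n in Filter.atTop, ∀ t, (T.k n (x (t + 1)).2 : ℝ) - T.k n (x t).2 =
      T.sgn (x t) * T.ψ n (T.und (x t) (i t)) := by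
    rw [Filter.eventually_all]
    intro t
    have := T.ev_nb (x t) (i t)
    rw [hi] at this
    exact this
  obtain ⟨n, ⟨h1, h2⟩, h3⟩ := (hs.and_eventually hev).exists
  have hsum : ∑ t, ((T.k n (x (t + 1)).2 : ℝ) - T.k n (x t).2) = 0 := by
    rw [Finset.sum_sub_distrib, sub_eq_zero]
    exact Equiv.sum_comp (Equiv.addRight (1 : Fin (k + 1))) fun t => (T.k n (x t).2 : ℝ)
  simp only [h3] at hsum
  rw [Finset.sum_eq_single 0, h2, mul_one] at hsum
  · exact T.sgn_ne _ hsum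
  · intro t _ ht
    rw [h1 _ (Finset.mem_image_of_mem _ (Finset.mem_univ _)), mul_zero]
    exact fun h => ht (hinj h)
  · simp

lemma graph_circ (f : T.graph.V × T.graph.V → ℝ) (hf : T.graph.IsCirculation f)
    (hi : Integrable (fun x => ∑ᶠ y, |f (x, y)|) T.graph.ν) :
    ∫ x, (∑ᶠ y, |f (x, y)|) ∂T.graph.ν = 0 := by
  change (Bool × T.Y) × (Bool × T.Y) → ℝ at f
  obtain ⟨hm, hanti, hsupp, hsum⟩ := hf
  have hm : Measurable f := hm
  have hanti : ∀ v w, f (v, w) = - f (w, v) := hanti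
  have hsupp : ∀ v w, (∀ i, T.nb v i ≠ w) → f (v, w) = 0 := by
    intro v w h
    refine hsupp v w ?_
    rintro ⟨i, hi⟩
    exact h i hi
  have hsum : ∀ v : Bool × T.Y, ∑ᶠ w, f (v, w) = 0 := hsum
  change ∫ x, (∑ᶠ y, |f (x, y)|) ∂T.νV = 0
  replace hi : Integrable (fun x => ∑ᶠ y, |f (x, y)|) T.νV := hi
  have e1 : ∀ v, ∑ᶠ w, |f (v, w)| = ∑ i, |f (v, T.nb v i)| := fun v =>
    T.finsum_nb v _ fun w hw => by rw [hsupp v w hw, abs_zero]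
  have e2 : ∀ v, ∑ i, f (v, T.nb v i) = 0 := fun v => by
    rw [← hsum v]; exact (T.finsum_nb v (fun w => f (v, w)) (hsupp v)).symm
  simp only [e1] at hi ⊢
  have hi' := T.integrable_νV hi
  let F : T.Y × Fin d → ℝ := fun x => f ((false, x.1), (true, (T.θ x).1))
  have hFm : Measurable F := by
    refine hm.comp (Measurable.prodMk (measurable_const.prodMk measurable_fst) ?_)
    exact measurable_const.prodMk (measurable_fst.comp T.θ.measurable)
  have hFi : Integrable F T.μ := by
    rw [integrable_prod_iff hFm.aestronglyMeasurable]
    refine ⟨Filter.Eventually.of_forall fun y => Integrable.of_finite, ?_⟩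
    simp only [integral_count]
    exact hi' false
  have hFB : ∀ z j, F (T.θ.symm (z, j)) = - f ((true, z), T.nb (true, z) j) := by
    intro z j
    rw [← hanti]
    simp [F, nb]
  have hF := T.circ_zero hFi (Filter.Eventually.of_forall fun y => e2 (false, y))
    (Filter.Eventually.of_forall fun z => by
      simp only [hFB, Finset.sum_neg_distrib, e2, neg_zero])
  rw [T.integral_νV hi]
  have hF2 : (F ∘ T.θ.symm) =ᵐ[T.μ] 0 :=
    T.mp.symm.quasiMeasurePreserving.ae_eq_comp hF
  have z1 : ∫ y, ∑ i, |f ((false, y), T.nb (false, y) i)| ∂T.ν = 0 := by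
    have := T.integral_μ hFi.abs
    refine this.symm.trans ?_
    refine integral_eq_zero_of_ae ?_
    filter_upwards [hF] with x hx
    simp [hx]
  have z2 : ∫ y, ∑ i, |f ((true, y), T.nb (true, y) i)| ∂T.ν = 0 := by
    have := T.integral_μ (T.mp.symm.integrable_comp_of_integrable hFi).abs
    simp only [Function.comp_apply, hFB, abs_neg] at this
    refine this.symm.trans ?_
    refine integral_eq_zero_of_ae ?_
    filter_upwards [hF2] with x hx
    have hx' : F (T.θ.symm (x.1, x.2)) = 0 := hx
    rw [hFB] at hx'
    simpa using hx'
  rw [Fintype.sum_bool, z1, z2]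
  simp

lemma graph_no_matching (hd : 2 ≤ d) : ¬ ∃ M, T.graph.IsPerfectMatching M := by
  classical
  rintro ⟨M, hME, hMm, hMs, hM⟩
  change Set ((Bool × T.Y) × (Bool × T.Y)) at M
  have hMm : MeasurableSet M := hMm
  have hME : ∀ v w, (v, w) ∈ M → ∃ i, T.nb v i = w := fun v w h => hME h
  have hMs : ∀ v w, (v, w) ∈ M → (w, v) ∈ M := hMs
  have hM : ∀ᵐ v ∂T.νV, ∃! w, (v, w) ∈ M := hM
  have hsum : ∀ v, (∃! w, (v, w) ∈ M) → ∑ i, (if (v, T.nb v i) ∈ M then (d : ℝ) else 0) = d := by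
    rintro v ⟨w, hw, huniq⟩
    obtain ⟨i, rfl⟩ := hME v w hw
    rw [Finset.sum_eq_single i]
    · rw [if_pos hw]
    · intro j _ hj
      rw [if_neg]
      exact fun h => hj (T.nb_inj v (huniq _ h))
    · simp
  let F : T.Y × Fin d → ℝ := fun x =>
    (if ((false, x.1), (true, (T.θ x).1)) ∈ M then (d : ℝ) else 0) - 1
  have hmap : Measurable fun x : T.Y × Fin d => ((false, x.1), (true, (T.θ x).1)) :=
    Measurable.prodMk (measurable_const.prodMk measurable_fst)
      (measurable_const.prodMk (measurable_fst.comp T.θ.measurable))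
  have hFm : Measurable F :=
    (Measurable.ite (hmap hMm) measurable_const measurable_const).sub measurable_const
  have hFi : Integrable F T.μ := by
    refine Integrable.of_bound hFm.aestronglyMeasurable (d + 1)
      (Filter.Eventually.of_forall fun x => ?_)
    refine (norm_sub_le _ _).trans ?_
    split_ifs <;> simp
  have hF := T.circ_zero hFi (by
      filter_upwards [T.ae_νV hM false] with y hy
      have := hsum _ hy
      simp only [F, Finset.sum_sub_distrib]
      simp only [nb, tw_false, Bool.not_false] at this
      rw [this]
      simp) (by
      filter_upwards [T.ae_νV hM true] with y hy
      have := hsum _ hy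
      simp only [F, Finset.sum_sub_distrib]
      simp only [nb, tw_true, Bool.not_true] at this
      rw [Finset.sum_congr rfl (g := fun i =>
        if ((true, y), false, (T.θ.symm (y, i)).1) ∈ M then (d : ℝ) else 0), this]
      · simp
      · intro i _
        simp only [MeasurableEquiv.apply_symm_apply]
        congr 1
        exact propext ⟨hMs _ _, hMs _ _⟩)
  have hne : ∀ x, F x ≠ 0 := by
    intro x
    have : (2 : ℝ) ≤ d := by exact_mod_cast hd
    simp only [F]
    split_ifs
    · intro h; linarith
    · norm_num
  have h0 : T.μ Set.univ = 0 := by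
    rw [Filter.EventuallyEq, ae_iff] at hF
    have : {a | ¬ F a = (0 : T.Y × Fin d → ℝ) a} = Set.univ := by
      ext a; simpa using hne a
    rwa [this] at hF
  have h1 := T.μ_preimage_fst Set.univ
  simp only [Set.mem_univ, Set.ofPred_true, h0, measure_univ, mul_one] at h1
  have : d = 0 := by exact_mod_cast h1.symm
  omega

end TData

namespace Constr

open Filter

abbrev YY (N : ℕ → ℕ) : Type := ∀ n, Fin (N n + 1)
abbrev XX (d : ℕ) (N : ℕ → ℕ) : Type := YY N × Fin d
abbrev CC (d : ℕ) (N : ℕ → ℕ) (m : ℕ) : Type := (∀ i : Fin m, Fin (N i + 1)) × Fin d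

variable {d : ℕ} {N : ℕ → ℕ}

/-- restriction to the first `m` coordinates and the label -/
def pr (m : ℕ) (x : XX d N) : CC d N m := (fun i => x.1 i, x.2)

lemma pr_eq_iff {m : ℕ} {x x' : XX d N} :
    pr m x = pr m x' ↔ (∀ i < m, x.1 i = x'.1 i) ∧ x.2 = x'.2 := by
  simp only [pr, Prod.mk.injEq, funext_iff, Fin.forall_iff]

lemma pr_mono {m m' : ℕ} (h : m ≤ m') {x x' : XX d N} (hx : pr m' x = pr m' x') :
    pr m x = pr m x' := by
  rw [pr_eq_iff] at *
  exact ⟨fun i hi => hx.1 i (by omega), hx.2⟩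

/-- replace the first `m` coordinates and the label -/
def rep (m : ℕ) (u : CC d N m) (x : XX d N) : XX d N :=
  (fun i => if h : i < m then u.1 ⟨i, h⟩ else x.1 i, u.2)

lemma pr_rep (m : ℕ) (u : CC d N m) (x : XX d N) : pr m (rep m u x) = u := by
  ext i <;> simp [pr, rep]

lemma rep_of_ge {m i : ℕ} (h : m ≤ i) (u : CC d N m) (x : XX d N) :
    (rep m u x).1 i = x.1 i := by
  simp [rep, h]

lemma rep_rep (m : ℕ) (u u' : CC d N m) (x : XX d N) : rep m u (rep m u' x) = rep m u x := by
  simp only [rep, Prod.mk.injEq, and_true]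
  ext i
  split_ifs <;> rfl

lemma rep_pr (m : ℕ) (x : XX d N) : rep m (pr m x) x = x := by
  simp [rep, pr]

def upd (n : ℕ) (c : Fin (N n + 1)) (x : XX d N) : XX d N := (Function.update x.1 n c, x.2)

lemma upd_self (n : ℕ) (c : Fin (N n + 1)) (x : XX d N) : (upd n c x).1 n = c := by simp [upd]

lemma upd_ne {n i : ℕ} (h : i ≠ n) (c : Fin (N n + 1)) (x : XX d N) :
    (upd n c x).1 i = x.1 i := by simp [upd, h]

lemma upd_upd (n : ℕ) (c c' : Fin (N n + 1)) (x : XX d N) : upd n c (upd n c' x) = upd n c x := by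
  simp [upd]

lemma upd_eq (n : ℕ) (x : XX d N) : upd n (x.1 n) x = x := by simp [upd]

lemma pr_upd {m n : ℕ} (h : m ≤ n) (c : Fin (N n + 1)) (x : XX d N) :
    pr m (upd n c x) = pr m x := by
  rw [pr_eq_iff]
  exact ⟨fun i hi => upd_ne (by omega) _ _, rfl⟩

def sg (n m : ℕ) (u u' : CC d N m) (x : XX d N) : XX d N :=
  if pr m x = u then
    (if x.1 n = Fin.last _ then rep m u' x else upd n (x.1 n + 1) x)
  else if pr m x = u' then
    (if x.1 n = 0 then rep m u x else upd n (x.1 n - 1) x)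
  else x

lemma fin_add_one_ne {k : ℕ} {c : Fin (k + 1)} (h : c ≠ Fin.last k) : c + 1 ≠ 0 := by
  intro h2
  apply h
  have : c + 1 = Fin.last k + 1 := by rw [h2, Fin.last_add_one]
  exact add_right_cancel this

lemma fin_sub_one_ne {k : ℕ} {c : Fin (k + 1)} (h : c ≠ 0) : c - 1 ≠ Fin.last k := by
  intro h2
  apply h
  have : c = Fin.last k + 1 := by rw [← h2, sub_add_cancel]
  rw [this, Fin.last_add_one]

lemma sg_sg {n m : ℕ} (h : m ≤ n) {u u' : CC d N m} (hu : u ≠ u') (x : XX d N) :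
    sg n m u' u (sg n m u u' x) = x := by
  by_cases h1 : pr m x = u
  · by_cases h2 : x.1 n = Fin.last _
    · have e : sg n m u u' x = rep m u' x := by simp [sg, h1, h2]
      rw [e]
      have : sg n m u' u (rep m u' x) = rep m u (rep m u' x) := by
        simp [sg, pr_rep, rep_of_ge h, h2]
      rw [this, rep_rep, ← h1, rep_pr]
    · have e : sg n m u u' x = upd n (x.1 n + 1) x := by simp [sg, h1, h2]
      rw [e]
      have : sg n m u' u (upd n (x.1 n + 1) x) = upd n (x.1 n) (upd n (x.1 n + 1) x) := by
        simp [sg, pr_upd h, h1, hu, upd_self, fin_add_one_ne h2]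
      rw [this, upd_upd, upd_eq]
  · by_cases h1' : pr m x = u'
    · by_cases h2 : x.1 n = 0
      · have e : sg n m u u' x = rep m u x := by simp [sg, h1', hu.symm, h2]
        rw [e]
        have : sg n m u' u (rep m u x) = rep m u' (rep m u x) := by
          simp [sg, pr_rep, hu, rep_of_ge h, h2]
        rw [this, rep_rep, ← h1', rep_pr]
      · have e : sg n m u u' x = upd n (x.1 n - 1) x := by simp [sg, h1', hu.symm, h2]
        rw [e]
        have : sg n m u' u (upd n (x.1 n - 1) x) = upd n (x.1 n) (upd n (x.1 n - 1) x) := by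
          simp [sg, pr_upd h, h1', upd_self, fin_sub_one_ne h2]
        rw [this, upd_upd, upd_eq]
    · simp [sg, h1, h1']

def Resp (M0 : ℕ) (f : XX d N → XX d N) : Prop :=
  ∀ M, M0 ≤ M → ∀ x x', pr M x = pr M x' → pr M (f x) = pr M (f x')

def Bad (n : ℕ) (y : YY N) : Prop := y n = 0 ∨ y n = Fin.last _

structure IsStep (n : ℕ) (f : XX d N → XX d N) : Prop where
  resp : Resp (n + 1) f
  fix : ∀ x i, n < i → (f x).1 i = x.1 i
  good : ∀ x, ¬ Bad n x.1 → pr n (f x) = pr n x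

lemma pr_rep_congr {m M : ℕ} (u : CC d N m) {x x' : XX d N}
    (h : pr M x = pr M x') : pr M (rep m u x) = pr M (rep m u x') := by
  rw [pr_eq_iff] at *
  refine ⟨fun i hi => ?_, rfl⟩
  simp only [rep]
  split_ifs
  · rfl
  · exact h.1 i hi

lemma pr_upd_congr {n M : ℕ} (c : Fin (N n + 1)) {x x' : XX d N}
    (h : pr M x = pr M x') : pr M (upd n c x) = pr M (upd n c x') := by
  rw [pr_eq_iff] at *
  refine ⟨fun i hi => ?_, h.2⟩
  by_cases hin : i = n
  · subst hin; simp [upd_self]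
  · rw [upd_ne hin, upd_ne hin, h.1 i hi]

lemma isStep_sg {n m : ℕ} (h : m ≤ n) (u u' : CC d N m) : IsStep n (sg n m u u') where
  resp := by
    intro M hM x x' hx
    have h1 : pr m x = pr m x' := pr_mono (by omega) hx
    have h2 : x.1 n = x'.1 n := (pr_eq_iff.1 hx).1 n (by omega)
    simp only [sg, h1, h2]
    split_ifs
    · exact pr_rep_congr _ hx
    · exact pr_upd_congr _ hx
    · exact pr_rep_congr _ hx
    · exact pr_upd_congr _ hx
    · exact hx
  fix := by
    intro x i hi
    simp only [sg]
    split_ifs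
    · exact rep_of_ge (by omega) _ _
    · exact upd_ne (by omega) _ _
    · exact rep_of_ge (by omega) _ _
    · exact upd_ne (by omega) _ _
    · rfl
  good := by
    intro x hx
    simp only [Bad, not_or] at hx
    simp only [sg, hx.1, hx.2, if_false]
    split_ifs
    · exact pr_upd le_rfl _ _
    · exact pr_upd le_rfl _ _
    · rfl

lemma isStep_id (n : ℕ) : IsStep n (id : XX d N → XX d N) :=
  ⟨fun _ _ _ _ h => h, fun _ _ _ => rfl, fun _ _ => rfl⟩

/-- potential -/
noncomputable def ps (m : ℕ) (u u' : CC d N m) (x : XX d N) : ℝ :=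
  (if pr m x = u then 1 else 0) - (if pr m x = u' then 1 else 0)

lemma fin_val_add_one {k : ℕ} {c : Fin (k + 1)} (h : c ≠ Fin.last k) :
    ((c + 1).val : ℝ) = c.val + 1 := by
  have : (c + 1).val = c.val + 1 := Fin.val_add_one_of_lt (Fin.lt_last_iff_ne_last.2 h)
  rw [this]; push_cast; rfl

lemma fin_val_sub_one {k : ℕ} {c : Fin (k + 1)} (h : c ≠ 0) :
    ((c - 1).val : ℝ) = c.val - 1 := by
  have := fin_val_add_one (fin_sub_one_ne h)
  rw [sub_add_cancel] at this
  linarith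

lemma sg_abs {n m : ℕ} (h : m ≤ n) (u u' : CC d N m) (x : XX d N) :
    |((sg n m u u' x).1 n : ℝ) - (x.1 n : ℝ)| ≤ 1 := by
  simp only [sg]
  split_ifs with h1 h2 h3 h4
  · simp [rep_of_ge h]
  · simp [upd_self, fin_val_add_one h2]
  · simp [rep_of_ge h]
  · simp [upd_self, fin_val_sub_one h4]
  · simp

lemma sg_ps {n m : ℕ} {u u' : CC d N m} (hu : u ≠ u') (x : XX d N)
    (hx : ¬ Bad n x.1) :
    ((sg n m u u' x).1 n : ℝ) - (x.1 n : ℝ) = ps m u u' x := by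
  simp only [Bad, not_or] at hx
  simp only [sg, hx.1, hx.2, if_false, ps]
  split_ifs with h1 h2 h3
  · exact absurd (h1.symm.trans h2) hu
  · simp [upd_self, fin_val_add_one hx.2]
  · simp [upd_self, fin_val_sub_one hx.1]
  · simp

/-- steps -/
abbrev Trip (d : ℕ) (N : ℕ → ℕ) : Type := Σ m, CC d N m × CC d N m

def Act (n : ℕ) (t : Trip d N) : Prop := t.1 ≤ n ∧ t.2.1 ≠ t.2.2

open Classical in
noncomputable def stp (n : ℕ) (t : Trip d N) : Equiv.Perm (XX d N) :=
  if h : Act n t then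
    ⟨sg n t.1 t.2.1 t.2.2, sg n t.1 t.2.2 t.2.1, sg_sg h.1 h.2, sg_sg h.1 h.2.symm⟩
  else 1

open Classical in
noncomputable def psi (n : ℕ) (t : Trip d N) (x : XX d N) : ℝ :=
  if Act n t then ps t.1 t.2.1 t.2.2 x else 0

lemma stp_isStep (n : ℕ) (t : Trip d N) : IsStep n (stp n t) := by
  unfold stp
  split_ifs with h
  · exact isStep_sg h.1 _ _
  · exact isStep_id n

lemma stp_symm_isStep (n : ℕ) (t : Trip d N) : IsStep n (stp n t).symm := by
  unfold stp
  split_ifs with h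
  · exact isStep_sg h.1 _ _
  · exact isStep_id n

lemma stp_abs (n : ℕ) (t : Trip d N) (x : XX d N) :
    |((stp n t x).1 n : ℝ) - (x.1 n : ℝ)| ≤ 1 := by
  unfold stp
  split_ifs with h
  · exact sg_abs h.1 _ _ _
  · simp

lemma stp_psi (n : ℕ) (t : Trip d N) (x : XX d N) (hx : ¬ Bad n x.1) :
    ((stp n t x).1 n : ℝ) - (x.1 n : ℝ) = psi n t x := by
  unfold stp psi
  split_ifs with h
  · exact sg_ps h.2 _ hx
  · simp

variable (t : ℕ → Trip d N)

noncomputable def th : ℕ → Equiv.Perm (XX d N)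
  | 0 => 1
  | n + 1 => (stp n (t n)).trans (th n)

lemma th_succ (n : ℕ) (x : XX d N) : th t (n + 1) x = th t n (stp n (t n) x) := rfl

lemma th_succ_symm (n : ℕ) (x : XX d N) :
    (th t (n + 1)).symm x = (stp n (t n)).symm ((th t n).symm x) := rfl

lemma th_resp (n : ℕ) : Resp n (th t n) := by
  induction n with
  | zero => exact fun _ _ _ _ h => h
  | succ n ih =>
    intro M hM x x' h
    rw [th_succ, th_succ]
    exact ih M (by omega) _ _ ((stp_isStep n (t n)).resp M hM _ _ h)

lemma th_symm_resp (n : ℕ) : Resp n (th t n).symm := by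
  induction n with
  | zero => exact fun _ _ _ _ h => h
  | succ n ih =>
    intro M hM x x' h
    rw [th_succ_symm, th_succ_symm]
    exact (stp_symm_isStep n (t n)).resp M hM _ _ (ih M (by omega) _ _ h)

lemma th_fix (n : ℕ) (x : XX d N) (i : ℕ) (hi : n ≤ i) : (th t n x).1 i = x.1 i := by
  induction n generalizing x with
  | zero => rfl
  | succ n ih =>
    rw [th_succ, ih _ (by omega), (stp_isStep n (t n)).fix _ _ (by omega)]

lemma th_symm_fix (n : ℕ) (x : XX d N) (i : ℕ) (hi : n ≤ i) : ((th t n).symm x).1 i = x.1 i := by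
  have := th_fix t n ((th t n).symm x) i hi
  rw [Equiv.apply_symm_apply] at this
  exact this.symm

lemma th_succ_pr {n : ℕ} {x : XX d N} (hx : ¬ Bad n x.1) :
    pr n (th t (n + 1) x) = pr n (th t n x) :=
  th_resp t n n le_rfl _ _ ((stp_isStep n (t n)).good _ hx)

lemma th_succ_symm_pr {n : ℕ} {x : XX d N} (hx : ¬ Bad n x.1) :
    pr n ((th t (n + 1)).symm x) = pr n ((th t n).symm x) := by
  rw [th_succ_symm]
  apply (stp_symm_isStep n (t n)).good
  simpa only [Bad, th_symm_fix t n x n le_rfl] using hx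

lemma exists_lim {n0 : ℕ} (z : ℕ → XX d N) (hz : ∀ m, n0 ≤ m → pr m (z (m + 1)) = pr m (z m)) :
    ∃ w : XX d N, ∀ m, n0 ≤ m → pr m (z m) = pr m w := by
  have key : ∀ m, n0 ≤ m → ∀ j, m ≤ j → pr m (z j) = pr m (z m) := by
    intro m hm j hj
    induction j, hj using Nat.le_induction with
    | base => rfl
    | succ j hj ih => rw [pr_mono hj (hz j (by omega)), ih]
  refine ⟨(fun i => (z (max n0 (i + 1))).1 i, (z n0).2), fun m hm => pr_eq_iff.2 ⟨?_, ?_⟩⟩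
  · intro i hi
    exact (pr_eq_iff.1 (key (max n0 (i + 1)) (le_max_left _ _) m (by omega))).1 i (by omega)
  · exact (pr_eq_iff.1 (key n0 le_rfl m hm)).2

def RR (x w : XX d N) : Prop := ∀ᶠ m in atTop, pr m (th t m x) = pr m w

lemma RR_iff {x w : XX d N} : RR t x w ↔ ∀ᶠ m in atTop, pr m ((th t m).symm w) = pr m x := by
  apply eventually_congr
  refine Eventually.of_forall fun m => ⟨fun h => ?_, fun h => ?_⟩
  · have := th_symm_resp t m m le_rfl _ _ h
    rw [Equiv.symm_apply_apply] at this
    exact this.symm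
  · have := th_resp t m m le_rfl _ _ h
    rw [Equiv.apply_symm_apply] at this
    exact this.symm

lemma eq_of_ev {w w' : XX d N} (h : ∀ᶠ m in atTop, pr m w = pr m w') : w = w' := by
  obtain ⟨m0, h0⟩ := eventually_atTop.1 h
  refine Prod.ext (funext fun i => ?_) (pr_eq_iff.1 (h0 m0 le_rfl)).2
  exact (pr_eq_iff.1 (h0 (max m0 (i + 1)) (le_max_left _ _))).1 i (by omega)

lemma RR_right_unique {x w w' : XX d N} (h : RR t x w) (h' : RR t x w') : w = w' :=
  eq_of_ev (by filter_upwards [h, h'] with m a b; rw [← a, b])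

lemma RR_left_unique {x x' w : XX d N} (h : RR t x w) (h' : RR t x' w) : x = x' := by
  rw [RR_iff] at h h'
  exact eq_of_ev (by filter_upwards [h, h'] with m a b; rw [← a, b])

lemma RR_pr {n0 : ℕ} {x w : XX d N} (hx : ∀ m, n0 ≤ m → ¬ Bad m x.1) (h : RR t x w) :
    ∀ m, n0 ≤ m → pr m (th t m x) = pr m w := by
  obtain ⟨w', hw'⟩ := exists_lim (fun m => th t m x) (fun m hm => th_succ_pr t (hx m hm))
  have : RR t x w' := eventually_atTop.2 ⟨n0, hw'⟩
  rw [RR_right_unique t h this]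
  exact hw'

lemma RR_coord {m : ℕ} {x w : XX d N} (h : pr (m + 1) (th t (m + 1) x) = pr (m + 1) w) :
    w.1 m = (stp m (t m) x).1 m := by
  rw [← (pr_eq_iff.1 h).1 m (by omega), th_succ, th_fix t m _ m le_rfl]

def InY (y : YY N) : Prop := ∀ r : ℕ, ∀ᶠ n in atTop, r ≤ (y n).val ∧ (y n).val + r ≤ N n

lemma InY.good {y : YY N} (h : InY y) : ∃ n0, ∀ m, n0 ≤ m → ¬ Bad m y := by
  obtain ⟨n0, h0⟩ := eventually_atTop.1 (h 1)
  refine ⟨n0, fun m hm => ?_⟩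
  have := h0 m hm
  rintro (hb | hb)
  · rw [hb] at this; simp at this
  · rw [hb] at this; simp at this

lemma InY.of_close {y y' : YY N} (h : InY y)
    (hc : ∀ᶠ n in atTop, |((y' n).val : ℝ) - (y n).val| ≤ 1) : InY y' := by
  intro r
  filter_upwards [h (r + 1), hc] with n h1 h2
  rw [abs_le] at h2
  have a : ((y n).val : ℝ) ≤ (y' n).val + 1 := by linarith
  have b : ((y' n).val : ℝ) ≤ (y n).val + 1 := by linarith
  have a' : (y n).val ≤ (y' n).val + 1 := by exact_mod_cast a
  have b' : (y' n).val ≤ (y n).val + 1 := by exact_mod_cast b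
  omega

lemma RR_close {x w : XX d N} (h : RR t x w) :
    ∀ᶠ n in atTop, |((w.1 n).val : ℝ) - (x.1 n).val| ≤ 1 := by
  have h' := (tendsto_add_atTop_nat 1).eventually h
  filter_upwards [h'] with n hn
  rw [RR_coord t hn]
  exact stp_abs _ _ _

lemma RR_InY {x w : XX d N} (h : RR t x w) (hx : InY x.1) : InY w.1 :=
  hx.of_close (RR_close t h)

lemma RR_InY' {x w : XX d N} (h : RR t x w) (hw : InY w.1) : InY x.1 :=
  hw.of_close (by filter_upwards [RR_close t h] with n hn; rwa [abs_sub_comm])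

lemma RR_total {x : XX d N} (hx : InY x.1) : ∃ w, RR t x w := by
  obtain ⟨n0, h0⟩ := hx.good
  obtain ⟨w', hw'⟩ := exists_lim (fun m => th t m x) (fun m hm => th_succ_pr t (h0 m hm))
  exact ⟨w', eventually_atTop.2 ⟨n0, hw'⟩⟩

lemma RR_surj {w : XX d N} (hw : InY w.1) : ∃ x, RR t x w := by
  obtain ⟨n0, h0⟩ := hw.good
  obtain ⟨x', hx'⟩ := exists_lim (fun m => (th t m).symm w)
    (fun m hm => th_succ_symm_pr t (h0 m hm))
  exact ⟨x', (RR_iff t).2 (eventually_atTop.2 ⟨n0, hx'⟩)⟩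

abbrev Y1 (N : ℕ → ℕ) : Type := {y : YY N // InY y}
abbrev X1 (d : ℕ) (N : ℕ → ℕ) : Type := Y1 N × Fin d

def io (x : X1 d N) : XX d N := (x.1.1, x.2)

lemma io_inj : Function.Injective (io : X1 d N → XX d N) := by
  rintro ⟨⟨a, _⟩, b⟩ ⟨⟨a', _⟩, b'⟩ h
  simp only [io, Prod.mk.injEq] at h
  simp [h.1, h.2]

lemma ex_fwd (x : X1 d N) : ∃ w : X1 d N, RR t (io x) (io w) := by
  obtain ⟨w, hw⟩ := RR_total t (x := io x) x.1.2
  exact ⟨(⟨w.1, RR_InY t hw x.1.2⟩, w.2), hw⟩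

lemma ex_bwd (w : X1 d N) : ∃ x : X1 d N, RR t (io x) (io w) := by
  obtain ⟨x, hx⟩ := RR_surj t (w := io w) w.1.2
  exact ⟨(⟨x.1, RR_InY' t hx w.1.2⟩, x.2), hx⟩

noncomputable def Th : Equiv.Perm (X1 d N) where
  toFun x := (ex_fwd t x).choose
  invFun w := (ex_bwd t w).choose
  left_inv x := io_inj (RR_left_unique t (ex_bwd t _).choose_spec (ex_fwd t x).choose_spec)
  right_inv w := io_inj (RR_right_unique t (ex_fwd t _).choose_spec (ex_bwd t w).choose_spec)

lemma Th_RR (x : X1 d N) : RR t (io x) (io (Th t x)) := (ex_fwd t x).choose_spec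

lemma Th_symm_RR (x : X1 d N) : RR t (io ((Th t).symm x)) (io x) := (ex_bwd t x).choose_spec

end Constr

namespace Constr

open Filter

variable {d : ℕ} {N : ℕ → ℕ}

lemma pr_meas (m : ℕ) : Measurable (pr m : XX d N → CC d N m) := by
  unfold pr
  fun_prop

lemma cyl_meas (m : ℕ) (c : CC d N m) : MeasurableSet (pr m ⁻¹' {c} : Set (XX d N)) :=
  pr_meas m (measurableSet_singleton c)

/-- extension by zero -/
def lft (m : ℕ) (c : CC d N m) : XX d N := rep m c (0, c.2)

lemma pr_lft (m : ℕ) (c : CC d N m) : pr m (lft m c) = c := pr_rep m c _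

lemma Resp.measurable {M0 : ℕ} {f : XX d N → XX d N} (hf : Resp M0 f) : Measurable f := by
  have key : ∀ M, M0 ≤ M → ∀ x, pr M (f x) = pr M (f (lft M (pr M x))) := fun M hM x =>
    hf M hM _ _ (pr_lft M _).symm
  refine Measurable.prodMk (measurable_pi_iff.2 fun i => ?_) ?_
  · have e : (fun x => (f x).1 i) =
        (fun c => (f (lft (max M0 (i + 1)) c)).1 i) ∘ pr (max M0 (i + 1)) := by
      ext x
      exact congrArg _ ((pr_eq_iff.1 (key (max M0 (i + 1)) (le_max_left _ _) x)).1 i (by omega))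
    rw [e]
    exact (measurable_of_countable _).comp (pr_meas _)
  · have e : (fun x => (f x).2) = (fun c => (f (lft M0 c)).2) ∘ pr M0 := by
      ext x
      exact congrArg _ (pr_eq_iff.1 (key M0 le_rfl x)).2
    rw [e]
    exact (measurable_of_countable _).comp (pr_meas _)

/-- the cylinders -/
def cyls (d : ℕ) (N : ℕ → ℕ) (M0 : ℕ) : Set (Set (XX d N)) :=
  {A | ∃ m, M0 ≤ m ∧ ∃ c : CC d N m, A = pr m ⁻¹' {c}}

lemma cyls_pi (M0 : ℕ) : IsPiSystem (cyls d N M0) := by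
  have key : ∀ m m' (c : CC d N m) (c' : CC d N m'), m ≤ m' → M0 ≤ m' →
      (pr m ⁻¹' {c} ∩ pr m' ⁻¹' {c'} : Set (XX d N)).Nonempty →
      pr m ⁻¹' {c} ∩ pr m' ⁻¹' {c'} ∈ cyls d N M0 := by
    rintro m m' c c' h h0 ⟨z, hz1, hz2⟩
    refine ⟨m', h0, c', ?_⟩
    apply Set.inter_eq_right.2
    intro x hx
    have h1 : pr m' x = pr m' z := Eq.trans hx (Eq.symm hz2)
    exact Eq.trans (pr_mono h h1) hz1
  rintro _ ⟨m, hm, c, rfl⟩ _ ⟨m', hm', c', rfl⟩ hne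
  rcases le_total m m' with h | h
  · exact key m m' c c' h hm' hne
  · rw [Set.inter_comm] at hne ⊢
    exact key m' m c' c h hm hne

lemma cyls_gen (M0 : ℕ) :
    (inferInstance : MeasurableSpace (XX d N)) = MeasurableSpace.generateFrom (cyls d N M0) := by
  apply le_antisymm
  · have hpr : ∀ m, M0 ≤ m →
        @Measurable _ _ (MeasurableSpace.generateFrom (cyls d N M0)) _ (pr m) := by
      intro m hm
      refine @measurable_to_countable' _ _ _ _ (MeasurableSpace.generateFrom (cyls d N M0)) _ ?_
      intro c
      exact MeasurableSpace.measurableSet_generateFrom ⟨m, hm, c, rfl⟩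
    have hid : @Measurable _ _ (MeasurableSpace.generateFrom (cyls d N M0)) _
        (id : XX d N → XX d N) := by
      refine @Measurable.prodMk _ (MeasurableSpace.generateFrom (cyls d N M0)) _ _ _ _
        (fun x : XX d N => x.1) (fun x : XX d N => x.2)
        (@measurable_pi_lambda _ _ _ (MeasurableSpace.generateFrom (cyls d N M0)) _ _
          fun i => ?_) ?_
      · have e : (fun x : XX d N => x.1 i) =
          (fun c : CC d N (max M0 (i + 1)) => c.1 ⟨i, by omega⟩) ∘ pr (max M0 (i + 1)) := rfl
        rw [e]
        exact (measurable_of_countable _).comp (hpr _ (le_max_left _ _))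
      · have e : (fun x : XX d N => x.2) = (fun c : CC d N M0 => c.2) ∘ pr M0 := rfl
        rw [e]
        exact (measurable_of_countable _).comp (hpr _ le_rfl)
    intro s hs
    exact hid hs
  · apply MeasurableSpace.generateFrom_le
    rintro _ ⟨m, hm, c, rfl⟩
    exact cyl_meas m c

lemma ext_cyl {μ μ' : Measure (XX d N)} [IsFiniteMeasure μ] [IsFiniteMeasure μ'] (M0 : ℕ)
    (h : ∀ m, M0 ≤ m → ∀ c, μ (pr m ⁻¹' {c}) = μ' (pr m ⁻¹' {c})) : μ = μ' := by
  refine ext_of_generate_finite _ (cyls_gen M0) (cyls_pi M0) ?_ ?_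
  · rintro _ ⟨m, hm, c, rfl⟩
    exact h m hm c
  · have e : (Set.univ : Set (XX d N)) = ⋃ c, pr M0 ⁻¹' {c} := by ext x; simp
    have hd : Pairwise (Function.onFun Disjoint fun c => (pr M0 ⁻¹' {c} : Set (XX d N))) := by
      intro c c' hcc
      exact Disjoint.preimage _ (by simpa using hcc)
    rw [e, measure_iUnion hd fun c => cyl_meas _ c, measure_iUnion hd fun c => cyl_meas _ c]
    exact tsum_congr fun c => h M0 le_rfl c

noncomputable def uN (k : ℕ) : Measure (Fin (k + 1)) := ProbabilityTheory.uniformOn Set.univ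

instance (k : ℕ) : IsProbabilityMeasure (uN k) := by
  unfold uN
  exact ProbabilityTheory.isProbabilityMeasure_uniformOn Set.finite_univ Set.univ_nonempty

lemma uN_apply (k : ℕ) (s : Set (Fin (k + 1))) :
    uN k s = (Set.encard s : ENNReal) / ((k : ENNReal) + 1) := by
  unfold uN
  rw [ProbabilityTheory.uniformOn_univ, Measure.count_apply s.toFinite.measurableSet]
  simp

noncomputable def nuf (N : ℕ → ℕ) : Measure (YY N) := Measure.infinitePi fun n => uN (N n)

instance : IsProbabilityMeasure (nuf N) := by unfold nuf; infer_instance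

noncomputable def muf (d : ℕ) (N : ℕ → ℕ) : Measure (XX d N) := (nuf N).prod Measure.count

instance : IsFiniteMeasure (muf d N) := by unfold muf; infer_instance

lemma muf_cyl (m : ℕ) (c : CC d N m) :
    muf d N (pr m ⁻¹' {c}) = ∏ i ∈ Finset.range m, ((N i : ENNReal) + 1)⁻¹ := by
  have e : (pr m ⁻¹' {c} : Set (XX d N)) =
      (Set.pi (Finset.range m) fun i => {(lft m c).1 i}) ×ˢ {c.2} := by
    ext x
    have : pr m x = c ↔ pr m x = pr m (lft m c) := by rw [pr_lft]
    simp only [Set.mem_preimage, Set.mem_singleton_iff, this, pr_eq_iff, Set.mem_prod, Set.mem_pi,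
      Finset.coe_range, Set.mem_Iio]
    rfl
  rw [e, muf, Measure.prod_prod, nuf, Measure.infinitePi_pi]
  · simp [uN_apply]
  · intro i _
    exact measurableSet_singleton _

lemma mp_of_resp {M0 : ℕ} (T : Equiv.Perm (XX d N)) (h : Resp M0 T) (h' : Resp M0 T.symm) :
    MeasurePreserving T (muf d N) (muf d N) := by
  refine ⟨h.measurable, ?_⟩
  have : IsFiniteMeasure (Measure.map T (muf d N)) := inferInstance
  refine ext_cyl M0 fun m hm c => ?_
  rw [Measure.map_apply h.measurable (cyl_meas m c)]
  have e : T ⁻¹' (pr m ⁻¹' {c}) = pr m ⁻¹' {pr m (T.symm (lft m c))} := by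
    ext x
    simp only [Set.mem_preimage, Set.mem_singleton_iff]
    constructor
    · intro hx
      rw [← pr_lft m c] at hx
      have := h' m hm _ _ hx
      rwa [Equiv.symm_apply_apply] at this
    · intro hx
      have := h m hm _ _ hx
      rwa [Equiv.apply_symm_apply, pr_lft] at this
  rw [e, muf_cyl, muf_cyl]

lemma InY_meas : MeasurableSet {y : YY N | InY y} := by
  have : {y : YY N | InY y} = ⋂ r : ℕ, ⋃ n0 : ℕ, ⋂ n : ℕ, ⋂ (_ : n0 ≤ n),
      (fun y : YY N => y n) ⁻¹' {c | r ≤ c.val ∧ c.val + r ≤ N n} := by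
    ext y
    simp [InY, eventually_atTop]
  rw [this]
  refine MeasurableSet.iInter fun r => MeasurableSet.iUnion fun n0 => MeasurableSet.iInter fun n =>
    MeasurableSet.iInter fun _ => measurable_pi_apply n (Set.toFinite _).measurableSet

instance : StandardBorelSpace (Y1 N) := InY_meas.standardBorel

noncomputable def nu1 (N : ℕ → ℕ) : Measure (Y1 N) := (nuf N).comap Subtype.val

lemma nu1_map (hN : ∀ᵐ y ∂nuf N, InY y) :
    MeasurePreserving (Subtype.val : Y1 N → YY N) (nu1 N) (nuf N) := by
  refine ⟨measurable_subtype_coe, ?_⟩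
  have := map_comap_subtype_coe (InY_meas (N := N)) (nuf N)
  refine Eq.trans this ?_
  exact Measure.restrict_eq_self_of_ae_mem hN

lemma nu1_prob (hN : ∀ᵐ y ∂nuf N, InY y) : IsProbabilityMeasure (nu1 N) := by
  constructor
  have := (nu1_map hN).measure_preimage (s := Set.univ) MeasurableSet.univ.nullMeasurableSet
  simpa using this

lemma io_meas : Measurable (io : X1 d N → XX d N) := by
  unfold io
  fun_prop

lemma io_emb : MeasurableEmbedding (io : X1 d N → XX d N) := io_meas.measurableEmbedding io_inj

lemma io_mp (hN : ∀ᵐ y ∂nuf N, InY y) :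
    MeasurePreserving (io : X1 d N → XX d N) ((nu1 N).prod Measure.count) (muf d N) := by
  have := nu1_prob hN
  exact (nu1_map hN).prod (MeasurePreserving.id Measure.count)

lemma meas_of_ev {α : Type*} [MeasurableSpace α] {f : ℕ → α → XX d N} {g : α → XX d N}
    (hf : ∀ j, Measurable (f j)) (h : ∀ x, ∀ᶠ m in atTop, pr m (f m x) = pr m (g x)) :
    Measurable g := by
  refine Measurable.prodMk (measurable_pi_iff.2 fun i => ?_) ?_
  · refine measurable_of_tendsto_metrizable (f := fun j x => (f j x).1 i)
      (fun j => (measurable_pi_apply i).comp (measurable_fst.comp (hf j))) (tendsto_pi_nhds.2 ?_)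
    intro x
    refine tendsto_const_nhds.congr' ?_
    filter_upwards [h x, eventually_gt_atTop i] with m hm hi
    exact ((pr_eq_iff.1 hm).1 i hi).symm
  · refine measurable_of_tendsto_metrizable (f := fun j x => (f j x).2)
      (fun j => measurable_snd.comp (hf j)) (tendsto_pi_nhds.2 ?_)
    intro x
    refine tendsto_const_nhds.congr' ?_
    filter_upwards [h x] with m hm
    exact ((pr_eq_iff.1 hm).2).symm

variable (t : ℕ → Trip d N)

lemma Th_meas : Measurable (Th t) := by
  rw [← io_emb.measurable_comp_iff]
  exact meas_of_ev (f := fun m x => th t m (io x))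
    (fun m => (th_resp t m).measurable.comp io_meas) (fun x => Th_RR t x)

lemma Th_symm_meas : Measurable (Th t).symm := by
  rw [← io_emb.measurable_comp_iff]
  exact meas_of_ev (f := fun m x => (th t m).symm (io x))
    (fun m => (th_symm_resp t m).measurable.comp io_meas)
    (fun x => (RR_iff t).1 (Th_symm_RR t x))

noncomputable def ThM : X1 d N ≃ᵐ X1 d N := ⟨Th t, Th_meas t, Th_symm_meas t⟩

lemma ThM_mp (hN : ∀ᵐ y ∂nuf N, InY y) :
    MeasurePreserving (ThM t) ((nu1 N).prod Measure.count) ((nu1 N).prod Measure.count) := by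
  have := nu1_prob hN
  refine ⟨(ThM t).measurable, ?_⟩
  have hT : Measurable (fun x => io (Th t x)) := io_meas.comp (Th_meas t)
  have key : Measure.map io (Measure.map (ThM t) ((nu1 N).prod Measure.count)) = muf d N := by
    rw [Measure.map_map io_meas (ThM t).measurable]
    refine ext_cyl 0 fun m _ c => ?_
    rw [Measure.map_apply (io_meas.comp (ThM t).measurable) (cyl_meas m c)]
    have h1 : Tendsto (fun j => ((nu1 N).prod Measure.count)
        ((fun x => th t j (io x)) ⁻¹' (pr m ⁻¹' {c}))) atTop
        (nhds (((nu1 N).prod Measure.count) ((fun x => io (Th t x)) ⁻¹' (pr m ⁻¹' {c})))) := by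
      apply tendsto_measure_of_tendsto_indicator_of_isFiniteMeasure
      · intro j
        exact ((th_resp t j).measurable.comp io_meas) (cyl_meas m c)
      · intro x
        filter_upwards [Th_RR t x, eventually_ge_atTop m] with j hj hm
        simp only [Set.mem_preimage, Set.mem_singleton_iff]
        rw [pr_mono hm hj]
    have h2 : ∀ j, ((nu1 N).prod Measure.count)
        ((fun x => th t j (io x)) ⁻¹' (pr m ⁻¹' {c})) = muf d N (pr m ⁻¹' {c}) := fun j =>
      ((mp_of_resp (th t j) (th_resp t j) (th_symm_resp t j)).comp (io_mp hN)).measure_preimage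
        (cyl_meas m c).nullMeasurableSet
    simp only [h2] at h1
    exact (tendsto_nhds_unique h1 tendsto_const_nhds)
  rw [← (io_mp (d := d) hN).map_eq] at key
  rw [← io_emb.comap_map (Measure.map (ThM t) _), key, io_emb.comap_map]

end Constr

namespace Constr

open Filter

variable {d : ℕ} {N : ℕ → ℕ}

lemma nuf_coord (n : ℕ) (s : Set (Fin (N n + 1))) : nuf N {y | y n ∈ s} = uN (N n) s :=
  (measurePreserving_eval_infinitePi (fun n => uN (N n)) n).measure_preimage
    (s.toFinite.measurableSet).nullMeasurableSet

def edge (n j : ℕ) : Set (YY N) := {y | (y n).val = j ∨ (y n).val + j = N n}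

lemma edge_meas (n j : ℕ) : MeasurableSet (edge n j : Set (YY N)) :=
  measurable_pi_apply (X := fun n => Fin (N n + 1)) n
    (Set.toFinite {c : Fin (N n + 1) | c.val = j ∨ c.val + j = N n}).measurableSet

lemma nuf_edge (n j : ℕ) : nuf N (edge n j) ≤ 2 / ((N n : ENNReal) + 1) := by
  have h := nuf_coord n {c : Fin (N n + 1) | c.val = j ∨ c.val + j = N n}
  refine (le_of_eq h).trans ?_
  rw [uN_apply]
  apply ENNReal.div_le_div_right
  have h1 : Set.encard {c : Fin (N n + 1) | c.val = j ∨ c.val + j = N n} ≤ 2 := by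
    have e : {c : Fin (N n + 1) | c.val = j ∨ c.val + j = N n} =
        {c | c.val = j} ∪ {c | c.val + j = N n} := rfl
    rw [e]
    refine (Set.encard_union_le _ _).trans ?_
    have a : Set.encard {c : Fin (N n + 1) | c.val = j} ≤ 1 := by
      rw [Set.encard_le_one_iff]
      intro a b ha hb
      exact Fin.ext (Eq.trans ha (Eq.symm hb))
    have b : Set.encard {c : Fin (N n + 1) | c.val + j = N n} ≤ 1 := by
      rw [Set.encard_le_one_iff]
      intro a b ha hb
      simp only [Set.mem_ofPred_eq] at ha hb
      exact Fin.ext (by omega)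
    calc _ ≤ (1 : ℕ∞) + 1 := add_le_add a b
      _ = 2 := by norm_num
  exact_mod_cast ENat.toENNReal_le.2 h1

lemma Bad_iff (n : ℕ) (y : YY N) : Bad n y ↔ y ∈ (edge n 0 : Set (YY N)) := by
  simp only [Bad, edge, Set.mem_ofPred_eq, Fin.ext_iff, Fin.val_last, add_zero, Fin.val_zero]

lemma arith (K m a : ℕ) (h : 2 ^ m * K ≤ a) :
    (K : ENNReal) * (2 / ((a : ENNReal) + 1)) ≤ 2 * (2⁻¹ : ENNReal) ^ m := by
  rw [← mul_div_assoc]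
  apply ENNReal.div_le_of_le_mul
  have h1 : ((2 : ENNReal) ^ m * K) ≤ (a : ENNReal) + 1 := by
    have : ((2 ^ m * K : ℕ) : ENNReal) ≤ (a : ENNReal) := by exact_mod_cast h
    push_cast at this
    exact this.trans le_self_add
  calc (K : ENNReal) * 2 = 2 * (((2⁻¹ : ENNReal) ^ m * 2 ^ m) * K) := by
        rw [← mul_pow, ENNReal.inv_mul_cancel (by norm_num) (by norm_num)]; ring
    _ = 2 * (2⁻¹ : ENNReal) ^ m * (2 ^ m * K) := by ring
    _ ≤ _ := by gcongr

lemma ae_InY (h : ∀ n, 2 ^ n ≤ N n) : ∀ᵐ y ∂nuf N, InY y := by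
  have h1 : ∀ j, ∀ᵐ y ∂nuf N, ∀ᶠ n in atTop, y ∉ (edge n j : Set (YY N)) := by
    intro j
    apply ae_eventually_notMem
    have hle : ∑' n, nuf N (edge n j) ≤ ∑' n, 2 * (2⁻¹ : ENNReal) ^ n := by
      refine ENNReal.tsum_le_tsum fun n => (nuf_edge n j).trans ?_
      simpa using arith 1 n (N n) (by simpa using h n)
    refine ne_top_of_le_ne_top ?_ hle
    rw [ENNReal.tsum_mul_left, ENNReal.tsum_geometric, ENNReal.one_sub_inv_two, inv_inv]
    exact ENNReal.mul_ne_top (by norm_num) (by norm_num)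
  filter_upwards [ae_all_iff.2 h1] with y hy r
  have := (eventually_all_finset (Finset.range r)).2 fun j _ => hy j
  filter_upwards [this] with n hn
  simp only [edge, Set.mem_ofPred_eq, Finset.mem_range, not_or] at hn
  have hlt := (y n).isLt
  constructor
  · by_contra hc
    exact (hn (y n).val (by omega)).1 rfl
  · by_contra hc
    exact (hn (N n - (y n).val) (by omega)).2 (by omega)

/-- the fast growing sequence -/
def NN (d : ℕ) : ℕ → ℕ
  | 0 => 1
  | n + 1 => 2 ^ (n + 1) * (d + 1) ^ (NN d n + 1)

lemma NN_ge (d n : ℕ) : 2 ^ n ≤ NN d n := by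
  cases n with
  | zero => simp [NN]
  | succ n => exact Nat.le_mul_of_pos_right _ (by positivity)

lemma NN_pos (d n : ℕ) : 0 < NN d n := lt_of_lt_of_le (by positivity) (NN_ge d n)

lemma NN_mono (hd : 1 ≤ d) : Monotone (NN d) := by
  apply monotone_nat_of_le_succ
  intro n
  have h1 : NN d n + 1 < (d + 1) ^ (NN d n + 1) := Nat.lt_pow_self (by omega)
  have h2 : (d + 1) ^ (NN d n + 1) ≤ NN d (n + 1) := Nat.le_mul_of_pos_left _ (by positivity)
  omega

lemma NN_big (hd : 1 ≤ d) {n m : ℕ} (h : n < m) : 2 ^ m * (d + 1) ^ (NN d n + 1) ≤ NN d m := by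
  obtain ⟨k, rfl⟩ : ∃ k, m = k + 1 := ⟨m - 1, by omega⟩
  have := NN_mono hd (show n ≤ k by omega)
  simp only [NN]
  gcongr
  omega

lemma exists_enum (hd : 1 ≤ d) (N : ℕ → ℕ) :
    ∃ t : ℕ → Trip d N, ∀ τ, ∃ᶠ n in atTop, t n = τ := by
  have : Nonempty (Trip d N) := ⟨⟨0, ((fun _ => 0), ⟨0, by omega⟩), ((fun _ => 0), ⟨0, by omega⟩)⟩⟩
  obtain ⟨s, hs⟩ := exists_surjective_nat (Trip d N)
  refine ⟨fun n => s (Nat.unpair n).1, fun τ => ?_⟩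
  rw [frequently_atTop]
  intro n0
  obtain ⟨a, rfl⟩ := hs τ
  exact ⟨Nat.pair a n0, Nat.right_le_pair a n0, by simp⟩

lemma ev_ne {a b : XX d N} (h : a ≠ b) : ∀ᶠ m in atTop, pr m a ≠ pr m b := by
  have : ∃ m0, pr m0 a ≠ pr m0 b := by
    by_contra! hc
    exact h (eq_of_ev (Eventually.of_forall hc))
  obtain ⟨m0, h0⟩ := this
  filter_upwards [eventually_ge_atTop m0] with m hm h2
  exact h0 (pr_mono hm h2)

lemma psi_of_eq {n : ℕ} {τ τ' : Trip d N} (hn : τ.1 ≤ n) (hτ : τ.2.1 ≠ τ.2.2) (h : τ' = τ)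
    (x : XX d N) : psi n τ' x = ps τ.1 τ.2.1 τ.2.2 x := by
  subst h
  simp [psi, Act, hn, hτ]

variable (t : ℕ → Trip d N)

lemma psi_sep (hN : ∀ n, 0 < N n) (ht : ∀ τ, ∃ᶠ n in atTop, t n = τ) (hd : 1 ≤ d)
    (Q : Finset (X1 d N)) (e : X1 d N) :
    ∃ᶠ n in atTop, (∀ q ∈ Q, q ≠ e → psi n (t n) (io q) = 0) ∧ psi n (t n) (io e) = 1 := by
  classical
  have : ∀ n, Nontrivial (Fin (N n + 1)) := fun n =>
    Fin.nontrivial_iff_two_le.2 (by have := hN n; omega)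
  have : Nonempty (Fin d) := ⟨⟨0, by omega⟩⟩
  have : Infinite (YY N) := Pi.infinite_of_left
  have : Infinite (XX d N) := inferInstance
  obtain ⟨z, hz⟩ := Infinite.exists_notMem_finset ((insert e Q).image io)
  have hz' : ∀ q ∈ insert e Q, io q ≠ z := by
    intro q hq h
    exact hz (h ▸ Finset.mem_image_of_mem io hq)
  have h1 : ∀ᶠ m in atTop, ∀ q ∈ insert e Q, pr m (io q) ≠ pr m z :=
    (eventually_all_finset _).2 fun q hq => ev_ne (hz' q hq)
  have h2 : ∀ᶠ m in atTop, ∀ q ∈ Q, q ≠ e → pr m (io q) ≠ pr m (io e) := by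
    refine (eventually_all_finset _).2 fun q hq => ?_
    by_cases hqe : q = e
    · simp [hqe]
    · filter_upwards [ev_ne (io_inj.ne hqe)] with m hm _ using hm
  obtain ⟨m, hm1, hm2⟩ := (h1.and h2).exists
  have hne := hm1 e (Finset.mem_insert_self _ _)
  have hf := (ht ⟨m, pr m (io e), pr m z⟩).and_eventually (eventually_ge_atTop m)
  refine hf.mono ?_
  rintro n ⟨hn, hmn⟩
  constructor
  · intro q hq hqe
    rw [psi_of_eq hmn hne hn]
    simp [ps, hm2 q hq hqe, hm1 q (Finset.mem_insert_of_mem hq)]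
  · rw [psi_of_eq hmn hne hn]
    simp [ps, hne]

lemma ps_meas (m : ℕ) (u u' : CC d N m) : Measurable (ps m u u') := by
  have : ps m u u' = (fun c : CC d N m => ((if c = u then 1 else 0) - (if c = u' then 1 else 0) : ℝ)) ∘
    pr m := rfl
  rw [this]
  exact (measurable_of_countable _).comp (pr_meas m)

lemma psi_meas (n : ℕ) (τ : Trip d N) : Measurable (psi n τ) := by
  unfold psi
  split_ifs
  · exact ps_meas _ _ _
  · exact measurable_const

lemma psi_le (n : ℕ) (τ : Trip d N) (x : XX d N) : |psi n τ x| ≤ 1 := by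
  unfold psi ps
  split_ifs <;> simp

lemma span_aux (hN : ∀ᵐ y ∂nuf N, InY y) (ht : ∀ τ, ∃ᶠ n in atTop, t n = τ)
    (F : X1 d N → ℝ) (hF : Integrable F ((nu1 N).prod Measure.count))
    (h0 : ∫ x, F x ∂((nu1 N).prod Measure.count) = 0)
    (hl : Tendsto (fun n => ∫ x, F x * psi n (t n) (io x) ∂((nu1 N).prod Measure.count))
      atTop (nhds 0)) :
    F =ᵐ[(nu1 N).prod Measure.count] 0 := by
  have := nu1_prob hN
  set μ := (nu1 N).prod (Measure.count : Measure (Fin d)) with hμ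
  have cm : ∀ m (c : CC d N m), MeasurableSet (io ⁻¹' (pr m ⁻¹' {c}) : Set (X1 d N)) :=
    fun m c => io_meas (cyl_meas m c)
  have hind : ∀ m (c : CC d N m) (x : X1 d N), (io ⁻¹' (pr m ⁻¹' {c})).indicator F x =
      F x * (if pr m (io x) = c then 1 else 0) := by
    intro m c x
    by_cases h : pr m (io x) = c
    · rw [Set.indicator_of_mem (show x ∈ io ⁻¹' (pr m ⁻¹' {c}) from h), if_pos h, mul_one]
    · rw [Set.indicator_of_notMem (show x ∉ io ⁻¹' (pr m ⁻¹' {c}) from h), if_neg h, mul_zero]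
  have hI : ∀ m (c : CC d N m), ∫ x in io ⁻¹' (pr m ⁻¹' {c}), F x ∂μ =
      ∫ x, F x * (if pr m (io x) = c then 1 else 0) ∂μ := by
    intro m c
    rw [← integral_indicator (cm m c)]
    exact integral_congr_ae (Eventually.of_forall fun x => hind m c x)
  have hintg : ∀ m (c : CC d N m),
      Integrable (fun x => F x * (if pr m (io x) = c then 1 else 0)) μ := by
    intro m c
    refine (hF.indicator (cm m c)).congr (Eventually.of_forall fun x => hind m c x)
  have heq : ∀ m (u u' : CC d N m), ∫ x in io ⁻¹' (pr m ⁻¹' {u}), F x ∂μ =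
      ∫ x in io ⁻¹' (pr m ⁻¹' {u'}), F x ∂μ := by
    intro m u u'
    by_cases huu : u = u'
    · rw [huu]
    have hz : ∫ x, F x * ps m u u' (io x) ∂μ = 0 := by
      by_contra hc
      have h1 := hl.eventually_ne (Ne.symm hc)
      have h2 := (ht ⟨m, u, u'⟩).and_eventually ((eventually_ge_atTop m).and h1)
      obtain ⟨n, hn, hmn, hne⟩ := h2.exists
      apply hne
      congr 1
      ext x
      rw [psi_of_eq hmn huu hn]
    rw [hI, hI, ← sub_eq_zero, ← integral_sub (hintg m u) (hintg m u')]
    refine Eq.trans (integral_congr_ae (Eventually.of_forall fun x => ?_)) hz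
    simp only [ps]
    ring
  have hcyl : ∀ m (c : CC d N m), ∫ x in io ⁻¹' (pr m ⁻¹' {c}), F x ∂μ = 0 := by
    intro m c
    have h1 : ∑ c', ∫ x in io ⁻¹' (pr m ⁻¹' {c'}), F x ∂μ = 0 := by
      simp only [hI]
      rw [← integral_finsetSum _ fun c' _ => hintg m c']
      refine Eq.trans (integral_congr_ae (Eventually.of_forall fun x => ?_)) h0
      simp
    rw [Finset.sum_congr rfl fun c' _ => heq m c' c, Finset.sum_const, smul_eq_zero] at h1
    refine h1.resolve_left ?_
    have : Nonempty (CC d N m) := ⟨c⟩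
    rw [Finset.card_univ]
    exact Fintype.card_ne_zero
  have hall : ∀ B : Set (XX d N), MeasurableSet B → ∫ x in io ⁻¹' B, F x ∂μ = 0 := by
    intro B hB
    induction B, hB using MeasurableSpace.induction_on_inter (cyls_gen (d := d) (N := N) 0)
      (cyls_pi 0) with
    | empty => simp
    | basic B hB =>
      obtain ⟨m, _, c, rfl⟩ := hB
      exact hcyl m c
    | compl B hB ih =>
      have := integral_add_compl (io_meas hB) hF
      rw [ih, h0, zero_add] at this
      exact this
    | iUnion f hd hm ih =>
      rw [Set.preimage_iUnion, integral_iUnion (fun i => io_meas (hm i))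
        (fun i j hij => (hd hij).preimage _) hF.integrableOn]
      simp [ih]
  refine hF.ae_eq_zero_of_forall_setIntegral_eq_zero fun s hs _ => ?_
  have := hall (io '' s) (io_emb.measurableSet_image.2 hs)
  rwa [Set.preimage_image_eq _ io_inj] at this

lemma Th_eq {n : ℕ} {x : X1 d N} (hx : ∀ m, n < m → ¬ Bad m x.1.1) :
    (Th t x).1.1 n = (stp n (t n) (io x)).1 n :=
  RR_coord t (RR_pr t (n0 := n + 1) (x := io x) (fun m hm => hx m hm) (Th_RR t x) (n + 1) le_rfl)

lemma nu1_edge (hN : ∀ᵐ y ∂nuf N, InY y) (n : ℕ) :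
    nu1 N {y | Bad n y.1} ≤ 2 / ((N n : ENNReal) + 1) := by
  have e : {y : Y1 N | Bad n y.1} = Subtype.val ⁻¹' (edge n 0) := by
    ext y; exact Bad_iff n y.1
  rw [e, (nu1_map hN).measure_preimage (edge_meas n 0).nullMeasurableSet]
  exact nuf_edge n 0

lemma Bad_meas (n : ℕ) : MeasurableSet {y : Y1 N | Bad n y.1} := by
  have e : {y : Y1 N | Bad n y.1} = Subtype.val ⁻¹' (edge n 0) := by
    ext y; exact Bad_iff n y.1
  rw [e]
  exact measurable_subtype_coe (edge_meas n 0)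

lemma geo_lim : Tendsto (fun n : ℕ => 2 * (2⁻¹ : ENNReal) ^ n) atTop (nhds 0) := by
  have h := ENNReal.Tendsto.const_mul (a := 2)
    (ENNReal.tendsto_pow_atTop_nhds_zero_of_lt_one (r := 2⁻¹) (by simp))
    (Or.inr (by norm_num))
  simpa using h

lemma S_bound (hd : 1 ≤ d) (n : ℕ) : ((d : ENNReal) + 1) ^ (NN d n + 1) *
    nu1 (NN d) {y | ∃ m, n < m ∧ Bad m y.1} ≤ 2 * (2⁻¹ : ENNReal) ^ n := by
  have hN := ae_InY (NN_ge d)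
  have e : {y : Y1 (NN d) | ∃ m, n < m ∧ Bad m y.1} = ⋃ j, {y | Bad (n + 1 + j) y.1} := by
    ext y
    simp only [Set.mem_ofPred_eq, Set.mem_iUnion]
    constructor
    · rintro ⟨m, hm, hb⟩
      obtain ⟨j, rfl⟩ := Nat.exists_eq_add_of_le (show n + 1 ≤ m from hm)
      exact ⟨j, hb⟩
    · rintro ⟨j, hb⟩
      exact ⟨n + 1 + j, by omega, hb⟩
  rw [e]
  calc _ ≤ ((d : ENNReal) + 1) ^ (NN d n + 1) * ∑' j, nu1 (NN d) {y | Bad (n + 1 + j) y.1} := by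
        gcongr
        exact measure_iUnion_le _
    _ = ∑' j, ((d : ENNReal) + 1) ^ (NN d n + 1) * nu1 (NN d) {y | Bad (n + 1 + j) y.1} := by
        rw [ENNReal.tsum_mul_left]
    _ ≤ ∑' j, 2 * (2⁻¹ : ENNReal) ^ (n + 1 + j) := by
        refine ENNReal.tsum_le_tsum fun j => ?_
        have h1 := arith ((d + 1) ^ (NN d n + 1)) (n + 1 + j) _
          (NN_big hd (show n < n + 1 + j by omega))
        push_cast at h1
        refine le_trans ?_ h1
        gcongr
        exact nu1_edge hN _
    _ = 2 * (2⁻¹ : ENNReal) ^ n := by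
        simp only [pow_add, ← mul_assoc]
        rw [ENNReal.tsum_mul_left, ENNReal.tsum_geometric, ENNReal.one_sub_inv_two, inv_inv,
          mul_assoc (2 * (2⁻¹ : ENNReal) ^ n), pow_one,
          ENNReal.inv_mul_cancel (by norm_num) (by norm_num), mul_one]

theorem exists_TData (hd : 1 ≤ d) : Nonempty (TData d) := by
  have hN := ae_InY (NN_ge d)
  obtain ⟨t, ht⟩ := exists_enum hd (NN d)
  have := nu1_prob hN
  exact ⟨{
    Y := Y1 (NN d)
    ν := nu1 (NN d)
    θ := ThM t
    mp := ThM_mp t hN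
    k := fun n y => (y.1 n).val
    N := NN d
    ψ := fun n x => psi n (t n) (io x)
    S := fun n => {y | ∃ m, n < m ∧ Bad m y.1}
    Z := fun n => {y | Bad n y.1}
    k_meas := fun n => (measurable_of_countable _).comp
      ((measurable_pi_apply n).comp measurable_subtype_coe)
    ψ_meas := fun n => (psi_meas n _).comp io_meas
    S_meas := fun n => by
      have e : {y : Y1 (NN d) | ∃ m, n < m ∧ Bad m y.1} =
          ⋃ m, ⋃ (_ : n < m), {y : Y1 (NN d) | Bad m y.1} := by
        ext y; simp
      rw [e]
      exact MeasurableSet.iUnion fun m => MeasurableSet.iUnion fun _ => Bad_meas m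
    Z_meas := fun n => Bad_meas n
    k_le := fun n y => Nat.lt_succ_iff.1 (y.1 n).isLt
    N_pos := NN_pos d
    ψ_le := fun n x => psi_le n _ _
    ev := fun x => by
      obtain ⟨n0, h0⟩ := x.1.2.good
      filter_upwards [eventually_ge_atTop n0] with n hn
      have h1 := Th_eq t (n := n) (x := x) fun m hm => h0 m (by omega)
      have h2 := stp_psi n (t n) (io x) (h0 n hn)
      rw [← h1] at h2
      exact h2
    le_one := fun n x hx => by
      have h1 := Th_eq t (n := n) (x := x) fun m hm hb => hx ⟨m, hm, hb⟩
      have h2 := stp_abs n (t n) (io x)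
      rw [← h1] at h2
      exact h2
    eq_ψ := fun n x hx hz => by
      have h1 := Th_eq t (n := n) (x := x) fun m hm hb => hx ⟨m, hm, hb⟩
      have h2 := stp_psi n (t n) (io x) hz
      rw [← h1] at h2
      exact h2
    Z_lim := tendsto_of_tendsto_of_tendsto_of_le_of_le tendsto_const_nhds geo_lim
      (fun n => bot_le) (fun n => (nu1_edge hN n).trans (by
        simpa using arith 1 n (NN d n) (by simpa using NN_ge d n)))
    S_lim := tendsto_of_tendsto_of_tendsto_of_le_of_le tendsto_const_nhds geo_lim
      (fun n => bot_le) (fun n => S_bound hd n)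
    sep := fun Q e _ => psi_sep t (NN_pos d) ht hd Q e
    span := fun F hF h0 hl => span_aux t hN ht F hF h0 hl }⟩

end Constr

/-- For every `d ≥ 2` there is a `d`-regular measurably bipartite treeing in which
every absolutely integrable circulation is a.e. zero and which admits no measurable
perfect matching. -/
theorem exists_treeing_no_measurable_perfect_matching :
    ∀ d : ℕ, 2 ≤ d → ∃ T : Graphing,
      T.IsRegular d ∧ T.Acyclic ∧ T.MeasurablyBipartite ∧
      (∀ f : T.V × T.V → ℝ, T.IsCirculation f →
        Integrable (fun x : T.V => ∑ᶠ y : T.V, |f (x, y)|) T.ν →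
        ∫ x : T.V, (∑ᶠ y : T.V, |f (x, y)|) ∂T.ν = 0) ∧
      ¬ ∃ M : Set (T.V × T.V), T.IsPerfectMatching M := by
  intro d hd
  obtain ⟨T⟩ := Constr.exists_TData (d := d) (by omega)
  exact ⟨T.graph, T.graph_regular, T.graph_acyclic, T.graph_bip, T.graph_circ,
    T.graph_no_matching hd⟩
end

section
/- For every natural number d ≥ 2 there exists a d-regular measurably bipartite treeing T (an acyclic d-regular graphing with vertex space (V, ν) admitting a Borel bipartition) such that there is no free pmp ℤ-action whose Schreier graphing is a subgraphing of T of positive measure; precisely, there do not exist a Borel set A ⊆ V with ν(A) > 0 and a Borel measure-preserving bijection S : A → A such that for ν-almost every x ∈ A one has Sⁿx ≠ x for all integers n ≠ 0 and (x, Sx) ∈ E(T). -/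
open MeasureTheory

section
open MeasureTheory Filter Topology

namespace KunTreeing

/-- Abstract data from which the treeing is built: `Y` is the space of edges, `V` the space of
vertices, `v s y` the endpoint of `y` on side `s`. -/
structure Sys (G : Type) [Fintype G] where
  Y : Type
  V : Type
  ι : Type
  [mY : MeasurableSpace Y]
  [mV : MeasurableSpace V]
  [sbY : StandardBorelSpace Y]
  [sbV : StandardBorelSpace V]
  μ : Measure Y
  [pr : IsProbabilityMeasure μ]
  v : Bool → Y → V
  v_meas : ∀ s, Measurable (v s)
  side : V → Bool
  side_meas : Measurable side
  side_v : ∀ s y, side (v s y) = s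
  r : V → Y
  r_meas : Measurable r
  v_r : ∀ p, v (side p) (r p) = p
  m : Bool → G → Y → Y
  m_mp : ∀ s g, MeasurePreserving (m s g) μ μ
  fib : ∀ s y y', v s y = v s y' ↔ ∃ g, y' = m s g y
  m_inj : ∀ s y, Function.Injective (fun g => m s g y)
  w : ι → ℕ → V → ℝ
  w_meas : ∀ i n, Measurable (w i n)
  w_bdd : ∀ i n, ∃ c, ∀ p, |w i n p| ≤ c
  C : ι → Set Y
  C_meas : ∀ i, MeasurableSet (C i)
  lim : ∀ i y, Tendsto (fun n => w i n (v false y) + w i n (v true y)) atTop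
    (𝓝 ((C i).indicator (fun _ => (1:ℝ)) y))
  limL1 : ∀ i, Tendsto (fun n => ∫ y, |(C i).indicator (fun _ => (1:ℝ)) y
    - (w i n (v false y) + w i n (v true y))| ∂μ) atTop (𝓝 0)
  sep : ∀ (Z : Finset Y) (y : Y), y ∉ Z → ∃ i, y ∈ C i ∧ ∀ z ∈ Z, z ∉ C i
  pi : IsPiSystem (Set.range C)
  gen : mY = MeasurableSpace.generateFrom (Set.range C)
  univ_mem : ∃ i, C i = Set.univ

attribute [instance] Sys.mY Sys.mV Sys.sbY Sys.sbV Sys.pr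

variable {G : Type} [Fintype G] (K : Sys G)

namespace Sys

lemma pair_inj {y y' : K.Y} (h : ∀ s, K.v s y = K.v s y') : y = y' := by
  classical
  by_contra hne
  obtain ⟨i, h1, h2⟩ := K.sep {y'} y (by simpa using hne)
  have h2 := h2 y' (by simp)
  have l1 := K.lim i y
  have l2 := K.lim i y'
  simp only [h] at l1
  have := tendsto_nhds_unique l1 l2
  simp [h1, h2] at this

lemma pair_inj' {y y' : K.Y} (s : Bool) (h : K.v s y = K.v s y') (h' : K.v (!s) y = K.v (!s) y') :
    y = y' := by
  apply K.pair_inj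
  intro t
  cases s <;> cases t <;> simp_all

lemma v_m (s : Bool) (g : G) (y : K.Y) : K.v s (K.m s g y) = K.v s y :=
  ((K.fib s y _).2 ⟨g, rfl⟩).symm

lemma v_cross {s t : Bool} {y y' : K.Y} (h : K.v s y = K.v t y') : s = t := by
  rw [← K.side_v s y, h, K.side_v]

/-- Edge set. -/
def E : Set (K.V × K.V) := ⋃ s : Bool, Set.range (fun z => (K.v s z, K.v (!s) z))

lemma mem_E {p q : K.V} : (p, q) ∈ K.E ↔ ∃ s z, K.v s z = p ∧ K.v (!s) z = q := by
  simp [E]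

lemma mem_E_of {s : Bool} {y : K.Y} {q : K.V} :
    (K.v s y, q) ∈ K.E ↔ ∃ g, K.v (!s) (K.m s g y) = q := by
  rw [mem_E]
  constructor
  · rintro ⟨t, z, h1, h2⟩
    obtain rfl := K.v_cross h1
    obtain ⟨g, rfl⟩ := (K.fib t y z).1 h1.symm
    exact ⟨g, h2⟩
  · rintro ⟨g, h⟩
    exact ⟨s, _, K.v_m s g y, h⟩

lemma nb_inj (s : Bool) (y : K.Y) : Function.Injective (fun g => K.v (!s) (K.m s g y)) := by
  intro g g' h
  apply K.m_inj s y
  apply K.pair_inj' s _ h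
  simp [v_m]

lemma E_meas : MeasurableSet K.E := by
  refine MeasurableSet.iUnion fun s => ?_
  rw [← Set.image_univ]
  refine MeasurableSet.image_of_measurable_injOn MeasurableSet.univ
    ((K.v_meas s).prodMk (K.v_meas _)) ?_
  intro y _ y' _ h
  simp only [Prod.mk.injEq] at h
  exact K.pair_inj' s h.1 h.2

/-- Vertex measure. -/
noncomputable def ν : Measure K.V :=
  (2⁻¹ : ENNReal) • (K.μ.map (K.v false) + K.μ.map (K.v true))

instance : IsProbabilityMeasure K.ν := by
  have h1 := Measure.isProbabilityMeasure_map (μ := K.μ) (K.v_meas false).aemeasurable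
  have h2 := Measure.isProbabilityMeasure_map (μ := K.μ) (K.v_meas true).aemeasurable
  constructor
  simp only [ν, Measure.smul_apply, Measure.add_apply, measure_univ, smul_eq_mul]
  rw [one_add_one_eq_two, ENNReal.inv_mul_cancel] <;> simp

lemma integral_ν (h : K.V → ℝ) (hm : Measurable h) (hb : ∃ c, ∀ p, |h p| ≤ c) :
    ∫ p, h p ∂K.ν = 2⁻¹ * (∫ y, h (K.v false y) ∂K.μ + ∫ y, h (K.v true y) ∂K.μ) := by
  obtain ⟨c, hc⟩ := hb
  have h1 := Measure.isProbabilityMeasure_map (μ := K.μ) (K.v_meas false).aemeasurable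
  have h2 := Measure.isProbabilityMeasure_map (μ := K.μ) (K.v_meas true).aemeasurable
  have hi : ∀ (ρ : Measure K.V) [IsProbabilityMeasure ρ], Integrable h ρ := fun ρ _ =>
    Integrable.of_bound hm.aestronglyMeasurable c (ae_of_all _ (by simpa using hc))
  rw [ν, integral_smul_measure, integral_add_measure (hi _) (hi _),
    integral_map (K.v_meas _).aemeasurable hm.aestronglyMeasurable,
    integral_map (K.v_meas _).aemeasurable hm.aestronglyMeasurable]
  simp

lemma ncard_eq (s : Bool) (y : K.Y) (B : Set K.V) :
    ((Set.ncard {q ∈ B | (K.v s y, q) ∈ K.E} : ℕ) : ℝ)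
      = ∑ g, B.indicator (fun _ => (1:ℝ)) (K.v (!s) (K.m s g y)) := by
  classical
  have : {q ∈ B | (K.v s y, q) ∈ K.E} =
      ((Finset.univ.filter (fun g => K.v (!s) (K.m s g y) ∈ B)).image
        (fun g => K.v (!s) (K.m s g y)) : Finset K.V) := by
    ext q
    simp only [mem_E_of, Set.mem_ofPred_eq, Finset.coe_image, Finset.coe_filter, Finset.mem_univ,
      true_and, Set.mem_image]
    constructor
    · rintro ⟨h, g, rfl⟩; exact ⟨g, h, rfl⟩
    · rintro ⟨g, h, rfl⟩; exact ⟨h, g, rfl⟩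
  rw [this, Set.ncard_coe_finset, Finset.card_image_of_injective _ (K.nb_inj s y)]
  simp [Set.indicator_apply, Finset.sum_boole]

lemma deg_eq (p : K.V) : {q : K.V | (p, q) ∈ K.E}.ncard = Fintype.card G := by
  have h := K.ncard_eq (K.side p) (K.r p) Set.univ
  rw [K.v_r] at h
  simp only [Set.mem_univ, true_and, Set.indicator_univ, Finset.sum_const, Finset.card_univ,
    nsmul_eq_mul, mul_one] at h
  exact_mod_cast h

lemma finite_nb (p : K.V) : {q : K.V | (p, q) ∈ K.E}.Finite := by
  rw [← K.v_r p]
  simp only [mem_E_of]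
  exact Set.finite_range (fun g => K.v (!(K.side p)) (K.m (K.side p) g (K.r p)))

lemma meas_m_side (g : G) : Measurable (fun p : K.V => K.v (!K.side p) (K.m (K.side p) g (K.r p))) := by
  have : (fun p : K.V => K.v (!K.side p) (K.m (K.side p) g (K.r p))) = fun p =>
      if K.side p = true then K.v false (K.m true g (K.r p)) else K.v true (K.m false g (K.r p)) := by
    ext p
    cases h : K.side p <;> simp
  rw [this]
  refine Measurable.ite (K.side_meas (measurableSet_singleton true)) ?_ ?_
  · exact (K.v_meas _).comp ((K.m_mp _ _).measurable.comp K.r_meas)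
  · exact (K.v_meas _).comp ((K.m_mp _ _).measurable.comp K.r_meas)

lemma meas_ncard {B : Set K.V} (hB : MeasurableSet B) :
    Measurable (fun p => ((Set.ncard {q ∈ B | (p, q) ∈ K.E} : ℕ) : ℝ)) := by
  have : (fun p => ((Set.ncard {q ∈ B | (p, q) ∈ K.E} : ℕ) : ℝ)) = fun p =>
      ∑ g, B.indicator (fun _ => (1:ℝ)) (K.v (!K.side p) (K.m (K.side p) g (K.r p))) := by
    ext p
    rw [← K.ncard_eq, K.v_r]
  rw [this]
  exact Finset.measurable_sum _ fun g _ =>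
    (measurable_const.indicator hB).comp (K.meas_m_side g)

lemma mt_side (s : Bool) {A B : Set K.V} (hA : MeasurableSet A) (hB : MeasurableSet B) :
    ∫ y, A.indicator (fun p => ((Set.ncard {q ∈ B | (p, q) ∈ K.E} : ℕ) : ℝ)) (K.v s y) ∂K.μ
      = Fintype.card G * ∫ y, A.indicator (fun _ => (1:ℝ)) (K.v s y) *
          B.indicator (fun _ => (1:ℝ)) (K.v (!s) y) ∂K.μ := by
  set h : K.Y → ℝ := fun y => A.indicator (fun _ => (1:ℝ)) (K.v s y) *
          B.indicator (fun _ => (1:ℝ)) (K.v (!s) y) with hh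
  have hm : Measurable h := ((measurable_const.indicator hA).comp (K.v_meas s)).mul
    ((measurable_const.indicator hB).comp (K.v_meas (!s)))
  have hb : ∀ y, ‖h y‖ ≤ 1 := by
    intro y
    by_cases h1 : K.v s y ∈ A <;> by_cases h2 : K.v (!s) y ∈ B <;> simp [hh, h1, h2]
  have e : ∀ y, A.indicator (fun p => ((Set.ncard {q ∈ B | (p, q) ∈ K.E} : ℕ) : ℝ)) (K.v s y)
      = ∑ g, h (K.m s g y) := by
    intro y
    simp only [hh, v_m, ← Finset.mul_sum, ← ncard_eq]
    by_cases hy : K.v s y ∈ A <;> simp [hy]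
  simp only [e]
  rw [integral_finsetSum]
  · have : ∀ g, ∫ y, h (K.m s g y) ∂K.μ = ∫ y, h y ∂K.μ := by
      intro g
      conv_rhs => rw [← (K.m_mp s g).map_eq]
      rw [integral_map (K.m_mp s g).measurable.aemeasurable hm.aestronglyMeasurable]
    simp [this]
  · intro g _
    exact Integrable.of_bound (hm.comp (K.m_mp s g).measurable).aestronglyMeasurable 1
      (ae_of_all _ fun y => hb _)

lemma mt_formula {A B : Set K.V} (hA : MeasurableSet A) (hB : MeasurableSet B) :
    ∫ p in A, ((Set.ncard {q ∈ B | (p, q) ∈ K.E} : ℕ) : ℝ) ∂K.ν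
      = 2⁻¹ * (Fintype.card G * ∫ y, A.indicator (fun _ => (1:ℝ)) (K.v false y) *
          B.indicator (fun _ => (1:ℝ)) (K.v true y) ∂K.μ + 
          Fintype.card G * ∫ y, A.indicator (fun _ => (1:ℝ)) (K.v true y) *
          B.indicator (fun _ => (1:ℝ)) (K.v false y) ∂K.μ) := by
  rw [← integral_indicator hA, K.integral_ν _ ((K.meas_ncard hB).indicator hA), K.mt_side _ hA hB,
    K.mt_side _ hA hB]
  · rfl
  · refine ⟨Fintype.card G, fun p => ?_⟩
    by_cases hp : p ∈ A
    · rw [Set.indicator_of_mem hp, abs_of_nonneg (by positivity), ← K.deg_eq p]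
      have hsub : {q ∈ B | (p, q) ∈ K.E} ⊆ {q | (p, q) ∈ K.E} := fun q hq => hq.2
      exact_mod_cast Set.ncard_le_ncard hsub (K.finite_nb p)
    · simp [hp]

/-- The graphing. -/
noncomputable def T : Graphing where
  V := K.V
  ν := K.ν
  E := K.E
  E_meas := K.E_meas
  symm := by
    intro p q h
    obtain ⟨s, z, h1, h2⟩ := K.mem_E.1 h
    exact K.mem_E.2 ⟨!s, z, h2, by simpa using h1⟩
  irrefl := by
    intro p h
    obtain ⟨s, z, h1, h2⟩ := K.mem_E.1 h
    have := K.v_cross (h1.trans h2.symm)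
    simp at this
  locFin := K.finite_nb
  massTransport := by
    intro A B hA hB
    rw [K.mt_formula hA hB, K.mt_formula hB hA]
    simp only [mul_comm (B.indicator _ _)]
    ring

lemma T_bip : K.T.MeasurablyBipartite := by
  refine ⟨K.side ⁻¹' {true}, K.side_meas (measurableSet_singleton _), ?_⟩
  intro p q h
  obtain ⟨s, z, rfl, rfl⟩ := K.mem_E.1 h
  change K.side _ = true ↔ ¬ K.side _ = true
  rw [K.side_v, K.side_v]
  cases s <;> simp

lemma T_acyc : K.T.Acyclic := by
  classical
  rintro ⟨k, x, hk, hx, he⟩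
  change Function.Injective (α := Fin (k+1)) (β := K.V) x at hx
  change Fin (k+1) → K.V at x
  have he' : ∀ i, ∃ s z, K.v s z = x i ∧ K.v (!s) z = x (i+1) := fun i => K.mem_E.1 (he i)
  choose s z h1 h2 using he'
  have hs : ∀ i, s (i+1) = !(s i) := by
    intro i
    exact K.v_cross ((h1 (i+1)).trans (h2 i).symm)
  let σ : Bool → ℝ := fun b => if b then 1 else -1
  have hσ : ∀ b, σ (!b) = - σ b := by intro b; cases b <;> simp [σ]
  have key : ∀ W : K.V → ℝ, ∑ i, σ (s i) * (W (K.v false (z i)) + W (K.v true (z i))) = 0 := by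
    intro W
    have e : ∀ i, W (K.v false (z i)) + W (K.v true (z i)) = W (x i) + W (x (i+1)) := by
      intro i
      rw [← h1, ← h2]
      cases s i <;> simp [add_comm]
    simp only [e, mul_add, Finset.sum_add_distrib]
    have e2 : ∑ i, σ (s i) * W (x (i+1)) = - ∑ i, σ (s (i+1)) * W (x (i+1)) := by
      rw [← Finset.sum_neg_distrib]
      refine Finset.sum_congr rfl fun i _ => ?_
      rw [hs, hσ]; ring
    have e3 := Equiv.sum_comp (Equiv.addRight (1 : Fin (k+1))) (fun i => σ (s i) * W (x i))
    simp only [Equiv.coe_addRight] at e3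
    rw [e2, e3]
    ring
  have key2 : ∀ i, ∑ j, σ (s j) * (K.C i).indicator (fun _ => (1:ℝ)) (z j) = 0 := by
    intro i
    have : Tendsto (fun n => ∑ j, σ (s j) * (K.w i n (K.v false (z j)) + K.w i n (K.v true (z j))))
        atTop (𝓝 (∑ j, σ (s j) * (K.C i).indicator (fun _ => (1:ℝ)) (z j))) :=
      tendsto_finsetSum _ fun j _ => (K.lim i (z j)).const_mul _
    simp only [key] at this
    exact tendsto_nhds_unique this tendsto_const_nhds
  have hz : ∀ j, j ≠ 0 → z j ≠ z 0 := by
    intro j hj hjz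
    by_cases hsj : s j = s 0
    · apply hj
      apply hx
      rw [← h1, ← h1, hjz, hsj]
    · have hsj : s j = !(s 0) := by
        cases h : s j <;> cases h' : s 0 <;> simp_all
      have a1 : j = 0 + 1 := by
        apply hx
        rw [← h1, ← h2, hjz, hsj]
      have a2 : j + 1 = 0 := by
        apply hx
        have := h2 j
        rw [hjz, hsj, Bool.not_not] at this
        exact this.symm.trans (h1 0)
      rw [a1] at a2
      have := congrArg Fin.val a2
      simp only [zero_add, Fin.val_add, Fin.val_zero, Fin.val_one'] at this
      rw [Nat.mod_eq_of_lt (show 1 < k+1 by omega), Nat.mod_eq_of_lt (by omega)] at this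
      omega
  obtain ⟨i, hi, hi'⟩ := K.sep ((Finset.univ.erase 0).image z) (z 0) (by
    simp only [Finset.mem_image, Finset.mem_erase, Finset.mem_univ, and_true, not_exists, not_and]
    exact fun j hj => hz j hj)
  have h0 := key2 i
  rw [Finset.sum_eq_single 0] at h0
  · simp only [hi, Set.indicator_of_mem, mul_one] at h0
    cases h : s 0 <;> simp [h, σ] at h0
  · intro j _ hj
    have := hi' (z j) (Finset.mem_image_of_mem _ (by simp [hj]))
    simp [this]
  · simp

lemma T_reg : K.T.IsRegular (Fintype.card G) := K.deg_eq

lemma ae_ν {P : K.V → Prop} (h : ∀ᵐ p ∂K.ν, P p) (s : Bool) : ∀ᵐ y ∂K.μ, P (K.v s y) := by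
  have h' : ∀ᵐ p ∂(K.μ.map (K.v s)), P p := by
    refine Measure.AbsolutelyContinuous.ae_le (ν := K.ν) ?_ h
    intro N hN
    simp only [ν, Measure.smul_apply, Measure.add_apply, smul_eq_mul, mul_eq_zero,
      ENNReal.inv_eq_zero, ENNReal.ofNat_ne_top, add_eq_zero, false_or] at hN
    cases s
    · exact hN.1
    · exact hN.2
  exact ae_of_ae_map (K.v_meas s).aemeasurable h'

lemma null_of_ae {A : Set K.V} (hA : MeasurableSet A) (h : ∀ s, ∀ᵐ y ∂K.μ, K.v s y ∉ A) :
    K.ν A = 0 := by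
  have : ∀ s, K.μ.map (K.v s) A = 0 := by
    intro s
    rw [Measure.map_apply (K.v_meas s) hA]
    have := h s
    rw [ae_iff] at this
    simp only [not_not] at this
    exact this
  simp [ν, this]

/-- Orthogonality implies vanishing. -/
lemma vanish (f : K.Y → ℝ) (hf : Measurable f) (hb : ∀ y, |f y| ≤ 1)
    (h0 : ∀ s, ∀ᵐ y ∂K.μ, ∑ g, f (K.m s g y) = 0) (hG : 0 < Fintype.card G) :
    ∀ᵐ y ∂K.μ, f y = 0 := by
  have fi : Integrable f K.μ := Integrable.of_bound hf.aestronglyMeasurable 1 (ae_of_all _ hb)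
  have h1 : ∀ s, ∀ W : K.V → ℝ, Measurable W → (∃ c, ∀ p, |W p| ≤ c) →
      ∫ y, f y * W (K.v s y) ∂K.μ = 0 := by
    rintro s W hW ⟨c, hc⟩
    have hm : Measurable fun y => f y * W (K.v s y) := hf.mul (hW.comp (K.v_meas s))
    have hbd : ∀ y, ‖f y * W (K.v s y)‖ ≤ c := by
      intro y
      rw [norm_mul]
      calc ‖f y‖ * ‖W (K.v s y)‖ ≤ 1 * c :=
            mul_le_mul (hb y) (hc _) (norm_nonneg _) zero_le_one
        _ = c := one_mul c
    have e1 : ∀ g, ∫ y, f (K.m s g y) * W (K.v s y) ∂K.μ = ∫ y, f y * W (K.v s y) ∂K.μ := by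
      intro g
      conv_rhs => rw [← (K.m_mp s g).map_eq]
      rw [integral_map (K.m_mp s g).measurable.aemeasurable hm.aestronglyMeasurable]
      simp [v_m]
    have e2 : ∫ y, ∑ g, f (K.m s g y) * W (K.v s y) ∂K.μ = 0 := by
      rw [← integral_zero K.Y ℝ (μ := K.μ)]
      apply integral_congr_ae
      filter_upwards [h0 s] with y hy
      rw [← Finset.sum_mul, hy, zero_mul]
    rw [integral_finsetSum] at e2
    · simp only [e1, Finset.sum_const, Finset.card_univ, nsmul_eq_mul, mul_eq_zero,
        Nat.cast_eq_zero] at e2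
      rcases e2 with h | h
      · omega
      · exact h
    · intro g _
      refine Integrable.of_bound ?_ c (ae_of_all _ fun y => ?_) (μ := K.μ)
      · exact ((hf.comp (K.m_mp s g).measurable).mul
          (hW.comp (K.v_meas s))).aestronglyMeasurable
      · have := hbd (K.m s g y)
        rwa [v_m] at this
  have h2 : ∀ i, ∫ y, f y * (K.C i).indicator (fun _ => (1:ℝ)) y ∂K.μ = 0 := by
    intro i
    have hWi : ∀ n s, Integrable (fun y => f y * K.w i n (K.v s y)) K.μ := by
      intro n s
      obtain ⟨c, hc⟩ := K.w_bdd i n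
      refine Integrable.of_bound (hf.mul ((K.w_meas i n).comp (K.v_meas s))).aestronglyMeasurable c
        (ae_of_all _ fun y => ?_)
      rw [norm_mul]
      calc ‖f y‖ * ‖_‖ ≤ 1 * c :=
            mul_le_mul (hb y) (hc _) (norm_nonneg _) zero_le_one
        _ = c := one_mul c
    have hCi : Integrable (fun y => f y * (K.C i).indicator (fun _ => (1:ℝ)) y) K.μ := by
      refine Integrable.of_bound (hf.mul (measurable_const.indicator
        (K.C_meas i))).aestronglyMeasurable 1 (ae_of_all _ fun y => ?_)
      by_cases h : y ∈ K.C i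
      · simpa [h] using hb y
      · simp [h]
    have hbound : ∀ n, |∫ y, f y * (K.C i).indicator (fun _ => (1:ℝ)) y ∂K.μ| ≤
        ∫ y, |(K.C i).indicator (fun _ => (1:ℝ)) y
          - (K.w i n (K.v false y) + K.w i n (K.v true y))| ∂K.μ := by
      intro n
      have e : ∫ y, f y * (K.C i).indicator (fun _ => (1:ℝ)) y ∂K.μ =
          ∫ y, f y * ((K.C i).indicator (fun _ => (1:ℝ)) y
            - (K.w i n (K.v false y) + K.w i n (K.v true y))) ∂K.μ := by
        simp only [mul_sub, mul_add]
        have hadd : Integrable (fun y => f y * K.w i n (K.v false y) + f y * K.w i n (K.v true y))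
            K.μ := (hWi n false).add (hWi n true)
        rw [integral_sub hCi hadd,
          integral_add (hWi n false) (hWi n true), h1 _ _ (K.w_meas i n) (K.w_bdd i n),
          h1 _ _ (K.w_meas i n) (K.w_bdd i n)]
        simp
      rw [e]
      refine abs_integral_le_integral_abs.trans ?_
      refine integral_mono_of_nonneg (ae_of_all _ fun y => abs_nonneg _) ?_
        (ae_of_all _ fun y => ?_)
      · obtain ⟨c, hc⟩ := K.w_bdd i n
        refine Integrable.of_bound (((measurable_const.indicator (K.C_meas i)).sub
          (((K.w_meas i n).comp (K.v_meas false)).add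
            ((K.w_meas i n).comp (K.v_meas true)))).norm).aestronglyMeasurable (1 + (c + c))
            (ae_of_all _ fun y => ?_)
        rw [← Real.norm_eq_abs, norm_norm]
        refine (norm_sub_le _ _).trans (add_le_add ?_ ((norm_add_le _ _).trans
          (add_le_add (hc _) (hc _))))
        by_cases h : y ∈ K.C i <;> simp [h]
      · simp only [abs_mul]
        exact mul_le_of_le_one_left (abs_nonneg _) (hb y)
    have := ge_of_tendsto' (K.limL1 i) hbound
    exact abs_nonpos_iff.1 this
  have h3 : ∀ i, ∫ y in K.C i, f y ∂K.μ = 0 := by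
    intro i
    rw [← h2 i, ← integral_indicator (K.C_meas i)]
    congr 1
    ext y
    by_cases h : y ∈ K.C i <;> simp [h]
  have htot : ∫ y, f y ∂K.μ = 0 := by
    obtain ⟨i, hi⟩ := K.univ_mem
    have := h3 i
    rwa [hi, setIntegral_univ] at this
  have h4 : ∀ t, MeasurableSet t → ∫ y in t, f y ∂K.μ = 0 := by
    intro t ht
    induction t, ht using MeasurableSpace.induction_on_inter K.gen K.pi with
    | empty => simp
    | basic t ht => obtain ⟨i, rfl⟩ := ht; exact h3 i
    | compl t htm ih =>
      have := integral_add_compl htm fi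
      rw [ih, htot] at this
      linarith
    | iUnion g hd hgm ih =>
      rw [integral_iUnion hgm hd fi.integrableOn]
      simp [ih]
  exact fi.ae_eq_zero_of_forall_setIntegral_eq_zero fun t ht _ => h4 t ht

lemma T_no (hG : 0 < Fintype.card G) (A : Set K.V) (S S' : K.V → K.V)
    (hA : MeasurableSet A) (hpos : 0 < K.ν A) (hS : Measurable S) (hS' : Measurable S')
    (mS : Set.MapsTo S A A) (mS' : Set.MapsTo S' A A)
    (i1 : ∀ x ∈ A, S' (S x) = x) (i2 : ∀ x ∈ A, S (S' x) = x)
    (mp : ∀ B : Set K.V, B ⊆ A → MeasurableSet B → K.ν (S ⁻¹' B ∩ A) = K.ν B)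
    (fr : ∀ᵐ x ∂K.ν, x ∈ A →
            (∀ n : ℕ, 0 < n → S^[n] x ≠ x ∧ S'^[n] x ≠ x) ∧ (x, S x) ∈ K.E) : False := by
  classical
  have q1 : ∀ᵐ p ∂K.ν, p ∈ A → (p, S p) ∈ K.E := by
    filter_upwards [fr] with p hp h using (hp h).2
  have q2 : ∀ᵐ p ∂K.ν, p ∈ A → S (S p) ≠ p := by
    filter_upwards [fr] with p hp h using ((hp h).1 2 (by norm_num)).1
  have q3 : ∀ᵐ p ∂K.ν, p ∈ A → (S' p, p) ∈ K.E := by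
    set B : Set K.V := A ∩ {p | (S' p, p) ∉ K.E} with hB
    have hBm : MeasurableSet B :=
      hA.inter ((hS'.prodMk measurable_id) K.E_meas).compl
    have hB0 : K.ν B = 0 := by
      rw [← mp B Set.inter_subset_left hBm]
      refine measure_mono_null ?_ (ae_iff.1 q1)
      rintro p ⟨⟨_, h2⟩, h1⟩
      change (S' (S p), S p) ∉ K.E at h2
      rw [i1 p h1] at h2
      exact fun h => h2 (h h1)
    rw [ae_iff]
    refine measure_mono_null ?_ hB0
    intro p hp
    simp only [Set.mem_ofPred_eq, Classical.not_imp] at hp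
    exact hp
  let D : Bool → Set K.Y := fun s => {z | K.v s z ∈ A ∧ S (K.v s z) = K.v (!s) z}
  have hD : ∀ s, MeasurableSet (D s) := fun s =>
    (K.v_meas s hA).inter (measurableSet_eq_fun (hS.comp (K.v_meas s)) (K.v_meas _))
  let F : Bool → K.Y → ℝ := fun s => (D s).indicator (fun _ => 1)
  have hF : ∀ s, Measurable (F s) := fun s => measurable_const.indicator (hD s)
  have o1 : ∀ s, ∀ᵐ y ∂K.μ, ∑ g, F s (K.m s g y) = A.indicator (fun _ => 1) (K.v s y) := by
    intro s
    filter_upwards [K.ae_ν q1 s] with y hy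
    by_cases h : K.v s y ∈ A
    · obtain ⟨g, hg⟩ := K.mem_E_of.1 (hy h)
      rw [Finset.sum_eq_single g]
      · have : K.m s g y ∈ D s := by
          simp only [D, Set.mem_ofPred_eq, v_m]
          exact ⟨h, hg.symm⟩
        simp [F, this, h]
      · intro g' _ hne
        have : K.m s g' y ∉ D s := by
          simp only [D, Set.mem_ofPred_eq, v_m]
          rintro ⟨_, h'⟩
          exact hne (K.nb_inj s y (h'.symm.trans hg.symm))
        simp [F, this]
      · simp
    · rw [Set.indicator_of_notMem h]
      refine Finset.sum_eq_zero fun g _ => ?_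
      have : K.m s g y ∉ D s := by simp [D, v_m, h]
      simp [F, this]
  have o2 : ∀ s, ∀ᵐ y ∂K.μ, ∑ g, F (!s) (K.m s g y) = A.indicator (fun _ => 1) (K.v s y) := by
    intro s
    filter_upwards [K.ae_ν q3 s] with y hy
    have hmem : ∀ g, K.m s g y ∈ D (!s) ↔ K.v (!s) (K.m s g y) ∈ A ∧
        S (K.v (!s) (K.m s g y)) = K.v s y := by
      intro g
      simp [D, v_m]
    by_cases h : K.v s y ∈ A
    · have hE : (K.v s y, S' (K.v s y)) ∈ K.E := K.T.symm _ _ (hy h)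
      obtain ⟨g, hg⟩ := K.mem_E_of.1 hE
      rw [Finset.sum_eq_single g]
      · have : K.m s g y ∈ D (!s) := by
          rw [hmem, hg]
          exact ⟨mS' h, i2 _ h⟩
        simp [F, this, h]
      · intro g' _ hne
        have : K.m s g' y ∉ D (!s) := by
          rw [hmem]
          rintro ⟨h1, h2⟩
          apply hne
          apply K.nb_inj s y
          change K.v (!s) (K.m s g' y) = K.v (!s) (K.m s g y)
          rw [hg, ← i1 _ h1, h2]
        simp [F, this]
      · simp
    · rw [Set.indicator_of_notMem h]
      refine Finset.sum_eq_zero fun g _ => ?_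
      have : K.m s g y ∉ D (!s) := by
        rw [hmem]
        rintro ⟨h1, h2⟩
        exact h (h2 ▸ mS h1)
      simp [F, this]
  have van := K.vanish (fun y => F false y - F true y) ((hF _).sub (hF _)) (by
      intro y
      by_cases h1 : y ∈ D false <;> by_cases h2 : y ∈ D true <;> simp [F, h1, h2]) (by
      intro s
      filter_upwards [o1 s, o2 s] with y h1 h2
      rw [Finset.sum_sub_distrib]
      cases s
      · rw [h1]; simp only [Bool.not_false] at h2; rw [h2]; simp
      · rw [h1]; simp only [Bool.not_true] at h2; rw [h2]; simp) hG
  refine hpos.ne' (K.null_of_ae hA fun s => ?_)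
  have van' : ∀ᵐ y ∂K.μ, ∀ g, F false (K.m s g y) - F true (K.m s g y) = 0 :=
    ae_all_iff.2 fun g => (K.m_mp s g).quasiMeasurePreserving.ae van
  filter_upwards [van', K.ae_ν q1 s, K.ae_ν q2 s] with y h1 h2 h3 hy
  obtain ⟨g, hg⟩ := K.mem_E_of.1 (h2 hy)
  have m1 : K.m s g y ∈ D s := by
    simp only [D, Set.mem_ofPred_eq, v_m]
    exact ⟨hy, hg.symm⟩
  have m2 : K.m s g y ∉ D (!s) := by
    simp only [D, Set.mem_ofPred_eq, v_m, hg, Bool.not_not]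
    exact fun h => h3 hy h.2
  have := h1 g
  cases s
  · simp only [Bool.not_false] at m2
    simp [F, m1, m2] at this
  · simp only [Bool.not_true] at m2
    simp [F, m1, m2] at this

end Sys
end KunTreeing
end

section
open MeasureTheory Filter Topology

namespace KunTreeing

section Psi
set_option linter.unusedSectionVars false
variable {E : Type} [Fintype E]

lemma card_fin_lt (L : ℕ) (c : ℤ) (h0 : 0 ≤ c) (h1 : c ≤ L) :
    (Fintype.card {s : Fin L // (s : ℤ) < c} : ℤ) = c := by
  obtain ⟨n, rfl⟩ := Int.eq_ofNat_of_zero_le h0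
  have h1 : n ≤ L := by exact_mod_cast h1
  rw [Fintype.card_subtype]
  have : (Finset.univ.filter (fun s : Fin L => (s : ℤ) < (n : ℤ))) =
      Finset.univ.filter (fun s : Fin L => (s : ℕ) < n) := by
    ext s; simp
  rw [this, Fin.card_filter_val_lt]
  simp [h1]

lemma card_fin_ge (L : ℕ) (c : ℤ) (h0 : 0 ≤ c) (h1 : c ≤ L) :
    (Fintype.card {s : Fin L // c ≤ (s : ℤ)} : ℤ) = L - c := by
  have h := Fintype.card_subtype_compl (fun s : Fin L => (s : ℤ) < c)
  have h2 := card_fin_lt L c h0 h1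
  have h3 := Fintype.card_subtype_le (fun s : Fin L => (s : ℤ) < c)
  simp only [not_lt, Fintype.card_fin] at h h3
  rw [h]
  push_cast [Nat.cast_sub h3]
  rw [h2]

/-- Region (bottom, middle, top) of a point after the shift by `k`. -/
def region (L p : ℕ) (k : E → ℤ) (x : E × Fin L) : Fin 3 :=
  if (x.2 : ℤ) < p - k x.1 then 0 else if (L - p : ℤ) - k x.1 ≤ (x.2 : ℤ) then 2 else 1

lemma region_zero {L p : ℕ} {k : E → ℤ} {x : E × Fin L} :
    region L p k x = 0 ↔ (x.2 : ℤ) < p - k x.1 := by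
  unfold region; split_ifs <;> simp_all

lemma region_two {L p : ℕ} {k : E → ℤ} {x : E × Fin L} (hL : 2 * p ≤ L) :
    region L p k x = 2 ↔ (L - p : ℤ) - k x.1 ≤ (x.2 : ℤ) := by
  unfold region; split_ifs <;> simp_all; omega

lemma region_one {L p : ℕ} {k : E → ℤ} {x : E × Fin L} :
    region L p k x = 1 ↔ (p : ℤ) ≤ x.2 + k x.1 ∧ x.2 + k x.1 < (L - p : ℤ) := by
  unfold region; split_ifs <;> simp_all <;> omega

/-- A subtype of a product as a sigma type. -/
def prodSub {L : ℕ} (P : E → Fin L → Prop) : {x : E × Fin L // P x.1 x.2} ≃ Σ e, {s // P e s} where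
  toFun x := ⟨x.1.1, x.1.2, x.2⟩
  invFun x := ⟨(x.1, x.2.1), x.2.2⟩
  left_inv _ := rfl
  right_inv _ := rfl

lemma card_region_zero (L p : ℕ) (hL : 2 * p ≤ L) (k : E → ℤ) (hk : ∀ e, |k e| ≤ p)
    (hs : ∑ e, k e = 0) :
    (Fintype.card {x : E × Fin L // region L p k x = 0} : ℤ) = Fintype.card E * p := by
  classical
  simp only [region_zero]
  rw [Fintype.card_congr (prodSub (fun e (s : Fin L) => (s : ℤ) < p - k e)), Fintype.card_sigma]
  push_cast
  have : ∀ e, (Fintype.card {s : Fin L // (s : ℤ) < p - k e} : ℤ) = p - k e := by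
    intro e
    have := abs_le.1 (hk e)
    apply card_fin_lt <;> omega
  simp [this, hs]

lemma card_region_two (L p : ℕ) (hL : 2 * p ≤ L) (k : E → ℤ) (hk : ∀ e, |k e| ≤ p)
    (hs : ∑ e, k e = 0) :
    (Fintype.card {x : E × Fin L // region L p k x = 2} : ℤ) = Fintype.card E * p := by
  classical
  simp only [region_two hL]
  rw [Fintype.card_congr (prodSub (fun e (s : Fin L) => (L - p : ℤ) - k e ≤ s)),
    Fintype.card_sigma]
  push_cast
  have : ∀ e, (Fintype.card {s : Fin L // (L - p : ℤ) - k e ≤ s} : ℤ) = p + k e := by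
    intro e
    have := abs_le.1 (hk e)
    rw [card_fin_ge] <;> omega
  simp only [this]
  simp [hs, Finset.sum_add_distrib]

/-- The middle shift. -/
def midEquiv (L p : ℕ) (k : E → ℤ) (hk : ∀ e, |k e| ≤ p) :
    {x : E × Fin L // region L p (fun _ => 0) x = 1} ≃ {x : E × Fin L // region L p k x = 1} where
  toFun x := ⟨(x.1.1, ⟨((x.1.2 : ℤ) - k x.1.1).toNat, by
      have h := region_one.1 x.2; have := abs_le.1 (hk x.1.1); omega⟩), by
      have h := region_one.1 x.2; have := abs_le.1 (hk x.1.1)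
      rw [region_one]; simp only; omega⟩
  invFun x := ⟨(x.1.1, ⟨((x.1.2 : ℤ) + k x.1.1).toNat, by
      have h := region_one.1 x.2; have := abs_le.1 (hk x.1.1); omega⟩), by
      have h := region_one.1 x.2; have := abs_le.1 (hk x.1.1)
      rw [region_one]; simp only; omega⟩
  left_inv x := by
    have h := region_one.1 x.2; have := abs_le.1 (hk x.1.1)
    apply Subtype.ext; apply Prod.ext
    · rfl
    · apply Fin.ext; simp only; omega
  right_inv x := by
    have h := region_one.1 x.2; have := abs_le.1 (hk x.1.1)
    apply Subtype.ext; apply Prod.ext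
    · rfl
    · apply Fin.ext; simp only; omega

/-- Goodness of the rewiring permutation. -/
def Good (p L : ℕ) (k : E → ℤ) (Ψ : Equiv.Perm (E × Fin L)) : Prop :=
  (∀ (e : E) (t : Fin L), p ≤ (t : ℕ) → (t : ℕ) + p < L →
    (Ψ (e, t)).1 = e ∧ (((Ψ (e, t)).2 : ℕ) : ℤ) = t - k e) ∧
  ∀ x, |(((Ψ x).2 : ℕ) : ℤ) - (x.2 : ℕ)| ≤ 2 * p

lemma exists_good (p L : ℕ) (k : E → ℤ) (hk : ∀ e, |k e| ≤ p) (hs : ∑ e, k e = 0) :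
    ∃ Ψ, Good p L k Ψ := by
  classical
  by_cases hL : 2 * p ≤ L
  swap
  · refine ⟨1, fun e t h1 h2 => by omega, fun x => ?_⟩
    have := x.2.2
    simp
  have hk0 : ∀ e : E, |(fun _ => (0:ℤ)) e| ≤ p := by simp
  have c0 : Fintype.card {x : E × Fin L // region L p (fun _ => 0) x = 0} =
      Fintype.card {x : E × Fin L // region L p k x = 0} := by
    have a := card_region_zero L p hL k hk hs
    have b := card_region_zero (E := E) L p hL (fun _ => 0) hk0 (by simp)
    exact_mod_cast b.trans a.symm
  have c2 : Fintype.card {x : E × Fin L // region L p (fun _ => 0) x = 2} =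
      Fintype.card {x : E × Fin L // region L p k x = 2} := by
    have a := card_region_two L p hL k hk hs
    have b := card_region_two (E := E) L p hL (fun _ => 0) hk0 (by simp)
    exact_mod_cast b.trans a.symm
  let F : ∀ i : Fin 3, {x : E × Fin L // region L p (fun _ => 0) x = i} ≃
      {x : E × Fin L // region L p k x = i} := fun i =>
    match i with
    | 0 => Fintype.equivOfCardEq c0
    | 1 => midEquiv L p k hk
    | 2 => Fintype.equivOfCardEq c2
  let Ψ : Equiv.Perm (E × Fin L) := (Equiv.sigmaFiberEquiv (region L p (fun _ => 0))).symm.trans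
    ((Equiv.sigmaCongrRight F).trans (Equiv.sigmaFiberEquiv (region L p k)))
  have hΨ : ∀ x i (h : region L p (fun _ => 0) x = i), Ψ x = (F i ⟨x, h⟩).1 := by
    rintro x i rfl
    rfl
  have g1 : ∀ (e : E) (t : Fin L), p ≤ (t : ℕ) → (t : ℕ) + p < L →
    (Ψ (e, t)).1 = e ∧ (((Ψ (e, t)).2 : ℕ) : ℤ) = t - k e := by
    intro e t h1 h2
    have h : region L p (fun _ => 0) (e, t) = 1 := by
      rw [region_one]; simp only; omega
    rw [hΨ _ _ h]
    have := abs_le.1 (hk e)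
    refine ⟨rfl, ?_⟩
    change ((((t : ℤ) - k e).toNat : ℕ) : ℤ) = _
    omega
  refine ⟨Ψ, g1, fun x => ?_⟩
  by_cases h0 : region L p (fun _ => 0) x = 0
  · have e := hΨ x _ h0
    have h1 := (F 0 ⟨x, h0⟩).2
    rw [← e, region_zero] at h1
    rw [region_zero] at h0
    have := abs_le.1 (hk (Ψ x).1)
    rw [abs_le]; omega
  by_cases h2 : region L p (fun _ => 0) x = 2
  · have e := hΨ x _ h2
    have h1 := (F 2 ⟨x, h2⟩).2
    rw [← e, region_two hL] at h1
    rw [region_two hL] at h2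
    have := abs_le.1 (hk (Ψ x).1)
    have := (Ψ x).2.2
    have := x.2.2
    rw [abs_le]; omega
  have h1 : region L p (fun _ => 0) x = 1 := by
    generalize region L p (fun _ => 0) x = i at *
    fin_cases i <;> simp_all
  rw [region_one] at h1
  have := (g1 x.1 x.2 (by omega) (by omega)).2
  have := abs_le.1 (hk x.1)
  rw [abs_le]
  simp only [Prod.mk.eta] at *
  omega

end Psi
end KunTreeing
end

section
open MeasureTheory Filter Topology

namespace KunTreeing

/-- The free product of two copies of `G`. -/
abbrev FP (G : Type) [Group G] : Type := Monoid.CoprodI (fun _ : Bool => G)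

instance {G : Type} [Group G] [Countable G] : Countable (FP G) := by
  let f : List (Bool × G) → FP G := fun l =>
    (l.map (fun q => Monoid.CoprodI.of (M := fun _ : Bool => G) (i := q.1) q.2)).prod
  have hf : Function.Surjective f := by
    intro x
    induction x using Monoid.CoprodI.induction_on with
    | one => exact ⟨[], rfl⟩
    | of s g => exact ⟨[(s, g)], by simp [f]⟩
    | mul a b iha ihb =>
      obtain ⟨la, rfl⟩ := iha
      obtain ⟨lb, rfl⟩ := ihb
      exact ⟨la ++ lb, by simp [f]⟩
  exact hf.countable

/-- generators -/
def gen {G : Type} [Group G] (s : Bool) : G →* FP G :=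
  Monoid.CoprodI.of (M := fun _ : Bool => G) (i := s)

/-- The shift space. -/
abbrev Om (G : Type) [Group G] : Type := FP G × ℕ → G

variable {G : Type} [Group G]

/-- The shift action. -/
def act (γ : FP G) (x : Om G) : Om G := fun q => x (q.1 * γ, q.2)

lemma act_mul (γ δ : FP G) (x : Om G) : act (γ * δ) x = act γ (act δ x) := by
  ext q; simp [act, mul_assoc]

lemma act_one (x : Om G) : act 1 x = x := by
  ext q; simp [act]

/-- coordinates carrying the cosets -/
def cs (s : Bool) : ℕ := if s then 1 else 0

variable (G) in
/-- Finite systems. -/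
structure FS where
  E : Type
  [fin : Fintype E]
  [ne : Nonempty E]
  α : FP G →* Equiv.Perm E
  l : E → ℕ → G
  hl : ∀ s g e, l (α (gen s g) e) (cs s) = g * l e (cs s)

attribute [instance] FS.fin FS.ne

namespace FS

variable (S : FS G)

/-- The point of the shift space defined by a vertex. -/
def pt (e : S.E) : Om G := fun q => S.l (S.α q.1 e) q.2

lemma act_pt (γ : FP G) (e : S.E) : act γ (S.pt e) = S.pt (S.α γ e) := by
  ext q; simp [act, pt]

variable (G) in
/-- The initial system. -/
def base [Fintype G] : FS G where
  E := G
  α := Monoid.CoprodI.lift (fun _ => MulAction.toPermHom G G)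
  l := fun e _ => e
  hl := by
    intro s g e
    simp [gen]

/-- The action of one factor on the extended system. -/
def extHom (L : ℕ) (Φ : Equiv.Perm (S.E × Fin L)) (s : Bool) : G →* Equiv.Perm (S.E × Fin L) where
  toFun g := (Φ.trans (Equiv.prodCongr (S.α (gen s g)) (Equiv.refl _))).trans Φ.symm
  map_one' := by ext x <;> simp
  map_mul' g h := by ext x <;> simp <;> rfl

/-- The pair of conjugating permutations. -/
def Phi (L : ℕ) (Ψ : Equiv.Perm (S.E × Fin L)) (s : Bool) : Equiv.Perm (S.E × Fin L) :=
  if s then Ψ else 1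

/-- New labels. -/
noncomputable def extLabel (g0 : G) (L : ℕ) (Ψ : Equiv.Perm (S.E × Fin L)) (x : S.E × Fin L) (n : ℕ) : G :=
  if n = 0 then S.l x.1 0 else if n = 1 then S.l (Ψ x).1 1
  else if n < L + 2 then S.l x.1 n
  else if n = L + 2 + (Fintype.equivFin (S.E × Fin L) x : ℕ) then g0 else 1

/-- The action on the extended system. -/
def extA (L : ℕ) (Ψ : Equiv.Perm (S.E × Fin (L+1))) : FP G →* Equiv.Perm (S.E × Fin (L+1)) :=
  Monoid.CoprodI.lift (fun s => S.extHom (L+1) (S.Phi (L+1) Ψ s) s)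

/-- The extended system. -/
noncomputable def ext (g0 : G) (L : ℕ) (Ψ : Equiv.Perm (S.E × Fin (L+1))) : FS G where
  E := S.E × Fin (L+1)
  α := S.extA L Ψ
  l := S.extLabel g0 (L+1) Ψ
  hl := by
    intro s g x
    cases s
    · simp [gen, extA, extLabel, cs, extHom, Phi]
      exact S.hl false g x.1
    · simp [gen, extA, extLabel, cs, extHom, Phi]
      exact S.hl true g (Ψ x).1

variable (g0 : G) (L : ℕ) (Ψ : Equiv.Perm (S.E × Fin (L+1)))

lemma ext_gen (s : Bool) (g : G) (x : S.E × Fin (L+1)) :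
    S.extA L Ψ (gen s g) x =
      (S.Phi (L+1) Ψ s).symm (S.α (gen s g) (S.Phi (L+1) Ψ s x).1, (S.Phi (L+1) Ψ s x).2) := by
  simp [gen, extA, extHom]
  rfl

lemma ext_shift (p : ℕ) (k : S.E → ℤ) (hk : ∀ e, |k e| ≤ p) (γ : FP G) :
    ∃ R : ℕ, ∀ L Ψ, Good p (L+1) k Ψ → ∀ (e : S.E) (t : Fin (L+1)), R ≤ (t:ℕ) → t + R < L + 1 →
      ∃ t' : Fin (L+1), S.extA L Ψ γ (e, t) = (S.α γ e, t') ∧ (t:ℕ) ≤ t' + R ∧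
        (t' : ℕ) ≤ t + R := by
  induction γ using Monoid.CoprodI.induction_on with
  | one => exact ⟨0, fun L Ψ _ e t _ _ => ⟨t, by simp, by simp, by simp⟩⟩
  | of s g =>
    change G at g
    change ∃ R : ℕ, ∀ L Ψ, Good p (L+1) k Ψ → ∀ (e : S.E) (t : Fin (L+1)), R ≤ (t:ℕ) →
      t + R < L + 1 → ∃ t' : Fin (L+1), S.extA L Ψ (gen s g) (e, t) = (S.α (gen s g) e, t') ∧
        (t:ℕ) ≤ t' + R ∧ (t' : ℕ) ≤ t + R
    refine ⟨3 * p, fun L Ψ hΨ e t h1 h2 => ?_⟩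
    rw [ext_gen]
    cases s
    · exact ⟨t, by simp [Phi]; rfl, by omega, by omega⟩
    · obtain ⟨a1, a2⟩ := hΨ.1 e t (by omega) (by omega)
      have b1 := abs_le.1 (hk e)
      have b2 := abs_le.1 (hk (S.α (gen true g) e))
      refine ⟨⟨((t : ℤ) - k e + k (S.α (gen true g) e)).toNat, by omega⟩, ?_, ?_, ?_⟩
      · simp only [Phi, if_true]
        rw [Equiv.symm_apply_eq, a1]
        obtain ⟨c1, c2⟩ := hΨ.1 (S.α (gen true g) e)
          ⟨((t : ℤ) - k e + k (S.α (gen true g) e)).toNat, by omega⟩ (by simp only; omega)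
          (by simp only; omega)
        apply Prod.ext
        · exact c1.symm
        · apply Fin.ext
          simp only at c2 ⊢
          omega
      · simp only; omega
      · simp only; omega
  | mul γ δ ih1 ih2 =>
    obtain ⟨R1, h1⟩ := ih1
    obtain ⟨R2, h2⟩ := ih2
    refine ⟨R1 + R2, fun L Ψ hΨ e t a b => ?_⟩
    obtain ⟨t', c1, c2, c3⟩ := h2 L Ψ hΨ e t (by omega) (by omega)
    obtain ⟨t'', d1, d2, d3⟩ := h1 L Ψ hΨ (S.α δ e) t' (by omega) (by omega)
    refine ⟨t'', ?_, by omega, by omega⟩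
    rw [map_mul, Equiv.Perm.mul_apply, c1, d1]
    simp

lemma ext_label (p : ℕ) (k : S.E → ℤ) (hΨ : Good p (L+1) k Ψ) (e : S.E) (t : Fin (L+1))
    (h1 : p ≤ (t:ℕ)) (h2 : t + p < L + 1) (n : ℕ) (hn : n ≤ L) :
    (S.ext g0 L Ψ).l (e, t) n = S.l e n := by
  change S.extLabel g0 (L+1) Ψ (e, t) n = _
  unfold extLabel
  have := (hΨ.1 e t h1 h2).1
  split_ifs with a b c
  · rw [a]
  · rw [b, this]
  · rfl
  · omega
  · omega

lemma ext_coord (p : ℕ) (k : S.E → ℤ) (hk : ∀ e, |k e| ≤ p) (F : Finset (FP G × ℕ)) :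
    ∃ R : ℕ, ∀ L Ψ, Good p (L+1) k Ψ → ∀ (e : S.E) (t : Fin (L+1)), R ≤ (t:ℕ) → t + R < L + 1 →
      ∀ q ∈ F, (S.ext g0 L Ψ).pt (e, t) q = S.pt e q := by
  classical
  induction F using Finset.induction_on with
  | empty => exact ⟨0, by simp⟩
  | insert q F _ ih =>
    obtain ⟨R1, h1⟩ := ih
    obtain ⟨R2, h2⟩ := S.ext_shift p k hk q.1
    refine ⟨R1 + R2 + p + q.2, fun L Ψ hΨ e t a b q' hq' => ?_⟩
    rcases Finset.mem_insert.1 hq' with rfl | hq'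
    · obtain ⟨t', c1, c2, c3⟩ := h2 L Ψ hΨ e t (by omega) (by omega)
      unfold pt
      change (S.ext g0 L Ψ).l (S.extA L Ψ q'.1 (e, t)) q'.2 = _
      rw [c1]
      exact S.ext_label g0 L Ψ p k hΨ _ _ (by omega) (by omega) _ (by omega)
    · exact h1 L Ψ hΨ e t (by omega) (by omega) q' hq'

/-- Every vertex of an extended system has a marker coordinate. -/
lemma ext_marker (hg0 : g0 ≠ 1) :
    ∃ n : (S.ext g0 L Ψ).E → ℕ, ∀ x y, (S.ext g0 L Ψ).l y (n x) = g0 ↔ y = x := by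
  refine ⟨fun x => L + 1 + 2 + (Fintype.equivFin (S.E × Fin (L+1)) x : ℕ), fun x y => ?_⟩
  change S.extLabel g0 (L+1) Ψ y _ = g0 ↔ _
  unfold extLabel
  dsimp only
  rw [if_neg (by omega), if_neg (by omega), if_neg (by omega)]
  constructor
  · intro h
    split_ifs at h with h'
    · apply (Fintype.equivFin (S.E × Fin (L+1))).injective
      apply Fin.ext
      omega
    · exact absurd h.symm hg0
  · rintro rfl
    simp

lemma realize [Fintype G] [TopologicalSpace G] [DiscreteTopology G]
    (n : S.E → ℕ) (hn : ∀ x y, S.l y (n x) = g0 ↔ y = x)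
    (s : Bool) (u : S.E → ℝ) (hu : ∀ g e, u (S.α (gen s g) e) = u e) :
    ∃ w : C(Om G, ℝ), (∀ g x, w (act (gen s g) x) = w x) ∧ ∀ e, w (S.pt e) = u e := by
  classical
  let h : Om G → ℝ := fun x => ∑ e, u e * (if x (1, n e) = g0 then 1 else 0)
  have hh : Continuous h := by
    refine continuous_finsetSum _ fun e _ => continuous_const.mul ?_
    exact (continuous_of_discreteTopology (f := fun a : G => if a = g0 then (1:ℝ) else 0)).comp
      (continuous_apply (1, n e))
  have hpt : ∀ e, h (S.pt e) = u e := by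
    intro e
    simp only [h, pt, map_one, Equiv.Perm.one_apply, hn]
    simp
  have hact : ∀ γ : FP G, Continuous (act γ) := fun γ =>
    continuous_pi fun q => continuous_apply _
  refine ⟨⟨fun x => (Fintype.card G : ℝ)⁻¹ * ∑ g, h (act (gen s g) x), ?_⟩, ?_, ?_⟩
  · exact continuous_const.mul (continuous_finsetSum _ fun g _ => hh.comp (hact _))
  · intro g x
    simp only [ContinuousMap.coe_mk, ← act_mul, ← map_mul]
    congr 1
    exact Equiv.sum_comp (Equiv.mulRight g) (fun a => h (act (gen s a) x))
  · intro e
    simp [act_pt, hpt, hu]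

end FS
end KunTreeing
end

section
set_option linter.unusedSectionVars false
set_option linter.unusedVariables false
set_option linter.unusedSimpArgs false
open MeasureTheory Filter Topology

namespace KunTreeing

lemma avg_le {E : Type} [Fintype E] [Nonempty E] (N R : ℕ) (hN : 0 < N) (h : E × Fin N → ℝ) (B ε : ℝ)
    (hB0 : 0 ≤ B) (hε : 0 ≤ ε)
    (hB : ∀ x, h x ≤ B) (hR : ∀ e (t : Fin N), R ≤ (t:ℕ) → t + R < N → h (e, t) ≤ ε) :
    (Fintype.card (E × Fin N) : ℝ)⁻¹ * ∑ x, h x ≤ ε + B * (2 * R) / N := by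
  classical
  have h1 : ∀ e (t : Fin N), h (e, t) ≤ ε + B * ((if (t:ℕ) < R then 1 else 0) +
      (if N ≤ t + R then 1 else 0)) := by
    intro e t
    by_cases a : (t:ℕ) < R
    · have := hB (e, t)
      have : B * 0 ≤ B * (if N ≤ t + R then (1:ℝ) else 0) := by
        apply mul_le_mul_of_nonneg_left _ hB0
        split_ifs <;> norm_num
      rw [if_pos a, mul_add]
      linarith
    · by_cases b : N ≤ t + R
      · have := hB (e, t)
        rw [if_neg a, if_pos b]
        linarith
      · have := hR e t (by omega) (by omega)
        rw [if_neg a, if_neg b]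
        linarith
  have c1 : ∑ t : Fin N, (if (t:ℕ) < R then (1:ℝ) else 0) ≤ R := by
    rw [Fin.sum_univ_eq_sum_range (fun t => if t < R then (1:ℝ) else 0) N, Finset.sum_ite]
    simp only [Finset.sum_const, nsmul_eq_mul, mul_one, Finset.sum_const_zero, add_zero]
    have : (Finset.range N).filter (fun t => t < R) ⊆ Finset.range R := by
      intro t; simp
    have := Finset.card_le_card this
    simp only [Finset.card_range] at this
    exact_mod_cast this
  have c2 : ∑ t : Fin N, (if N ≤ (t:ℕ) + R then (1:ℝ) else 0) ≤ R := by
    rw [Fin.sum_univ_eq_sum_range (fun t => if N ≤ t + R then (1:ℝ) else 0) N, Finset.sum_ite]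
    simp only [Finset.sum_const, nsmul_eq_mul, mul_one, Finset.sum_const_zero, add_zero]
    have : (Finset.range N).filter (fun t => N ≤ t + R) ⊆ Finset.Ico (N - R) N := by
      intro t; simp; omega
    have := Finset.card_le_card this
    simp only [Nat.card_Ico] at this
    have : ((Finset.range N).filter (fun t => N ≤ t + R)).card ≤ R := by omega
    exact_mod_cast this
  have h2 : ∀ e : E, ∑ t, h (e, t) ≤ N * ε + B * (2 * R) := by
    intro e
    calc ∑ t, h (e, t) ≤ ∑ t : Fin N, (ε + B * ((if (t:ℕ) < R then 1 else 0) +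
          (if N ≤ t + R then 1 else 0))) := Finset.sum_le_sum fun t _ => h1 e t
      _ = N * ε + B * (∑ t : Fin N, (if (t:ℕ) < R then (1:ℝ) else 0) +
          ∑ t : Fin N, (if N ≤ (t:ℕ) + R then (1:ℝ) else 0)) := by
        rw [Finset.sum_add_distrib, ← Finset.mul_sum, Finset.sum_add_distrib]
        simp
      _ ≤ N * ε + B * (2 * R) := by
        have := mul_le_mul_of_nonneg_left (add_le_add c1 c2) hB0
        linarith
  have h3 : ∑ x, h x ≤ Fintype.card E * (N * ε + B * (2 * R)) := by
    rw [Fintype.sum_prod_type]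
    calc ∑ e, ∑ t, h (e, t) ≤ ∑ e : E, (N * ε + B * (2 * R)) := Finset.sum_le_sum fun e _ => h2 e
      _ = _ := by simp; ring
  have hE : (0:ℝ) < Fintype.card E := by exact_mod_cast Fintype.card_pos
  have hN' : (0:ℝ) < N := by exact_mod_cast hN
  rw [Fintype.card_prod, Fintype.card_fin]
  push_cast
  rw [inv_mul_le_iff₀ (by positivity)]
  refine h3.trans (le_of_eq ?_)
  field_simp

lemma avg_tendsto {E : Type} [Fintype E] [Nonempty E] (h : ∀ L : ℕ, E × Fin (L+1) → ℝ) (B : ℝ)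
    (hB0 : 0 ≤ B) (h0 : ∀ L x, 0 ≤ h L x) (hB : ∀ L x, h L x ≤ B)
    (hR : ∀ ε > 0, ∃ R : ℕ, ∀ L e (t : Fin (L+1)), R ≤ (t:ℕ) → t + R < L+1 → h L (e, t) ≤ ε) :
    Tendsto (fun L => (Fintype.card (E × Fin (L+1)) : ℝ)⁻¹ * ∑ x, h L x) atTop (𝓝 0) := by
  rw [Metric.tendsto_atTop]
  intro ε hε
  obtain ⟨R, hR⟩ := hR (ε/2) (by positivity)
  have ht : Tendsto (fun L : ℕ => (B * (2 * R)) / ((L + 1 : ℕ) : ℝ)) atTop (𝓝 0) :=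
    (tendsto_const_div_atTop_nhds_zero_nat _).comp (tendsto_add_atTop_nat 1)
  obtain ⟨N, hN⟩ := (Metric.tendsto_atTop.1 ht) (ε/2) (by positivity)
  refine ⟨N, fun L hL => ?_⟩
  have a := hN L hL
  have b := avg_le (L+1) R (by omega) (h L) B (ε/2) hB0 (by positivity) (hB L) (hR L)
  rw [Real.dist_eq, sub_zero] at a ⊢
  have c := (abs_lt.1 a).2
  have d : 0 ≤ (Fintype.card (E × Fin (L+1)) : ℝ)⁻¹ * ∑ x, h L x :=
    mul_nonneg (by positivity) (Finset.sum_nonneg fun x _ => h0 L x)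
  rw [abs_of_nonneg d]
  linarith

variable {G : Type} [Group G] [Fintype G] [TopologicalSpace G] [DiscreteTopology G]
  [MeasurableSpace G] [BorelSpace G]

lemma continuous_act (γ : FP G) : Continuous (act γ) :=
  continuous_pi fun q => continuous_apply _

namespace FS
variable (S : FS G)

/-- The empirical measure, as a measure. -/
noncomputable def empM : Measure (Om G) :=
  ENNReal.ofReal ((Fintype.card S.E : ℝ)⁻¹) • ∑ e, Measure.dirac (S.pt e)

instance : IsProbabilityMeasure S.empM := by
  constructor
  have : (Fintype.card S.E : ℝ) ≠ 0 := by exact_mod_cast Fintype.card_ne_zero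
  simp only [empM, Measure.smul_apply, Measure.finsetSum_apply, measure_univ, smul_eq_mul]
  simp only [Finset.sum_const, Finset.card_univ, nsmul_eq_mul, mul_one]
  rw [← ENNReal.ofReal_natCast, ← ENNReal.ofReal_mul (by positivity), inv_mul_cancel₀ this]
  simp

/-- The empirical measure. -/
noncomputable def emp : ProbabilityMeasure (Om G) := ⟨S.empM, inferInstance⟩

lemma integral_emp (φ : Om G → ℝ) (hφ : Continuous φ) :
    ∫ x, φ x ∂(S.emp : Measure (Om G)) = (Fintype.card S.E : ℝ)⁻¹ * ∑ e, φ (S.pt e) := by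
  change ∫ x, φ x ∂S.empM = _
  unfold empM
  rw [integral_smul_measure, integral_finsetSum_measure]
  · simp only [integral_dirac]
    rw [ENNReal.toReal_ofReal (by positivity), smul_eq_mul]
  · intro e _
    refine integrable_dirac ?_
    simp

variable (g0 : G)

lemma ext_cont (p : ℕ) (k : S.E → ℤ) (hk : ∀ e, |k e| ≤ p) (φ : Om G → ℝ) (hφ : Continuous φ)
    (ε : ℝ) (hε : 0 < ε) :
    ∃ R : ℕ, ∀ L Ψ, Good p (L+1) k Ψ → ∀ (e : S.E) (t : Fin (L+1)), R ≤ (t:ℕ) → t + R < L + 1 →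
      |φ ((S.ext g0 L Ψ).pt (e, t)) - φ (S.pt e)| < ε := by
  classical
  have h1 : ∀ e, ∃ F : Finset (FP G × ℕ), ∀ y : Om G, (∀ q ∈ F, y q = S.pt e q) →
      |φ y - φ (S.pt e)| < ε := by
    intro e
    have : {y : Om G | |φ y - φ (S.pt e)| < ε} ∈ 𝓝 (S.pt e) :=
      hφ.continuousAt (Metric.ball_mem_nhds _ hε)
    rw [nhds_pi, Filter.mem_pi] at this
    obtain ⟨I, hI, t, ht, hs⟩ := this
    refine ⟨hI.toFinset, fun y hy => hs fun q hq => ?_⟩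
    rw [hy q (by simpa using hq)]
    exact mem_of_mem_nhds (ht q)
  choose F hF using h1
  obtain ⟨R, hR⟩ := S.ext_coord g0 p k hk (Finset.univ.biUnion F)
  refine ⟨R, fun L Ψ hΨ e t a b => hF e _ fun q hq => hR L Ψ hΨ e t a b q ?_⟩
  exact Finset.mem_biUnion.2 ⟨e, Finset.mem_univ _, hq⟩

lemma emp_tendsto (p : ℕ) (k : S.E → ℤ) (hk : ∀ e, |k e| ≤ p)
    (Ψ : ∀ L, Equiv.Perm (S.E × Fin (L+1))) (hΨ : ∀ L, Good p (L+1) k (Ψ L)) :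
    Tendsto (fun L => (S.ext g0 L (Ψ L)).emp) atTop (𝓝 S.emp) := by
  rw [ProbabilityMeasure.tendsto_iff_forall_integral_tendsto]
  intro φ
  have key := avg_tendsto (fun L (x : S.E × Fin (L+1)) =>
    |φ ((S.ext g0 L (Ψ L)).pt x) - φ (S.pt x.1)|) (2 * ‖φ‖) (by positivity)
    (fun L x => abs_nonneg _) ?_ ?_
  · rw [tendsto_iff_norm_sub_tendsto_zero]
    refine squeeze_zero (fun L => norm_nonneg _) (fun L => ?_) key
    rw [integral_emp _ _ φ.continuous, integral_emp _ _ φ.continuous]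
    change |(Fintype.card (S.E × Fin (L+1)) : ℝ)⁻¹ *
      ∑ x : S.E × Fin (L+1), φ ((S.ext g0 L (Ψ L)).pt x) - _| ≤ _
    have : (Fintype.card S.E : ℝ)⁻¹ * ∑ e, φ (S.pt e) =
        (Fintype.card (S.E × Fin (L+1)) : ℝ)⁻¹ * ∑ x : S.E × Fin (L+1), φ (S.pt x.1) := by
      rw [Fintype.sum_prod_type]
      simp only [Finset.sum_const, Finset.card_univ, Fintype.card_fin, Fintype.card_prod,
        nsmul_eq_mul, ← Finset.mul_sum]
      have : (Fintype.card S.E : ℝ) ≠ 0 := by exact_mod_cast Fintype.card_ne_zero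
      push_cast
      field_simp
    rw [this, ← mul_sub, ← Finset.sum_sub_distrib, abs_mul, abs_of_nonneg (by positivity)]
    exact mul_le_mul_of_nonneg_left (Finset.abs_sum_le_sum_abs _ _) (by positivity)
  · intro L x
    have := φ.dist_le_two_norm ((S.ext g0 L (Ψ L)).pt x) (S.pt x.1)
    rwa [Real.dist_eq] at this
  · intro ε hε
    obtain ⟨R, hR⟩ := S.ext_cont g0 p k hk φ φ.continuous ε hε
    exact ⟨R, fun L e t a b => (hR L _ (hΨ L) e t a b).le⟩

end FS

/-- Good approximability of a function. -/
def UU (f : Om G → ℝ) (ε : ℝ) : Set (ProbabilityMeasure (Om G)) :=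
  {μ | ∃ w : Bool → C(Om G, ℝ), (∀ s g x, w s (act (gen s g) x) = w s x) ∧
    ∫ x, |f x - (w false x + w true x)| ∂(μ : Measure (Om G)) < ε}

lemma UU_open (f : Om G → ℝ) (hf : Continuous f) (ε : ℝ) : IsOpen (UU f ε) := by
  have : UU f ε = ⋃ (w : Bool → C(Om G, ℝ)) (_ : ∀ s g x, w s (act (gen s g) x) = w s x),
      {μ : ProbabilityMeasure (Om G) |
        ∫ x, |f x - (w false x + w true x)| ∂(μ : Measure (Om G)) < ε} := by
    ext μ; simp [UU]
  rw [this]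
  refine isOpen_iUnion fun w => isOpen_iUnion fun _ => ?_
  have := ProbabilityMeasure.continuous_integral_continuousMap
    (⟨fun x => |f x - (w false x + w true x)|, by fun_prop⟩ : C(Om G, ℝ))
  exact isOpen_lt this continuous_const

lemma UU_dense (g0 : G) (hg0 : g0 ≠ 1) (S : FS G) (f : Om G → ℝ) (hf : Continuous f)
    (hf01 : ∀ x, f x = 0 ∨ f x = 1) (ε : ℝ) (hε : 0 < ε) :
    S.emp ∈ closure (Set.range (FS.emp (G := G)) ∩ UU f ε) := by
  classical
  set p := Fintype.card S.E with hp
  have hp0 : 0 < p := Fintype.card_pos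
  let f0 : S.E → ℤ := fun e => if f (S.pt e) = 0 then 0 else 1
  have hf0 : ∀ e, (f0 e : ℝ) = f (S.pt e) := by
    intro e
    rcases hf01 (S.pt e) with h | h <;> simp [f0, h]
  have b0 : ∀ e, 0 ≤ f0 e ∧ f0 e ≤ 1 := by
    intro e; simp only [f0]; split_ifs <;> simp
  let σ : ℤ := ∑ e, f0 e
  have hσ0 : 0 ≤ σ := Finset.sum_nonneg fun e _ => (b0 e).1
  have hσ1 : σ ≤ p := by
    calc σ ≤ ∑ e : S.E, 1 := Finset.sum_le_sum fun e _ => (b0 e).2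
      _ = p := by simp [hp]
  let k : S.E → ℤ := fun e => p * f0 e - σ
  have hk : ∀ e, |k e| ≤ p := by
    intro e
    rw [abs_le]
    simp only [k]
    constructor <;> nlinarith [(b0 e).1, (b0 e).2]
  have hs : ∑ e, k e = 0 := by
    simp only [k, Finset.sum_sub_distrib, ← Finset.mul_sum]
    simp [hp, σ]
  choose Ψ hΨ using fun L => exists_good p (L+1) k hk hs
  have ht := S.emp_tendsto g0 p k hk Ψ hΨ
  have hp' : (0:ℝ) < p := by exact_mod_cast hp0
  let uf : ∀ L, S.E × Fin (L+1) → ℝ := fun L x => (σ + (x.2 : ℕ)) / p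
  let ut : ∀ L, S.E × Fin (L+1) → ℝ := fun L x => - (((Ψ L x).2 : ℕ) : ℝ) / p
  have key := avg_tendsto (fun L (x : S.E × Fin (L+1)) =>
    |f ((S.ext g0 L (Ψ L)).pt x) - (uf L x + ut L x)|) 4 (by norm_num)
    (fun L x => abs_nonneg _) ?_ ?_
  · refine mem_closure_of_tendsto ht ?_
    filter_upwards [key.eventually_lt_const hε] with L hL
    refine ⟨⟨_, rfl⟩, ?_⟩
    obtain ⟨n, hn⟩ := S.ext_marker g0 L (Ψ L) hg0
    have hut : ∀ g (x : (S.ext g0 L (Ψ L)).E),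
        ut L ((S.ext g0 L (Ψ L)).α (gen true g) x) = ut L x := by
      intro g (x : S.E × Fin (L+1))
      change ut L (S.extA L (Ψ L) (gen true g) x) = ut L x
      rw [S.ext_gen L (Ψ L) true g x]
      simp [ut, FS.Phi]
    have huf : ∀ g (x : (S.ext g0 L (Ψ L)).E),
        uf L ((S.ext g0 L (Ψ L)).α (gen false g) x) = uf L x := by
      intro g (x : S.E × Fin (L+1))
      change uf L (S.extA L (Ψ L) (gen false g) x) = uf L x
      rw [S.ext_gen L (Ψ L) false g x]
      rfl
    obtain ⟨w0, i0, r0⟩ := (S.ext g0 L (Ψ L)).realize g0 n hn false (uf L) huf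
    obtain ⟨w1, i1, r1⟩ := (S.ext g0 L (Ψ L)).realize g0 n hn true (ut L) hut
    refine ⟨fun s => if s then w1 else w0, ?_, ?_⟩
    · intro s g x
      cases s
      · exact i0 g x
      · exact i1 g x
    · rw [FS.integral_emp]
      · simp only [if_true, Bool.false_eq_true, if_false, r0, r1]
        exact hL
      · simp only [if_true, Bool.false_eq_true, if_false]
        fun_prop
  · intro L x
    have h2 := abs_le.1 ((hΨ L).2 x)
    have a1 : (((Ψ L x).2 : ℕ) : ℝ) ≤ (x.2 : ℕ) + 2 * p := by
      have : (((Ψ L x).2 : ℕ) : ℤ) ≤ (x.2 : ℕ) + 2 * p := by linarith [h2.2]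
      exact_mod_cast this
    have a2 : ((x.2 : ℕ) : ℝ) ≤ ((Ψ L x).2 : ℕ) + 2 * p := by
      have : ((x.2 : ℕ) : ℤ) ≤ ((Ψ L x).2 : ℕ) + 2 * p := by linarith [h2.1]
      exact_mod_cast this
    have c0 : (0:ℝ) ≤ σ := by exact_mod_cast hσ0
    have c1 : (σ:ℝ) ≤ p := by exact_mod_cast hσ1
    have d : uf L x + ut L x = (σ + (x.2 : ℕ) - ((Ψ L x).2 : ℕ)) / p := by
      simp only [uf, ut]; ring
    rw [d]
    have e1 : (σ + (x.2 : ℕ) - ((Ψ L x).2 : ℕ)) / (p:ℝ) ≤ 3 := by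
      rw [div_le_iff₀ hp']; linarith
    have e2 : -2 ≤ (σ + (x.2 : ℕ) - ((Ψ L x).2 : ℕ)) / (p:ℝ) := by
      rw [le_div_iff₀ hp']; linarith
    rw [abs_le]
    rcases hf01 ((S.ext g0 L (Ψ L)).pt x) with h | h <;> rw [h] <;> constructor <;> linarith
  · intro ε hε
    obtain ⟨R, hR⟩ := S.ext_cont g0 p k hk f hf ε hε
    refine ⟨R + p, fun L e t a b => ?_⟩
    have h1 := hR L _ (hΨ L) e t (by omega) (by omega)
    obtain ⟨_, h3⟩ := (hΨ L).1 e t (by omega) (by omega)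
    have h4 : (((Ψ L (e, t)).2 : ℕ) : ℝ) = (t : ℕ) - (p * f (S.pt e) - σ) := by
      rw [← hf0]
      exact_mod_cast h3
    have d : uf L (e, t) + ut L (e, t) = f (S.pt e) := by
      simp only [uf, ut, h4]
      field_simp
      ring
    simp only [d]
    exact h1.le

end KunTreeing
end

section
set_option linter.unusedSectionVars false
set_option linter.unusedVariables false
set_option linter.unusedSimpArgs false
open MeasureTheory Filter Topology

namespace KunTreeing

/-- Index set for cylinders. -/
abbrev Idx (G : Type) [Group G] : Type := Σ F : Finset (FP G × ℕ), Set (F → G)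

variable {G : Type} [Group G] [Fintype G] [TopologicalSpace G] [DiscreteTopology G]
  [MeasurableSpace G] [BorelSpace G]

/-- The cylinder. -/
def cyl (i : Idx G) : Set (Om G) := i.1.restrict ⁻¹' i.2

/-- The indicator function of a cylinder. -/
noncomputable def cf (i : Idx G) : Om G → ℝ := (cyl i).indicator (fun _ => 1)

lemma cf_cont (i : Idx G) : Continuous (cf i) := by
  have : cf i = (i.2.indicator (fun _ => (1:ℝ))) ∘ (i.1.restrict : Om G → (i.1 → G)) := by
    ext x
    rfl
  rw [this]
  exact continuous_of_discreteTopology.comp (by fun_prop)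

lemma cf_01 (i : Idx G) (x : Om G) : cf i x = 0 ∨ cf i x = 1 := by
  by_cases h : x ∈ cyl i <;> simp [cf, h]

lemma cyl_meas (i : Idx G) : MeasurableSet (cyl i) := by
  refine (Set.toFinite i.2).measurableSet.preimage ?_
  exact Finset.measurable_restrict _

lemma exists_measure (g0 : G) (hg0 : g0 ≠ 1) : ∃ μ : ProbabilityMeasure (Om G),
    (∀ γ, MeasurePreserving (act γ) (μ : Measure (Om G)) (μ : Measure (Om G))) ∧
    (∀ s g, ∀ᵐ x ∂(μ : Measure (Om G)), x (gen s g, cs s) = g * x (1, cs s)) ∧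
    ∀ (i : Idx G) (n : ℕ), μ ∈ UU (cf i) ((1/2 : ℝ) ^ n) := by
  let M : Set (ProbabilityMeasure (Om G)) := closure (Set.range (FS.emp (G := G)))
  have hM : IsClosed M := isClosed_closure
  have : CompactSpace M := isCompact_iff_compactSpace.1 hM.isCompact
  have hd : Dense (⋂ q : Idx G × ℕ, (Subtype.val ⁻¹' UU (cf q.1) ((1/2 : ℝ) ^ q.2) : Set M)) := by
    refine dense_iInter_of_isOpen (fun q => ?_) fun q => ?_
    · exact (UU_open _ (cf_cont q.1) _).preimage continuous_subtype_val
    · rw [Subtype.dense_iff]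
      refine closure_minimal ?_ isClosed_closure
      rintro _ ⟨S, rfl⟩
      refine closure_mono ?_ (UU_dense g0 hg0 S (cf q.1) (cf_cont q.1) (cf_01 q.1) _
        (by positivity : (0:ℝ) < (1/2 : ℝ) ^ q.2))
      rintro x ⟨h1, h2⟩
      exact ⟨⟨x, subset_closure h1⟩, h2, rfl⟩
  have : Nonempty M := ⟨⟨(FS.base G).emp, subset_closure ⟨_, rfl⟩⟩⟩
  obtain ⟨⟨μ, hμ⟩, hμ'⟩ := hd.nonempty
  refine ⟨μ, ?_, ?_, ?_⟩
  · intro γ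
    refine ⟨(continuous_act γ).measurable, ?_⟩
    have : IsProbabilityMeasure ((μ : Measure (Om G)).map (act γ)) :=
      Measure.isProbabilityMeasure_map (continuous_act γ).measurable.aemeasurable
    refine ext_of_forall_integral_eq_of_IsFiniteMeasure fun φ => ?_
    rw [integral_map (continuous_act γ).measurable.aemeasurable
      φ.continuous.aestronglyMeasurable]
    have hcl : IsClosed {μ : ProbabilityMeasure (Om G) |
        ∫ x, φ (act γ x) ∂(μ : Measure (Om G)) = ∫ x, φ x ∂(μ : Measure (Om G))} := by
      have a1 := ProbabilityMeasure.continuous_integral_continuousMap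
        (⟨fun x => φ (act γ x), φ.continuous.comp (continuous_act γ)⟩ : C(Om G, ℝ))
      have a2 := ProbabilityMeasure.continuous_integral_continuousMap
        (⟨fun x => φ x, φ.continuous⟩ : C(Om G, ℝ))
      exact isClosed_eq a1 a2
    refine closure_minimal ?_ hcl hμ
    rintro _ ⟨S, rfl⟩
    change ∫ x, φ (act γ x) ∂(S.emp : Measure (Om G)) = ∫ x, φ x ∂(S.emp : Measure (Om G))
    rw [S.integral_emp (fun x => φ (act γ x)) (φ.continuous.comp (continuous_act γ)), S.integral_emp _ φ.continuous]
    simp only [S.act_pt]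
    rw [Equiv.sum_comp (S.α γ) (fun e => φ (S.pt e))]
  · intro s g
    classical
    let f : Om G → ℝ := fun x => if x (gen s g, cs s) = g * x (1, cs s) then 0 else 1
    have hf : Continuous f := by
      have : f = (fun a : G × G => if a.1 = g * a.2 then (0:ℝ) else 1) ∘
        (fun x : Om G => (x (gen s g, cs s), x (1, cs s))) := rfl
      rw [this]
      exact continuous_of_discreteTopology.comp (by fun_prop)
    have hcl : IsClosed {μ : ProbabilityMeasure (Om G) | ∫ x, f x ∂(μ : Measure (Om G)) = 0} := by
      have a1 := ProbabilityMeasure.continuous_integral_continuousMap (⟨f, hf⟩ : C(Om G, ℝ))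
      exact isClosed_eq a1 continuous_const
    have h0 : ∫ x, f x ∂(μ : Measure (Om G)) = 0 := by
      refine closure_minimal ?_ hcl hμ
      rintro _ ⟨S, rfl⟩
      change ∫ x, f x ∂(S.emp : Measure (Om G)) = 0
      rw [S.integral_emp _ hf]
      have : ∀ e, f (S.pt e) = 0 := by
        intro e
        simp only [f, FS.pt, S.hl, map_one, Equiv.Perm.one_apply, if_true]
      simp [this]
    rw [integral_eq_zero_iff_of_nonneg] at h0
    · filter_upwards [h0] with x hx
      by_contra hne
      simp [f, hne] at hx
    · intro x
      simp only [f]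
      split_ifs <;> simp
    · exact (⟨f, hf⟩ : C(Om G, ℝ)).continuous.integrable_of_hasCompactSupport
        (HasCompactSupport.of_compactSpace _)
  · intro i n
    exact Set.mem_iInter.1 hμ' (i, n)

end KunTreeing
end

section
set_option linter.unusedSectionVars false
set_option linter.unusedVariables false
set_option linter.unusedSimpArgs false
open MeasureTheory Filter Topology

namespace KunTreeing

lemma ae_tendsto_of_half {α : Type} [MeasurableSpace α] (μ : Measure α) (f : ℕ → α → ℝ)
    (hi : ∀ n, Integrable (f n) μ) (h : ∀ n, ∫ x, |f n x| ∂μ < (1/2 : ℝ) ^ n) :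
    ∀ᵐ x ∂μ, Tendsto (fun n => f n x) atTop (𝓝 0) := by
  have h1 : ∫⁻ x, ∑' n, ‖f n x‖ₑ ∂μ < ⊤ := by
    rw [lintegral_tsum fun n => (hi n).1.enorm]
    calc ∑' n, ∫⁻ x, ‖f n x‖ₑ ∂μ ≤ ∑' n, ENNReal.ofReal ((1/2 : ℝ) ^ n) := by
          refine ENNReal.tsum_le_tsum fun n => ?_
          rw [← ofReal_integral_norm_eq_lintegral_enorm (hi n)]
          exact ENNReal.ofReal_le_ofReal (h n).le
      _ = ENNReal.ofReal (∑' n, (1/2 : ℝ) ^ n) :=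
          (ENNReal.ofReal_tsum_of_nonneg (fun n => by positivity) summable_geometric_two).symm
      _ < ⊤ := ENNReal.ofReal_lt_top
  have h2 := ae_lt_top' (AEMeasurable.tsum fun n => (hi n).1.enorm) h1.ne
  filter_upwards [h2] with x hx
  have := ENNReal.tendsto_atTop_zero_of_tsum_ne_top hx.ne
  rw [tendsto_zero_iff_norm_tendsto_zero]
  have := (ENNReal.tendsto_toReal ENNReal.zero_ne_top).comp this
  simpa [Function.comp_def] using this

variable {G : Type} [Group G] [Fintype G] [TopologicalSpace G] [DiscreteTopology G]
  [MeasurableSpace G] [BorelSpace G]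

lemma cyl_range : Set.range (cyl (G := G)) = measurableCylinders (fun _ : FP G × ℕ => G) := by
  ext s
  rw [mem_measurableCylinders]
  constructor
  · rintro ⟨i, rfl⟩
    exact ⟨i.1, i.2, (Set.toFinite _).measurableSet, rfl⟩
  · rintro ⟨F, S, _, rfl⟩
    exact ⟨⟨F, S⟩, rfl⟩

theorem exists_sys (g0 : G) (hg0 : g0 ≠ 1) : Nonempty (Sys G) := by
  classical
  obtain ⟨μ, hinv, hc, hU⟩ := exists_measure g0 hg0
  choose w winv wint using hU
  have hact : ∀ γ : FP G, Measurable (act γ) := fun γ => (continuous_act γ).measurable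
  let dd : Idx G → ℕ → Om G → ℝ := fun i n x => cf i x - (w i n false x + w i n true x)
  have ddc : ∀ i n, Continuous (dd i n) := fun i n =>
    (cf_cont i).sub ((w i n false).continuous.add (w i n true).continuous)
  have ddi : ∀ i n, Integrable (dd i n) (μ : Measure (Om G)) := fun i n =>
    (ddc i n).integrable_of_hasCompactSupport (HasCompactSupport.of_compactSpace _)
  let P0 : Set (Om G) := {x | (∀ s g, x (gen s g, cs s) = g * x (1, cs s)) ∧
    ∀ i, Tendsto (fun n => dd i n x) atTop (𝓝 0)}
  have hP0m : MeasurableSet P0 := by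
    refine MeasurableSet.inter (s₁ := {x : Om G | ∀ s g, x (gen s g, cs s) = g * x (1, cs s)})
      (s₂ := {x : Om G | ∀ i, Tendsto (fun n => dd i n x) atTop (𝓝 0)}) ?_ ?_
    · simp only [Set.ofPred_forall]
      refine MeasurableSet.iInter fun s => MeasurableSet.iInter fun g => ?_
      refine measurableSet_eq_fun (measurable_pi_apply _) ?_
      exact (measurable_of_finite (fun a : G => g * a)).comp (measurable_pi_apply _)
    · simp only [Set.ofPred_forall]
      refine MeasurableSet.iInter fun i => ?_
      exact measurableSet_tendsto _ fun n => (ddc i n).measurable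
  have hP0 : ∀ᵐ x ∂(μ : Measure (Om G)), x ∈ P0 := by
    have h1 : ∀ᵐ x ∂(μ : Measure (Om G)), ∀ s g, x (gen s g, cs s) = g * x (1, cs s) :=
      ae_all_iff.2 fun s => ae_all_iff.2 fun g => hc s g
    have h2 : ∀ᵐ x ∂(μ : Measure (Om G)), ∀ i, Tendsto (fun n => dd i n x) atTop (𝓝 0) :=
      ae_all_iff.2 fun i => ae_tendsto_of_half _ _ (ddi i) (wint i)
    filter_upwards [h1, h2] with x a b using ⟨a, b⟩
  let Y0 : Set (Om G) := {x | ∀ γ, act γ x ∈ P0}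
  have hY0m : MeasurableSet Y0 := by
    have : Y0 = ⋂ γ, act γ ⁻¹' P0 := by ext x; simp [Y0]
    rw [this]
    exact MeasurableSet.iInter fun γ => hact γ hP0m
  have hY0 : ∀ᵐ x ∂(μ : Measure (Om G)), x ∈ Y0 :=
    ae_all_iff.2 fun γ => (hinv γ).quasiMeasurePreserving.ae hP0
  have hY0P : ∀ x ∈ Y0, x ∈ P0 := fun x hx => by
    have := hx 1
    rwa [act_one] at this
  have hY0a : ∀ γ, ∀ x ∈ Y0, act γ x ∈ Y0 := fun γ x hx δ => by
    rw [← act_mul]; exact hx _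
  let μY : Measure Y0 := (μ : Measure (Om G)).comap Subtype.val
  have hval : MeasurePreserving (Subtype.val : Y0 → Om G) μY (μ : Measure (Om G)) := by
    have := measurePreserving_subtype_coe (μa := (μ : Measure (Om G))) hY0m
    rwa [Measure.restrict_eq_self_of_ae_mem hY0] at this
  have hemb : MeasurableEmbedding (Subtype.val : Y0 → Om G) := MeasurableEmbedding.subtype_coe hY0m
  let m : Bool → G → Y0 → Y0 := fun s g y => ⟨act (gen s g) y.1, hY0a _ _ y.2⟩
  have hmm : ∀ s g, Measurable (m s g) := fun s g =>
    ((hact _).comp measurable_subtype_coe).subtype_mk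
  have m_mul : ∀ s g h y, m s (g * h) y = m s g (m s h y) := fun s g h y =>
    Subtype.ext (by simp only [m, map_mul, act_mul])
  have m_one : ∀ s y, m s 1 y = y := fun s y => Subtype.ext (by simp only [m, map_one, act_one])
  let c : Bool → Y0 → G := fun s y => y.1 (1, cs s)
  have hcm : ∀ s, Measurable (c s) := fun s => (measurable_pi_apply _).comp measurable_subtype_coe
  have c_m : ∀ s g y, c s (m s g y) = g * c s y := by
    intro s g y
    have := (hY0P _ y.2).1 s g
    simpa [c, m, act] using this
  have hpr : IsProbabilityMeasure μY := by
    constructor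
    have := hval.measure_preimage (s := Set.univ) MeasurableSet.univ.nullMeasurableSet
    rw [Set.preimage_univ] at this
    rw [this]
    simp
  have hrm : ∀ s, Measurable (fun y => m s (c s y)⁻¹ y) := by
    intro s
    have h1 : Measurable (fun q : G × Y0 => m s q.1 q.2) :=
      measurable_from_prod_countable_right fun g => hmm s g
    have h2 : Measurable (fun y => ((c s y)⁻¹, y)) :=
      ((measurable_of_finite (fun a : G => a⁻¹)).comp (hcm s)).prodMk measurable_id
    exact h1.comp h2
  let Vs : Set (Y0 × Bool) := {p | c p.2 p.1 = 1}
  have hVs : MeasurableSet Vs := by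
    have : Measurable (fun p : Y0 × Bool => c p.2 p.1) :=
      measurable_from_prod_countable_left fun s => hcm s
    exact this (measurableSet_singleton 1)
  have sbY : StandardBorelSpace Y0 := hY0m.standardBorel
  have sbV : StandardBorelSpace Vs := hVs.standardBorel
  let v : Bool → Y0 → Vs := fun s y => ⟨(m s (c s y)⁻¹ y, s), by
    change c s (m s (c s y)⁻¹ y) = 1
    rw [c_m]; simp⟩
  have wv : ∀ i n s y, w i n s (m s (c s y)⁻¹ y).1 = w i n s y.1 := fun i n s y => winv i n s _ _
  refine ⟨{
    Y := Y0
    V := Vs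
    ι := Idx G
    sbY := sbY
    sbV := sbV
    μ := μY
    pr := hpr
    v := v
    v_meas := fun s => ((hrm s).prodMk measurable_const).subtype_mk
    side := fun p => p.1.2
    side_meas := measurable_snd.comp measurable_subtype_coe
    side_v := fun s y => rfl
    r := fun p => p.1.1
    r_meas := measurable_fst.comp measurable_subtype_coe
    v_r := ?_
    m := m
    m_mp := ?_
    fib := ?_
    m_inj := ?_
    w := fun i n p => w i n p.1.2 p.1.1.1
    w_meas := ?_
    w_bdd := ?_
    C := fun i => Subtype.val ⁻¹' cyl i
    C_meas := fun i => measurable_subtype_coe (cyl_meas i)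
    lim := ?_
    limL1 := ?_
    sep := ?_
    pi := ?_
    gen := ?_
    univ_mem := ⟨⟨∅, Set.univ⟩, by ext; simp [cyl]⟩ }⟩
  · rintro ⟨⟨y, s⟩, h⟩
    have h' : c s y = 1 := h
    apply Subtype.ext
    change (m s (c s y)⁻¹ y, s) = (y, s)
    rw [h', inv_one, m_one]
  · intro s g
    refine ⟨hmm s g, ?_⟩
    refine Measure.ext fun B hB => ?_
    obtain ⟨B', hB', rfl⟩ := hB
    rw [Measure.map_apply (hmm s g) (measurable_subtype_coe hB'),
      hval.measure_preimage hB'.nullMeasurableSet]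
    exact ((hinv (gen s g)).comp hval).measure_preimage hB'.nullMeasurableSet
  · intro s y y'
    constructor
    · intro h
      have h' : m s (c s y)⁻¹ y = m s (c s y')⁻¹ y' := congrArg (fun p : Vs => p.1.1) h
      refine ⟨c s y' * (c s y)⁻¹, ?_⟩
      rw [m_mul, h', ← m_mul, mul_inv_cancel, m_one]
    · rintro ⟨g, rfl⟩
      apply Subtype.ext
      change (m s (c s y)⁻¹ y, s) = (m s (c s (m s g y))⁻¹ (m s g y), s)
      rw [c_m, ← m_mul]
      simp
  · intro s y g g' h
    have := congrArg (c s) h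
    simp only [c_m] at this
    exact mul_right_cancel this
  · intro i n
    have : Measurable (fun p : Y0 × Bool => w i n p.2 p.1.1) :=
      measurable_from_prod_countable_left fun s =>
        (w i n s).continuous.measurable.comp measurable_subtype_coe
    exact this.comp measurable_subtype_coe
  · intro i n
    refine ⟨‖w i n false‖ + ‖w i n true‖, fun p => ?_⟩
    have h0 := norm_nonneg (w i n false)
    have h1 := norm_nonneg (w i n true)
    have := (w i n p.1.2).norm_coe_le_norm p.1.1.1
    rw [Real.norm_eq_abs] at this
    refine this.trans ?_
    cases p.1.2 <;> linarith
  · intro i y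
    have := ((hY0P _ y.2).2 i).const_sub (cf i y.1)
    simp only [dd, sub_sub_cancel, sub_zero] at this
    simp only [v, wv]
    exact this
  · intro i
    simp only [v, wv]
    have h1 : ∀ n, ∫ y : Y0, |dd i n y.1| ∂μY = ∫ x, |dd i n x| ∂(μ : Measure (Om G)) :=
      fun n => hval.integral_comp hemb (fun x => |dd i n x|)
    change Tendsto (fun n => ∫ y : Y0, |dd i n y.1| ∂μY) atTop (𝓝 0)
    simp only [h1]
    exact squeeze_zero (fun n => integral_nonneg fun x => abs_nonneg _) (fun n => (wint i n).le)
      (tendsto_pow_atTop_nhds_zero_of_lt_one (by norm_num) (by norm_num))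
  · intro Z y hy
    have h1 : ∀ z : Y0, z ≠ y → ∃ q, z.1 q ≠ y.1 q := fun z hz => by
      by_contra hh
      push Not at hh
      exact hz (Subtype.ext (funext hh))
    let q : Y0 → FP G × ℕ := fun z => if h : z ≠ y then (h1 z h).choose else (1, 0)
    have hq : ∀ z, z ≠ y → z.1 (q z) ≠ y.1 (q z) := fun z hz => by
      simp only [q, dif_pos hz]
      exact (h1 z hz).choose_spec
    refine ⟨⟨Z.image q, {(Z.image q).restrict y.1}⟩, ?_, ?_⟩
    · simp [cyl]
    · intro z hz hzc
      have hzc' : (Z.image q).restrict z.1 = (Z.image q).restrict y.1 := hzc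
      refine hq z (fun h => hy (h ▸ hz)) ?_
      exact congrFun hzc' ⟨q z, Finset.mem_image_of_mem q hz⟩
  · have := (isPiSystem_measurableCylinders (α := fun _ : FP G × ℕ => G)).comap
      (Subtype.val : Y0 → Om G)
    rw [← cyl_range] at this
    convert this using 1
    ext B
    simp
  · have h1 : (MeasurableSpace.pi : MeasurableSpace (Om G)) =
        MeasurableSpace.generateFrom (Set.range (cyl (G := G))) := by
      rw [cyl_range, generateFrom_measurableCylinders]
    change MeasurableSpace.comap Subtype.val MeasurableSpace.pi = _
    rw [h1, MeasurableSpace.comap_generateFrom, ← Set.range_comp]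
    rfl

end KunTreeing
end

namespace KunTreeing

theorem exists_sys_card (d : ℕ) (hd : 2 ≤ d) : ∃ (G : Type) (_ : Fintype G),
    Fintype.card G = d ∧ Nonempty (Sys G) := by
  have : NeZero d := ⟨by omega⟩
  refine ⟨Multiplicative (ZMod d), inferInstance, ?_, ?_⟩
  · rw [Fintype.card_multiplicative, ZMod.card]
  · let _ : TopologicalSpace (Multiplicative (ZMod d)) := ⊥
    have : DiscreteTopology (Multiplicative (ZMod d)) := ⟨rfl⟩
    let _ : MeasurableSpace (Multiplicative (ZMod d)) := borel _
    have : BorelSpace (Multiplicative (ZMod d)) := ⟨rfl⟩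
    have : Nontrivial (Multiplicative (ZMod d)) := Fintype.one_lt_card_iff_nontrivial.1 (by
      rw [Fintype.card_multiplicative, ZMod.card]; omega)
    obtain ⟨g0, hg0⟩ := exists_ne (1 : Multiplicative (ZMod d))
    exact exists_sys g0 hg0

end KunTreeing

/-- For every `d ≥ 2` there is a `d`-regular measurably bipartite treeing `T` admitting
no free pmp `ℤ`-action whose Schreier graphing is a subgraphing of `T` of positive
measure: there is no Borel set `A` of positive measure together with a Borel
measure-preserving bijection `S : A → A` (with Borel inverse `S'`) which is a.e. free
(`Sⁿx ≠ x` for all integers `n ≠ 0`) and satisfies `(x, Sx) ∈ E(T)` a.e. on `A`. -/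
theorem exists_treeing_no_free_Z_subaction :
    ∀ d : ℕ, 2 ≤ d → ∃ T : Graphing,
      T.IsRegular d ∧ T.Acyclic ∧ T.MeasurablyBipartite ∧
      ¬ ∃ (A : Set T.V) (S S' : T.V → T.V),
          MeasurableSet A ∧ 0 < T.ν A ∧
          Measurable S ∧ Measurable S' ∧
          Set.MapsTo S A A ∧ Set.MapsTo S' A A ∧
          (∀ x ∈ A, S' (S x) = x) ∧ (∀ x ∈ A, S (S' x) = x) ∧
          (∀ B : Set T.V, B ⊆ A → MeasurableSet B → T.ν (S ⁻¹' B ∩ A) = T.ν B) ∧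
          (∀ᵐ x ∂T.ν, x ∈ A →
            (∀ n : ℕ, 0 < n → S^[n] x ≠ x ∧ S'^[n] x ≠ x) ∧ (x, S x) ∈ T.E) := by
  intro d hd
  obtain ⟨G, _, hcard, ⟨K⟩⟩ := KunTreeing.exists_sys_card d hd
  refine ⟨K.T, ?_, K.T_acyc, K.T_bip, ?_⟩
  · have := K.T_reg
    rwa [hcard] at this
  · rintro ⟨A, S, S', hA, hpos, hS, hS', mS, mS', i1, i2, mp, fr⟩
    exact K.T_no (by omega) A S S' hA hpos hS hS' mS mS' i1 i2 mp fr
end
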